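/- The positive integers x, y with gcd(x, y) = 1, the non-negative integer ℓ and the integer n ≥ 3 satisfy x² + 11^ℓ = y^n if and only if n = 3 and (x, y, ℓ) is one of the four tuples (4, 3, 1), (58, 15, 1), (2, 5, 2), (9324, 443, 3). -/

import Mathlib

theorem det_eq_zero_of_two_rows_proportional {n R : Type*} [Fintype n] [DecidableEq n] [CommRing R]
    (M : Matrix n n R) {i i' : n} (hne : i ≠ i') (c c' : R) (v : n → R)
    (hi : M i = c • v) (hi' : M i' = c' • v) : M.det = 0 := by
  have h : M = (M.updateRow i (c • v)).updateRow i' (c' • v) := by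
    rw [← hi, ← hi']
    ext a b
    by_cases h1 : a = i'
    · subst h1; simp
    · by_cases h2 : a = i
      · subst h2; simp [h1]
      · simp [h1]
  rw [h, Matrix.det_updateRow_smul, Matrix.updateRow_comm _ hne, Matrix.det_updateRow_smul,
    Matrix.det_zero_of_row_eq hne, mul_zero, mul_zero]
  simp [hne.symm]

theorem half_mul_pred_le_sum_of_injOn_lt {N : ℕ} (f : Fin N → Fin (N + 1))
    (hf : ∀ i i', i ≠ i' → f i = f i' → N ≤ (f i : ℕ)) :
    N * (N - 1) / 2 ≤ ∑ i, (f i : ℕ) := by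
  classical
  let S := Finset.univ.filter fun i => (f i : ℕ) < N
  have hinj : Set.InjOn (fun i => (f i : ℕ)) S := by
    intro i hi j hj h
    by_contra hne
    have := hf i j hne (Fin.ext h)
    simp [S] at hi
    omega
  let I := S.image fun i => (f i : ℕ)
  have hI : I ⊆ Finset.range N := by
    intro m hm
    obtain ⟨i, hi, rfl⟩ := Finset.mem_image.1 hm
    simpa [S] using hi
  have hcard : I.card = S.card := Finset.card_image_of_injOn hinj
  have h1 : ∑ m ∈ I, m = ∑ i ∈ S, (f i : ℕ) := Finset.sum_image hinj
  have h2 : ∑ m ∈ Finset.range N \ I, m ≤ (N - S.card) * N := by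
    rw [← hcard, ← smul_eq_mul]
    have : (Finset.range N \ I).card = N - I.card := by
      rw [Finset.card_sdiff_of_subset hI, Finset.card_range]
    rw [← this]
    refine Finset.sum_le_card_nsmul _ _ _ fun m hm => ?_
    have := (Finset.mem_sdiff.1 hm).1
    simp at this; omega
  have h3 : ∑ i ∈ Sᶜ, (f i : ℕ) = (N - S.card) * N := by
    have hc : Sᶜ.card = N - S.card := by rw [Finset.card_compl, Fintype.card_fin]
    rw [← hc, ← smul_eq_mul]
    refine Finset.sum_eq_card_nsmul fun i hi => ?_
    simp [S] at hi
    omega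
  rw [← Finset.sum_range_id, ← Finset.sum_sdiff hI, ← Finset.sum_add_sum_compl S, h1, h3]
  omega

/-- A determinant whose rows are small perturbations of combinations, with geometrically decaying
coefficients, of common vectors. -/
theorem norm_det_le_of_rows_approx {N : ℕ} (ρ : ℝ) (hρ : 1 ≤ ρ) (M : Matrix (Fin N) (Fin N) ℂ)
    (A : Fin N → ℝ) (hA : ∀ i, 0 ≤ A i) (x : Fin N → ℕ → ℂ) (q : ℕ → Fin N → ℂ)
    (hx : ∀ i m, ‖x i m‖ ≤ A i * (ρ ^ m)⁻¹) (hq : ∀ m j, ‖q m j‖ ≤ 1)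
    (ht : ∀ i j, ‖M i j - ∑ m ∈ Finset.range N, x i m * q m j‖ ≤ A i * (ρ ^ N)⁻¹) :
    ‖M.det‖ ≤ (N + 1 : ℝ) ^ N * N.factorial * (∏ i, A i) * (ρ ^ (N * (N - 1) / 2))⁻¹ := by
  classical
  have hρ0 : 0 < ρ := by linarith
  let w : Fin N → Fin (N + 1) → Fin N → ℂ := fun i m =>
    if (m : ℕ) < N then fun j => x i m * q m j
    else fun j => M i j - ∑ m ∈ Finset.range N, x i m * q m j
  have hM : M = fun i => ∑ m, w i m := by
    funext i j
    rw [Finset.sum_apply, Fin.sum_univ_castSucc]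
    simp [w, Finset.sum_range]
  have hw : ∀ i m j, ‖w i m j‖ ≤ A i * (ρ ^ (m : ℕ))⁻¹ := by
    intro i m j
    by_cases h : (m : ℕ) < N
    · simp only [w, h, if_true, norm_mul]
      calc _ ≤ (A i * (ρ ^ (m : ℕ))⁻¹) * 1 := by
            gcongr
            · exact mul_nonneg (hA i) (by positivity)
            · exact hx i m
            · exact hq m j
        _ = _ := mul_one _
    · have : (m : ℕ) = N := by omega
      simp only [w, h, if_false]
      rw [this]; exact ht i j
  have hdet : M.det = ∑ f : Fin N → Fin (N + 1), Matrix.det (fun i => w i (f i)) := by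
    conv_lhs => rw [hM]
    exact (Matrix.detRowAlternating (R := ℂ) (n := Fin N)).toMultilinearMap.map_sum w
  have hterm : ∀ f : Fin N → Fin (N + 1), ‖Matrix.det (fun i => w i (f i))‖ ≤
      N.factorial * (∏ i, A i) * (ρ ^ (N * (N - 1) / 2))⁻¹ := by
    intro f
    by_cases hf : ∃ i i', i ≠ i' ∧ f i = f i' ∧ (f i : ℕ) < N
    · obtain ⟨i, i', hne, hff, hlt⟩ := hf
      have : Matrix.det (fun i => w i (f i)) = 0 := by
        refine det_eq_zero_of_two_rows_proportional _ hne (x i (f i)) (x i' (f i)) (q (f i)) ?_ ?_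
        · funext j; simp [w, hlt]
        · funext j; simp [w, ← hff, hlt]
      rw [this, norm_zero]
      exact mul_nonneg (mul_nonneg (by positivity) (Finset.prod_nonneg fun i _ => hA i))
        (by positivity)
    · push Not at hf
      have hsum := half_mul_pred_le_sum_of_injOn_lt f hf
      calc ‖Matrix.det (fun i => w i (f i))‖ ≤ ∑ σ : Equiv.Perm (Fin N), ∏ i, A i * (ρ ^ (f i : ℕ))⁻¹ := by
            rw [Matrix.det_apply' (M := (fun i => w i (f i) : Matrix (Fin N) (Fin N) ℂ))]
            refine (norm_sum_le _ _).trans (Finset.sum_le_sum fun σ _ => ?_)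
            rw [norm_mul, norm_prod]
            have : ‖((Equiv.Perm.sign σ : ℤ) : ℂ)‖ = 1 := by
              rcases Int.units_eq_one_or (Equiv.Perm.sign σ) with h | h <;> simp [h]
            rw [this, one_mul, ← Equiv.prod_comp σ (fun i => A i * (ρ ^ (f i : ℕ))⁻¹)]
            exact Finset.prod_le_prod (fun _ _ => norm_nonneg _) fun i _ => hw _ _ _
        _ = N.factorial * ((∏ i, A i) * (ρ ^ (∑ i, (f i : ℕ)))⁻¹) := by
            rw [Finset.sum_const, Finset.card_univ, Fintype.card_perm, Fintype.card_fin,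
              nsmul_eq_mul, Finset.prod_mul_distrib, Finset.prod_inv_distrib,
              Finset.prod_pow_eq_pow_sum]
        _ ≤ _ := by
            rw [mul_assoc]
            gcongr
            exact Finset.prod_nonneg fun i _ => hA i
  rw [hdet]
  refine (norm_sum_le _ _).trans ((Finset.sum_le_sum fun f _ => hterm f).trans ?_)
  simp [Finset.card_univ, mul_assoc]

/-- Cauchy estimates: an entire function bounded by `A` on the circle of radius `ρ Z` is well
approximated by its Taylor polynomials on the disc of radius `Z`. -/
theorem exists_taylor_approx {f : ℂ → ℂ} (hf : Differentiable ℂ f) {A ρ Z : ℝ} (hρ : 2 ≤ ρ)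
    (hZ : 0 < Z) (hA : ∀ z : ℂ, ‖z‖ = ρ * Z → ‖f z‖ ≤ A) :
    ∃ x : ℕ → ℂ, (∀ m, ‖x m‖ ≤ A * (ρ ^ m)⁻¹) ∧ ∀ (N : ℕ) (z : ℂ), ‖z‖ ≤ Z →
      ‖f z - ∑ m ∈ Finset.range N, x m * (z / Z) ^ m‖ ≤ 2 * A * (ρ ^ N)⁻¹ := by
  have hρ0 : 0 < ρ := by linarith
  have hT : 0 < ρ * Z := by positivity
  have hA0 : 0 ≤ A := (norm_nonneg _).trans
    (hA ((ρ * Z : ℝ) : ℂ) (by rw [Complex.norm_real, Real.norm_of_nonneg hT.le]))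
  let x : ℕ → ℂ := fun m => (m.factorial : ℂ)⁻¹ * iteratedDeriv m f 0 * Z ^ m
  have hx : ∀ m, ‖x m‖ ≤ A * (ρ ^ m)⁻¹ := by
    intro m
    have h := Complex.norm_iteratedDeriv_le_of_forall_mem_sphere_norm_le (c := 0) (C := A) m hT
      hf.diffContOnCl (fun z hz => hA z (by simpa using hz))
    have hm : (0 : ℝ) < m.factorial := by positivity
    have : ‖x m‖ = ‖iteratedDeriv m f 0‖ * Z ^ m / m.factorial := by
      simp [x, abs_of_pos hZ]; ring
    rw [this, div_le_iff₀ hm]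
    calc _ ≤ m.factorial * A / (ρ * Z) ^ m * Z ^ m := by gcongr
      _ = _ := by rw [mul_pow]; field_simp
  refine ⟨x, hx, fun N z hz => ?_⟩
  have hs : HasSum (fun m => x m * (z / Z) ^ m) (f z) := by
    have h := Complex.hasSum_taylorSeries_of_entire hf 0 z
    have hZ' : (Z : ℂ) ≠ 0 := by exact_mod_cast hZ.ne'
    have he : (fun m => x m * (z / Z) ^ m) =
        fun n : ℕ => (n.factorial : ℂ)⁻¹ • (z - 0) ^ n • iteratedDeriv n f 0 := by
      funext m
      simp only [x, sub_zero, smul_eq_mul, div_pow]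
      field_simp
    rw [he]; exact h
  have hs' := (hasSum_nat_add_iff' N).2 hs
  rw [← hs'.tsum_eq]
  have hq : |ρ⁻¹| < 1 := by
    rw [abs_of_pos (by positivity)]; exact inv_lt_one_of_one_lt₀ (by linarith)
  have hg : HasSum (fun m : ℕ => A * (ρ ^ N)⁻¹ * ρ⁻¹ ^ m) (A * (ρ ^ N)⁻¹ * (1 - ρ⁻¹)⁻¹) :=
    (hasSum_geometric_of_abs_lt_one hq).mul_left _
  refine (tsum_of_norm_bounded hg fun m => ?_).trans ?_
  · rw [norm_mul]
    calc _ ≤ A * (ρ ^ (m + N))⁻¹ * 1 := by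
          gcongr
          · exact hx _
          · rw [norm_pow]
            refine pow_le_one₀ (norm_nonneg _) ?_
            rw [norm_div, Complex.norm_real, Real.norm_of_nonneg hZ.le]
            exact div_le_one_of_le₀ hz hZ.le
      _ = _ := by rw [pow_add, inv_pow, mul_inv]; ring
  · have : (1 - ρ⁻¹)⁻¹ ≤ 2 := by
      rw [inv_le_comm₀ (by have := (abs_lt.1 hq).2; linarith) (by norm_num)]
      have : ρ⁻¹ ≤ 2⁻¹ := by gcongr
      linarith
    calc _ ≤ A * (ρ ^ N)⁻¹ * 2 := by gcongr
      _ = _ := by ring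

section

open Polynomial

/-- Zero estimate for exponential polynomials `∑ Q_v(z) ω^{v z}` on a two-dimensional lattice of
points. -/
theorem eq_zero_of_expPoly_vanish {K : Type*} [Field K] [CharZero K] {L κ t R S : ℕ}
    (e : Fin L → ℤ) {ω : K} (hω : ω ≠ 0) (hinj : Function.Injective fun v => ω ^ e v) (J p : ℤ)
    (Q : Fin L → K[X]) (hQ : ∀ v, (Q v).natDegree ≤ κ) (hL : L ≤ 2 * t + 1)
    (hvan : ∀ r s : ℤ, |r| ≤ (R + t : ℕ) → |s| ≤ S →
      ∑ v, (Q v).eval (r * J + s * p : K) * (ω ^ r * (-1) ^ s) ^ e v = 0)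
    (hpts : ∀ r s r' s' : ℤ, |r| ≤ R → |s| ≤ S → |r'| ≤ R → |s'| ≤ S →
      r * J + s * p = r' * J + s' * p → r = r' ∧ s = s')
    (hcard : L * κ < (2 * R + 1) * (2 * S + 1)) : ∀ v, Q v = 0 := by
  classical
  by_contra hne
  push Not at hne
  obtain ⟨v₀, hv₀⟩ := hne
  let V := {v // Q v ≠ 0}
  let n := Fintype.card V
  let g : Fin n → Fin L := fun j => ((Fintype.equivFin V).symm j).1
  have hg : ∀ j, Q (g j) ≠ 0 := fun j => ((Fintype.equivFin V).symm j).2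
  have hginj : Function.Injective g := fun a b h => (Fintype.equivFin V).symm.injective
    (Subtype.ext h)
  have hgsurj : ∀ v, Q v ≠ 0 → ∃ j, g j = v := fun v hv =>
    ⟨Fintype.equivFin V ⟨v, hv⟩, by simp [g]⟩
  have hnL : n ≤ L := by
    simpa using Fintype.card_le_of_injective g hginj
  let sh : Fin n → ℤ := fun i => (i : ℤ) - t
  have hsh : ∀ i, |sh i| ≤ t := fun i => by
    have := i.2
    simp only [sh]; rw [abs_le]; constructor <;> omega
  -- the matrix of shifted polynomials
  let M : Matrix (Fin n) (Fin n) K[X] := Matrix.of fun i j =>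
    X ^ (κ - (Q (g j)).natDegree) * ((Q (g j)).comp (X + C (sh i * J : K)) * C (ω ^ (sh i * e (g j))))
  have hdeg : ∀ i j, (M i j).natDegree ≤ κ := by
    intro i j
    have h1 : ((Q (g j)).comp (X + C (sh i * J : K))).natDegree = (Q (g j)).natDegree := by
      rw [natDegree_comp, natDegree_X_add_C, mul_one]
    have := hQ (g j)
    simp only [M, Matrix.of_apply]
    refine (natDegree_mul_le).trans ?_
    have h2 := natDegree_mul_C_le ((Q (g j)).comp (X + C (sh i * J : K))) (ω ^ (sh i * e (g j)))
    rw [natDegree_X_pow]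
    omega
  have hcoef : ∀ i j, (M i j).coeff κ = (Q (g j)).leadingCoeff * ω ^ (sh i * e (g j)) := by
    intro i j
    have := hQ (g j)
    have hk : κ = (Q (g j)).natDegree + (κ - (Q (g j)).natDegree) := by omega
    simp only [M, Matrix.of_apply]
    conv_lhs => rw [hk]
    rw [Nat.add_sub_cancel_left, coeff_X_pow_mul, coeff_mul_C]
    congr 1
    have h1 : ((Q (g j)).comp (X + C (sh i * J : K))).natDegree = (Q (g j)).natDegree := by
      rw [natDegree_comp, natDegree_X_add_C, mul_one]
    rw [← h1, ← leadingCoeff, leadingCoeff_comp (by rw [natDegree_X_add_C]; exact one_ne_zero), leadingCoeff_X_add_C, one_pow, mul_one]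
  have hdetdeg : M.det.natDegree ≤ n * κ := by
    rw [Matrix.det_apply]
    refine natDegree_sum_le_of_forall_le _ _ fun σ _ => ?_
    refine (natDegree_smul_le _ _).trans ((natDegree_prod_le _ _).trans ?_)
    refine (Finset.sum_le_sum fun i _ => hdeg _ _).trans ?_
    simp
  have hdetcoef : M.det.coeff (n * κ) =
      (Matrix.of fun i j => (Q (g j)).leadingCoeff * ω ^ (sh i * e (g j))).det := by
    rw [Matrix.det_apply, Matrix.det_apply, finsetSum_coeff]
    refine Finset.sum_congr rfl fun σ _ => ?_
    have h := coeff_prod_of_natDegree_le (s := Finset.univ) (fun i => M (σ i) i) κ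
      (fun i _ => hdeg _ _)
    simp only [Finset.card_univ, Fintype.card_fin] at h
    rw [coeff_smul, h]
    congr 1
    exact Finset.prod_congr rfl fun i _ => hcoef _ _
  have hdet0 : M.det ≠ 0 := by
    intro h0
    rw [h0, coeff_zero] at hdetcoef
    have h1 := Matrix.det_mul_row (fun j => (Q (g j)).leadingCoeff)
      (Matrix.of fun i j : Fin n => ω ^ (sh i * e (g j)))
    have h2 : (Matrix.of fun i j : Fin n => ω ^ (sh i * e (g j))) = Matrix.of fun i j =>
        ω ^ (-(t : ℤ) * e (g j)) * (Matrix.vandermonde (fun j => ω ^ e (g j))).transpose i j := by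
      ext i j
      simp only [Matrix.of_apply, Matrix.transpose_apply, Matrix.vandermonde_apply, sh]
      rw [← zpow_natCast, ← zpow_mul, ← zpow_add₀ hω]
      congr 1; ring
    have h3 := Matrix.det_mul_row (fun j => ω ^ (-(t : ℤ) * e (g j)))
      (Matrix.vandermonde (fun j => ω ^ e (g j))).transpose
    simp only [Matrix.of_apply] at h1 hdetcoef
    rw [h1, h2, h3, Matrix.det_transpose] at hdetcoef
    have h4 : (Matrix.vandermonde (fun j => ω ^ e (g j))).det ≠ 0 :=
      Matrix.det_vandermonde_ne_zero_iff.2 (hinj.comp hginj)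
    refine mul_ne_zero (Finset.prod_ne_zero_iff.2 fun j _ => leadingCoeff_ne_zero.2 (hg j))
      (mul_ne_zero (Finset.prod_ne_zero_iff.2 fun j _ => zpow_ne_zero _ hω) h4) hdetcoef.symm
  -- it vanishes at many points
  let P : Finset (ℤ × ℤ) := Finset.Icc (-(R : ℤ)) R ×ˢ Finset.Icc (-(S : ℤ)) S
  have hP : ∀ x ∈ P, |x.1| ≤ R ∧ |x.2| ≤ S := by
    intro x hx
    simp only [P, Finset.mem_product, Finset.mem_Icc] at hx
    exact ⟨abs_le.2 hx.1, abs_le.2 hx.2⟩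
  let pt : ℤ × ℤ → K := fun x => ((x.1 * J + x.2 * p : ℤ) : K)
  have hptinj : Set.InjOn pt P := by
    intro x hx y hy h
    have := hpts x.1 x.2 y.1 y.2 (hP x hx).1 (hP x hx).2 (hP y hy).1 (hP y hy).2
      (Int.cast_injective h)
    exact Prod.ext this.1 this.2
  have hroot : ∀ x ∈ P, M.det.eval (pt x) = 0 := by
    intro x hx
    rw [← coe_evalRingHom, RingHom.map_det]
    have heq : (evalRingHom (pt x)).mapMatrix M = Matrix.of fun i j =>
        (pt x) ^ (κ - (Q (g j)).natDegree) * (Matrix.of fun i j =>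
          ((Q (g j)).eval (pt x + sh i * J) * ω ^ (sh i * e (g j)))) i j := by
      ext i j
      simp [M, eval_comp]
    rw [heq, Matrix.det_mul_row]
    refine mul_eq_zero_of_right _ ?_
    rw [← Matrix.exists_mulVec_eq_zero_iff]
    refine ⟨fun j => (ω ^ x.1 * (-1) ^ x.2) ^ e (g j), ?_, ?_⟩
    · obtain ⟨j₀, -⟩ := hgsurj v₀ hv₀
      intro h
      have := congrFun h j₀
      simp only [Pi.zero_apply] at this
      exact zpow_ne_zero _ (mul_ne_zero (zpow_ne_zero _ hω) (zpow_ne_zero _ (by simp))) this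
    · ext i
      have h := hvan (x.1 + sh i) x.2 ((abs_add_le _ _).trans (by
        have := (hP x hx).1; have := hsh i; push_cast; omega)) (hP x hx).2
      rw [Pi.zero_apply, ← h]
      simp only [Matrix.mulVec, dotProduct, Matrix.of_apply]
      have : ∑ v, (Q v).eval (((x.1 + sh i : ℤ) : K) * J + x.2 * p) *
          (ω ^ (x.1 + sh i) * (-1) ^ x.2) ^ e v = ∑ v ∈ Finset.univ.image g,
          (Q v).eval (((x.1 + sh i : ℤ) : K) * J + x.2 * p) *
          (ω ^ (x.1 + sh i) * (-1) ^ x.2) ^ e v := by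
        symm
        refine Finset.sum_subset (Finset.subset_univ _) fun v _ hv => ?_
        have : Q v = 0 := by
          by_contra h
          obtain ⟨j, rfl⟩ := hgsurj v h
          exact hv (Finset.mem_image_of_mem _ (Finset.mem_univ _))
        simp [this]
      rw [this, Finset.sum_image hginj.injOn]
      refine Finset.sum_congr rfl fun j _ => ?_
      have e1 : pt x + sh i * J = ((x.1 + sh i : ℤ) : K) * J + x.2 * p := by
        simp only [pt]; push_cast; ring
      rw [e1, mul_assoc]
      congr 1
      rw [zpow_add₀ hω, mul_right_comm, mul_zpow _ (ω ^ sh i), ← zpow_mul, mul_comm]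
  have hsub : (P.image pt).val ⊆ M.det.roots := by
    intro y hy
    obtain ⟨x, hx, rfl⟩ := Finset.mem_image.1 hy
    exact (mem_roots hdet0).2 (hroot x hx)
  have hc := card_le_degree_of_subset_roots hsub
  rw [Finset.card_image_of_injOn hptinj] at hc
  have hPc : P.card = (2 * R + 1) * (2 * S + 1) := by
    simp only [P, Finset.card_product, Int.card_Icc]
    congr 1 <;> omega
  have : n * κ ≤ L * κ := Nat.mul_le_mul_right _ hnL
  omega

theorem exists_submatrix_det_ne_zero {ι κ K : Type*} [Fintype ι] [DecidableEq ι] [Finite κ]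
    [Field K] (A : Matrix ι κ K) (hA : LinearIndependent K A.row) :
    ∃ c : ι → κ, (A.submatrix id c).det ≠ 0 := by
  have := Fintype.ofFinite κ
  obtain ⟨f, hf, -, hli⟩ := Submodule.exists_fun_fin_finrank_span_eq K (Set.range A.col)
  have hr : Module.finrank K (Submodule.span K (Set.range A.col)) = Fintype.card ι := by
    rw [← Matrix.rank_eq_finrank_span_cols, hA.rank_matrix]
  choose c hc using hf
  let e : ι ≃ Fin (Module.finrank K (Submodule.span K (Set.range A.col))) :=
    Fintype.equivFinOfCardEq hr.symm
  refine ⟨c ∘ e, ?_⟩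
  have : (A.submatrix id (c ∘ e)).col = f ∘ e := by
    funext j
    rw [Function.comp_apply, ← hc]
    rfl
  have h2 : IsUnit (A.submatrix id (c ∘ e)) := by
    rw [← Matrix.linearIndependent_cols_iff_isUnit, this]
    exact hli.comp _ e.injective
  exact ((Matrix.isUnit_iff_isUnit_det _).1 h2).ne_zero

/-- The binomial coefficient polynomial `X.choose u`. -/
noncomputable def choosePoly (K : Type*) [Field K] (u : ℕ) : K[X] :=
  C (u.factorial : K)⁻¹ * descPochhammer K u

theorem choosePoly_eval_intCast {K : Type*} [Field K] [CharZero K] (u : ℕ) (z : ℤ) :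
    (choosePoly K u).eval (z : K) = (Ring.choose z u : ℤ) := by
  have h := Ring.descPochhammer_eq_factorial_smul_choose z u
  have h2 : (u.factorial : K) ≠ 0 := by exact_mod_cast u.factorial_ne_zero
  rw [choosePoly, eval_mul, eval_C, inv_mul_eq_iff_eq_mul₀ h2, ← descPochhammer_eval_cast]
  have h3 : (descPochhammer ℤ u).eval z = u.factorial * Ring.choose z u := by
    rw [← nsmul_eq_mul, ← h, ← Polynomial.eval_eq_smeval]
  rw [h3]; push_cast; ring

theorem degree_choosePoly {K : Type*} [Field K] [CharZero K] (u : ℕ) :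
    (choosePoly K u).degree = u := by
  have h2 : (u.factorial : K)⁻¹ ≠ 0 := inv_ne_zero (by exact_mod_cast u.factorial_ne_zero)
  rw [choosePoly, degree_C_mul h2, degree_eq_natDegree (monic_descPochhammer K u).ne_zero,
    descPochhammer_natDegree]

theorem linearIndependent_choosePoly (K : Type*) [Field K] [CharZero K] :
    LinearIndependent K (choosePoly K) :=
  Polynomial.Sequence.linearIndependent ⟨choosePoly K, degree_choosePoly⟩

theorem exists_interpolation_det_ne_zero {k L t R S : ℕ} {ω : ℂ} (hω : ω ≠ 0)
    (e : Fin L → ℤ) (hinj : Function.Injective fun v => ω ^ e v) (J p : ℤ) (hL : L ≤ 2 * t + 1)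
    (hpts : ∀ r s r' s' : ℤ, |r| ≤ R → |s| ≤ S → |r'| ≤ R → |s'| ≤ S →
      r * J + s * p = r' * J + s' * p → r = r' ∧ s = s')
    (hcard : L * (k - 1) < (2 * R + 1) * (2 * S + 1)) :
    ∃ c : Fin k × Fin L → ℤ × ℤ, (∀ j, |(c j).1| ≤ (R + t : ℕ)) ∧ (∀ j, |(c j).2| ≤ S) ∧
      (Matrix.of fun i j : Fin k × Fin L => ((Ring.choose ((c j).1 * J + (c j).2 * p) (i.1 : ℕ) : ℤ) : ℂ)
        * (ω ^ (c j).1 * (-1) ^ (c j).2) ^ e i.2).det ≠ 0 := by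
  classical
  let P : Finset (ℤ × ℤ) := Finset.Icc (-((R + t : ℕ) : ℤ)) (R + t : ℕ) ×ˢ Finset.Icc (-(S : ℤ)) S
  let A : Matrix (Fin k × Fin L) P ℂ := Matrix.of fun i c =>
    ((Ring.choose (c.1.1 * J + c.1.2 * p) (i.1 : ℕ) : ℤ) : ℂ) * (ω ^ c.1.1 * (-1) ^ c.1.2) ^ e i.2
  have hA : LinearIndependent ℂ A.row := by
    rw [Fintype.linearIndependent_iff]
    intro l hl
    have h0 := eq_zero_of_expPoly_vanish (K := ℂ) (κ := k - 1) (R := R) (S := S) (t := t) e hω hinj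
      J p (fun v => ∑ u : Fin k, l (u, v) • choosePoly ℂ u) ?_ hL ?_ hpts hcard
    · rintro ⟨u, v⟩
      have h1 := (linearIndependent_choosePoly ℂ).comp (fun u : Fin k => (u : ℕ)) Fin.val_injective
      rw [Fintype.linearIndependent_iff] at h1
      exact h1 (fun u => l (u, v)) (h0 v) u
    · intro v
      refine natDegree_sum_le_of_forall_le _ _ fun u _ => (natDegree_smul_le _ _).trans ?_
      rw [natDegree_eq_of_degree_eq_some (degree_choosePoly _)]
      omega
    · intro r s hr hs
      have hm : (r, s) ∈ P := by
        simp only [P, Finset.mem_product, Finset.mem_Icc]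
        exact ⟨abs_le.1 hr, abs_le.1 hs⟩
      have h := congrFun hl ⟨(r, s), hm⟩
      rw [Finset.sum_apply, Pi.zero_apply, Fintype.sum_prod_type_right] at h
      rw [← h]
      refine Finset.sum_congr rfl fun v _ => ?_
      rw [eval_finsetSum, Finset.sum_mul]
      refine Finset.sum_congr rfl fun u _ => ?_
      have := choosePoly_eval_intCast (K := ℂ) u (r * J + s * p)
      push_cast at this
      simp only [eval_smul, this, smul_eq_mul, Pi.smul_apply, A, Matrix.row, Matrix.of_apply]
      ring
  obtain ⟨c, hc⟩ := exists_submatrix_det_ne_zero A hA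
  have hP : ∀ x : P, |x.1.1| ≤ (R + t : ℕ) ∧ |x.1.2| ≤ S := by
    rintro ⟨x, hx⟩
    simp only [P, Finset.mem_product, Finset.mem_Icc] at hx
    exact ⟨abs_le.2 hx.1, abs_le.2 hx.2⟩
  exact ⟨fun j => (c j).1, fun j => (hP _).1, fun j => (hP _).2, hc⟩

end

theorem one_le_norm_pow_mul_norm_det {ι : Type*} [Fintype ι] [DecidableEq ι] (O : Subring ℂ)
    (hO : ∀ x ∈ O, x ≠ 0 → 1 ≤ ‖x‖) {α β ω : ℂ} (hα : α ∈ O) (hβ : β ∈ O) (hα0 : α ≠ 0)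
    (hβ0 : β ≠ 0) (hω : ω = α / β ∨ ω = -(α / β)) (a : ι → ι → ℤ) (r s e : ι → ℤ) (E : ℕ)
    (hE : ∀ σ : Equiv.Perm ι, |∑ i, r i * e (σ i)| ≤ E)
    (hdet : (Matrix.of fun i j => (a i j : ℂ) * (ω ^ r j * (-1) ^ s j) ^ e i).det ≠ 0) :
    1 ≤ ‖α * β‖ ^ E *
      ‖(Matrix.of fun i j => (a i j : ℂ) * (ω ^ r j * (-1) ^ s j) ^ e i).det‖ := by
  rw [← norm_pow, ← norm_mul]
  refine hO _ ?_ (mul_ne_zero (pow_ne_zero _ (mul_ne_zero hα0 hβ0)) hdet)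
  rw [Matrix.det_apply', Finset.mul_sum]
  refine Subring.sum_mem _ fun σ _ => ?_
  simp only [Matrix.of_apply, Finset.prod_mul_distrib]
  have hsgn : ∀ m : ℤ, (-1 : ℂ) ^ m ∈ O := by
    intro m
    rcases Int.even_or_odd m with h | h
    · rw [h.neg_one_zpow]; exact O.one_mem
    · rw [h.neg_one_zpow]; exact O.neg_mem O.one_mem
  have hω0 : α / β ≠ 0 := div_ne_zero hα0 hβ0
  have key : ∀ m n : ℤ, ∃ c ∈ O, (ω ^ m * (-1) ^ n) = c * (α / β) ^ m := by
    intro m n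
    rcases hω with h | h
    · exact ⟨_, hsgn n, by rw [h]; ring⟩
    · refine ⟨_, O.mul_mem (hsgn m) (hsgn n), ?_⟩
      rw [h, ← neg_one_mul, mul_zpow]; ring
  have hprod : ∃ c ∈ O, ∏ i, (ω ^ r i * (-1) ^ s i) ^ e (σ i) =
      c * (α / β) ^ ∑ i, r i * e (σ i) := by
    have : ∀ i, ∃ c ∈ O, (ω ^ r i * (-1) ^ s i) ^ e (σ i) = c * (α / β) ^ (r i * e (σ i)) := by
      intro i
      rw [mul_zpow, ← zpow_mul, ← zpow_mul]
      exact key _ _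
    choose c hc hc' using this
    refine ⟨∏ i, c i, Subring.prod_mem _ fun i _ => hc i, ?_⟩
    have hz : (α / β) ^ ∑ i, r i * e (σ i) = ∏ i, (α / β) ^ (r i * e (σ i)) := by
      induction (Finset.univ : Finset ι) using Finset.induction_on with
      | empty => simp
      | insert x s hx ih => rw [Finset.sum_insert hx, Finset.prod_insert hx, zpow_add₀ hω0, ih]
    rw [hz, ← Finset.prod_mul_distrib]
    exact Finset.prod_congr rfl fun i _ => hc' i
  obtain ⟨c, hc, hc'⟩ := hprod
  rw [hc']
  have hm := abs_le.1 (hE σ)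
  set m := ∑ i, r i * e (σ i)
  obtain ⟨m1, hm1⟩ := Int.eq_ofNat_of_zero_le (show 0 ≤ E + m by linarith)
  obtain ⟨m2, hm2⟩ := Int.eq_ofNat_of_zero_le (show 0 ≤ E - m by linarith)
  have hpow : (α * β) ^ E * (α / β) ^ m = α ^ m1 * β ^ m2 := by
    rw [← zpow_natCast, ← zpow_natCast, ← zpow_natCast, ← hm1, ← hm2, mul_zpow, div_zpow,
      zpow_add₀ hα0, zpow_sub₀ hβ0]
    field_simp
  have : (α * β) ^ E * (((Equiv.Perm.sign σ : ℤ) : ℂ) * ((∏ i, (a (σ i) i : ℂ)) *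
      (c * (α / β) ^ m))) = ((Equiv.Perm.sign σ : ℤ) : ℂ) * (∏ i, (a (σ i) i : ℂ)) * c *
      (α ^ m1 * β ^ m2) := by
    rw [← hpow]; ring
  rw [this]
  exact O.mul_mem (O.mul_mem (O.mul_mem (intCast_mem _ _)
    (Subring.prod_mem _ fun i _ => intCast_mem _ _)) hc)
    (O.mul_mem (O.pow_mem hα _) (O.pow_mem hβ _))

theorem abs_sum_mul_le_sqrt {ι : Type*} [Fintype ι] [DecidableEq ι] {k t R S : ℕ}
    (c : ι → ℤ × ℤ) (hc : Function.Injective c) (hR : ∀ j, |(c j).1| ≤ R) (hS : ∀ j, |(c j).2| ≤ S)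
    (f : ι ≃ Fin k × Fin (2 * t + 1)) (σ : Equiv.Perm ι) :
    |∑ i, (c i).1 * (((f (σ i)).2 : ℤ) - t)| ≤ Nat.sqrt ((2 * S + 1) * (R * (R + 1) * (2 * R + 1) / 3)
      * (k * (t * (t + 1) * (2 * t + 1) / 3))) := by
  have hsq : ∀ n : ℕ, ∑ x ∈ Finset.Icc (-(n : ℤ)) n, x ^ 2 = (n * (n + 1) * (2 * n + 1) / 3 : ℕ) := by
    intro n
    have h3 : ∀ n : ℕ, 3 * ∑ x ∈ Finset.Icc (-(n : ℤ)) n, x ^ 2 = n * (n + 1) * (2 * n + 1) := by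
      intro n
      induction n with
      | zero => simp
      | succ n ih =>
        have : Finset.Icc (-((n + 1 : ℕ) : ℤ)) (n + 1 : ℕ) =
            insert (-((n : ℤ) + 1)) (insert ((n : ℤ) + 1) (Finset.Icc (-(n : ℤ)) n)) := by
          ext x; simp only [Finset.mem_insert, Finset.mem_Icc]; push_cast; omega
        rw [this, Finset.sum_insert, Finset.sum_insert, mul_add, mul_add, ih]
        · push_cast; ring
        · simp
        · simp only [Finset.mem_insert, Finset.mem_Icc]; omega
    have := h3 n
    push_cast
    omega
  have h1 : ∑ i, ((c i).1) ^ 2 ≤ (2 * S + 1) * (R * (R + 1) * (2 * R + 1) / 3 : ℕ) := by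
    calc ∑ i, ((c i).1) ^ 2 = ∑ x ∈ Finset.univ.image c, x.1 ^ 2 := by
          rw [Finset.sum_image hc.injOn]
      _ ≤ ∑ x ∈ Finset.Icc (-(R : ℤ)) R ×ˢ Finset.Icc (-(S : ℤ)) S, x.1 ^ 2 := by
          refine Finset.sum_le_sum_of_subset_of_nonneg ?_ fun x _ _ => sq_nonneg _
          intro x hx
          obtain ⟨i, -, rfl⟩ := Finset.mem_image.1 hx
          simp only [Finset.mem_product, Finset.mem_Icc]
          exact ⟨abs_le.1 (hR i), abs_le.1 (hS i)⟩
      _ = _ := by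
          rw [Finset.sum_product]
          simp only [Finset.sum_const, Int.card_Icc]
          rw [← Finset.smul_sum, hsq, nsmul_eq_mul]
          congr 1
          omega
  have h2 : ∑ i, (((f (σ i)).2 : ℤ) - t) ^ 2 = k * (t * (t + 1) * (2 * t + 1) / 3 : ℕ) := by
    refine (Equiv.sum_comp (σ.trans f)
      (fun x : Fin k × Fin (2 * t + 1) => ((x.2 : ℤ) - t) ^ 2)).trans ?_
    rw [Fintype.sum_prod_type]
    simp only [Finset.sum_const, Finset.card_univ, Fintype.card_fin, nsmul_eq_mul]
    congr 1
    rw [← hsq t, Fin.sum_univ_eq_sum_range (fun i => ((i : ℤ) - t) ^ 2)]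
    refine Finset.sum_bij (fun i _ => (i : ℤ) - t) ?_ ?_ ?_ ?_
    · intro i hi; simp only [Finset.mem_range, Finset.mem_Icc] at *; omega
    · intro i _ j _ h; simpa using h
    · intro x hx
      simp only [Finset.mem_Icc] at hx
      exact ⟨(x + t).toNat, by simp only [Finset.mem_range]; omega, by omega⟩
    · intro i _; rfl
  have h3 := Finset.sum_mul_sq_le_sq_mul_sq Finset.univ (fun i => (c i).1)
    (fun i => ((f (σ i)).2 : ℤ) - t)
  rw [h2] at h3
  rw [Int.abs_eq_natAbs, Nat.cast_le, Nat.le_sqrt']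
  zify
  rw [sq_abs]
  refine (h3.trans (mul_le_mul_of_nonneg_right h1 (by positivity))).trans (le_of_eq ?_)
  push_cast; ring

theorem half_mul_log_le_sum_log_factorial (n : ℕ) :
    ((n + 1 : ℝ) * n / 2) * Real.log (n / (2 * Real.exp 1)) ≤
      ∑ u ∈ Finset.range (n + 1), Real.log u.factorial := by
  rcases Nat.eq_zero_or_pos n with rfl | hn
  · simp
  have hn' : (0 : ℝ) < n := by exact_mod_cast hn
  have h1 : (n : ℝ) * Real.log (n / Real.exp 1) ≤ Real.log n.factorial := by
    have h := Real.pow_div_factorial_le_exp (n : ℝ) hn'.le n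
    have hf : (0 : ℝ) < n.factorial := by positivity
    have h2 := Real.log_le_log (by positivity) h
    rw [Real.log_div (by positivity) hf.ne', Real.log_pow, Real.log_exp] at h2
    rw [Real.log_div hn'.ne' (Real.exp_pos 1).ne', Real.log_exp]
    linarith
  have h2 : ∀ u ∈ Finset.range (n + 1), (n : ℝ) * Real.log (n / (2 * Real.exp 1)) ≤
      Real.log u.factorial + Real.log (n - u).factorial := by
    intro u hu
    have hu' : u ≤ n := by simp at hu; omega
    have h3 := Nat.choose_mul_factorial_mul_factorial hu'
    have h4 : n.factorial ≤ 2 ^ n * (u.factorial * (n - u).factorial) := by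
      rw [← h3, mul_assoc]
      exact Nat.mul_le_mul_right _ (Nat.choose_le_two_pow n u)
    have h5 : (n.factorial : ℝ) ≤ 2 ^ n * (u.factorial * (n - u).factorial) := by exact_mod_cast h4
    have h6 := Real.log_le_log (by positivity) h5
    rw [Real.log_mul (by positivity) (by positivity), Real.log_mul (by positivity) (by positivity),
      Real.log_pow] at h6
    have h7 : Real.log (n / (2 * Real.exp 1)) = Real.log (n / Real.exp 1) - Real.log 2 := by
      rw [← Real.log_div (by positivity) (by norm_num)]; congr 1; field_simp
    rw [h7]; linarith
  have h3 := Finset.sum_le_sum h2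
  rw [Finset.sum_add_distrib, Finset.sum_const, Finset.card_range, nsmul_eq_mul] at h3
  have h4 := Finset.sum_range_reflect (fun u => Real.log u.factorial) (n + 1)
  simp only [Nat.add_sub_cancel] at h4
  have h5 : ∑ u ∈ Finset.range (n + 1), Real.log (n - u).factorial =
      ∑ u ∈ Finset.range (n + 1), Real.log u.factorial := h4
  rw [h5] at h3
  push_cast at h3
  linarith

theorem sum_mul_log_sub_log_factorial_le {k : ℕ} (hk : 2 ≤ k) {X : ℝ} (hX : 0 < X) :
    ∑ u ∈ Finset.range k, (u * Real.log X - Real.log u.factorial) ≤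
      k * ((k - 1) / 2 * Real.log (2 * Real.exp 1 * X / (k - 1))) := by
  obtain ⟨n, rfl⟩ : ∃ n, k = n + 1 := ⟨k - 1, by omega⟩
  have hn : (0 : ℝ) < n := by exact_mod_cast (by omega : 0 < n)
  have h := half_mul_log_le_sum_log_factorial n
  rw [Finset.sum_sub_distrib, ← Finset.sum_mul, ← Nat.cast_sum]
  have h2 : ((∑ i ∈ Finset.range (n + 1), i : ℕ) : ℝ) = (n + 1) * n / 2 := by
    have := Finset.sum_range_id_mul_two (n + 1)
    have h3 : ((∑ i ∈ Finset.range (n + 1), i : ℕ) : ℝ) * 2 = (n + 1) * n := by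
      exact_mod_cast this
    linarith
  rw [h2]
  push_cast
  have h3 : Real.log (2 * Real.exp 1 * X / (n + 1 - 1)) =
      Real.log X - Real.log (n / (2 * Real.exp 1)) := by
    rw [← Real.log_div (by positivity) (by positivity)]
    congr 1
    rw [add_sub_cancel_right]; field_simp
  rw [h3]
  linarith

section

open Polynomial

theorem norm_choosePoly_eval_le (u k : ℕ) (hu : u < k) {z : ℂ} {T : ℝ} (hz : ‖z‖ ≤ T) :
    ‖(choosePoly ℂ u).eval z‖ ≤ (T + k) ^ u / u.factorial := by
  rw [choosePoly, eval_mul, eval_C, norm_mul, norm_inv, Complex.norm_natCast, div_eq_inv_mul]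
  gcongr
  rw [descPochhammer_eval_eq_prod_range, norm_prod]
  calc ∏ j ∈ Finset.range u, ‖z - j‖ ≤ ∏ j ∈ Finset.range u, (T + k) := by
        refine Finset.prod_le_prod (fun _ _ => norm_nonneg _) fun j hj => ?_
        have hj' : (j : ℝ) ≤ k := by
          have := Finset.mem_range.1 hj
          exact_mod_cast (by omega : j ≤ k)
        calc ‖z - j‖ ≤ ‖z‖ + ‖(j : ℂ)‖ := norm_sub_le _ _
          _ ≤ T + k := by rw [Complex.norm_natCast]; linarith
    _ = _ := by simp

theorem norm_exp_ofReal_mul_I_sub_le (x y : ℝ) :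
    ‖Complex.exp (x * Complex.I) - Complex.exp (y * Complex.I)‖ ≤ |x - y| := by
  have h : Complex.exp (x * Complex.I) - Complex.exp (y * Complex.I) =
      Complex.exp (y * Complex.I) * (Complex.exp (Complex.I * ((x - y : ℝ) : ℂ)) - 1) := by
    rw [mul_sub, ← Complex.exp_add, mul_one]
    congr 2; push_cast; ring
  rw [h, norm_mul, Complex.norm_exp_ofReal_mul_I, one_mul]
  exact Real.norm_exp_I_mul_ofReal_sub_one_le

/-- The interpolation determinant inequality for one logarithm of an algebraic number of absolute
value one (compared with `π i`). -/
theorem interpolation_inequality (O : Subring ℂ) (hO : ∀ x ∈ O, x ≠ 0 → 1 ≤ ‖x‖) {α β : ℂ}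
    (hα : α ∈ O) (hβ : β ∈ O) (hy : 1 ≤ ‖α * β‖) {θ : ℝ}
    (hω : Complex.exp (θ * Complex.I) = α / β ∨ Complex.exp (θ * Complex.I) = -(α / β))
    {p : ℕ} (hp : 0 < p) {J : ℤ} (hJ : 2 * |J| ≤ p)
    {k t R S : ℕ} (hk : 2 ≤ k)
    (hinj : Function.Injective fun v : Fin (2 * t + 1) =>
      Complex.exp (θ * Complex.I) ^ ((v : ℤ) - t))
    (hpts : ∀ r s r' s' : ℤ, |r| ≤ R → |s| ≤ S → |r'| ≤ R → |s'| ≤ S →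
      r * J + s * p = r' * J + s' * p → r = r' ∧ s = s')
    (hcard : (2 * t + 1) * (k - 1) < (2 * R + 1) * (2 * S + 1)) (hS : 0 < S)
    {ρ : ℝ} (hρ : 2 ≤ ρ)
    (happ : (R + t : ℕ) * t * |p * θ - Real.pi * J| / p ≤ (ρ ^ (k * (2 * t + 1)))⁻¹) :
    (k * (2 * t + 1) - 1 : ℝ) / 2 * Real.log ρ ≤
      Nat.sqrt ((2 * S + 1) * ((R + t) * ((R + t) + 1) * (2 * (R + t) + 1) / 3)
        * (k * (t * (t + 1) * (2 * t + 1) / 3))) / (k * (2 * t + 1) : ℝ) * Real.log ‖α * β‖ +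
      Real.log (k * (2 * t + 1) + 1) + Real.log (k * (2 * t + 1)) + Real.log 3 +
      (k - 1) / 2 * Real.log (2 * Real.exp 1 * (ρ * (p * ((R + t) / 2 + S)) + k) / (k - 1)) +
      Real.pi * (ρ * ((R + t) / 2 + S)) * (t * (t + 1) / (2 * t + 1)) := by
  classical
  set ω := Complex.exp (θ * Complex.I) with hωdef
  have hω0 : ω ≠ 0 := Complex.exp_ne_zero _
  have hβ0 : β ≠ 0 := by rintro rfl; simp at hy; linarith
  have hα0 : α ≠ 0 := by rintro rfl; simp at hy; linarith
  have hp' : (0 : ℝ) < p := by exact_mod_cast hp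
  have hS' : (0 : ℝ) < S := by exact_mod_cast hS
  have hρ0 : 0 < ρ := by linarith
  set N := k * (2 * t + 1) with hN
  have hN0 : 0 < N := by positivity
  set Z : ℝ := p * ((R + t) / 2 + S) with hZdef
  have hZ : 0 < Z := by positivity
  set T : ℝ := ρ * Z with hT
  have hT0 : 0 < T := by positivity
  let e : Fin (2 * t + 1) → ℤ := fun v => (v : ℤ) - t
  have he : ∀ v, |e v| ≤ t := fun v => by
    have := v.2
    simp only [e]; rw [abs_le]; constructor <;> omega
  obtain ⟨c, hcR, hcS, hdet⟩ := exists_interpolation_det_ne_zero (k := k) (R := R) (S := S) hω0 e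
    hinj J p le_rfl hpts hcard
  -- reindexing by `Fin N`
  let f : Fin N ≃ Fin k × Fin (2 * t + 1) := finProdFinEquiv.symm
  let ev : Fin N → ℤ := fun i => e (f i).2
  let ch : Fin N → Fin N → ℤ := fun i j =>
    Ring.choose ((c (f j)).1 * J + (c (f j)).2 * p) ((f i).1 : ℕ)
  let M : Matrix (Fin N) (Fin N) ℂ := Matrix.of fun i j =>
    (ch i j : ℂ) * (ω ^ (c (f j)).1 * (-1) ^ (c (f j)).2) ^ ev i
  have hMdet : M.det ≠ 0 := by
    rw [← Matrix.det_submatrix_equiv_self f] at hdet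
    exact hdet
  have hcinj : Function.Injective (c ∘ f) := by
    intro j j' h
    by_contra hne
    refine hMdet (Matrix.det_zero_of_column_eq hne fun i => ?_)
    have h' : c (f j) = c (f j') := h
    simp only [M, ch, Matrix.of_apply, h']
  -- lower bound
  set E := Nat.sqrt ((2 * S + 1) * ((R + t) * ((R + t) + 1) * (2 * (R + t) + 1) / 3)
        * (k * (t * (t + 1) * (2 * t + 1) / 3))) with hE
  have hlow : 1 ≤ ‖α * β‖ ^ E * ‖M.det‖ := by
    refine one_le_norm_pow_mul_norm_det O hO hα hβ hα0 hβ0 hω ch (fun j => (c (f j)).1)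
      (fun j => (c (f j)).2) ev E (fun σ => ?_) hMdet
    exact abs_sum_mul_le_sqrt (c ∘ f) hcinj (fun j => hcR _) (fun j => hcS _) f σ
  -- upper bound
  let A₀ : Fin N → ℝ := fun i =>
    (T + k) ^ ((f i).1 : ℕ) / ((f i).1 : ℕ).factorial * Real.exp (Real.pi * |(ev i : ℝ)| * T / p)
  have hA₀ : ∀ i, 0 < A₀ i := fun i => by positivity
  let F : Fin N → ℂ → ℂ := fun i z =>
    (choosePoly ℂ (f i).1).eval z * Complex.exp (Real.pi * ev i / p * z * Complex.I)
  have hFd : ∀ i, Differentiable ℂ (F i) := fun i => by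
    refine (Polynomial.differentiable _).mul (Complex.differentiable_exp.comp ?_)
    fun_prop
  have hFA : ∀ i, ∀ z : ℂ, ‖z‖ = ρ * Z → ‖F i z‖ ≤ A₀ i := by
    intro i z hz
    rw [norm_mul]
    refine mul_le_mul (norm_choosePoly_eval_le _ _ (f i).1.2 hz.le) ?_ (norm_nonneg _)
      (by positivity)
    refine (Complex.norm_exp_le_exp_norm _).trans (Real.exp_le_exp.2 (le_of_eq ?_))
    rw [norm_mul, norm_mul, norm_div, norm_mul, Complex.norm_I, hz, Complex.norm_real,
      Complex.norm_intCast, Complex.norm_natCast, Real.norm_of_nonneg Real.pi_pos.le, mul_one]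
    ring
  choose x hx hx' using fun i => exists_taylor_approx (hFd i) hρ hZ (hFA i)
  let zt : Fin N → ℤ := fun j => (c (f j)).1 * J + (c (f j)).2 * p
  have hzt : ∀ j, ‖(zt j : ℂ)‖ ≤ Z := by
    intro j
    have h1 : |((c (f j)).1 : ℝ)| ≤ R + t := by exact_mod_cast hcR (f j)
    have h2 : |((c (f j)).2 : ℝ)| ≤ S := by exact_mod_cast hcS (f j)
    have h3 : |(J : ℝ)| ≤ p / 2 := by
      have : (2 : ℝ) * |(J : ℝ)| ≤ p := by exact_mod_cast hJ
      linarith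
    rw [Complex.norm_intCast]
    simp only [zt]
    push_cast
    calc |((c (f j)).1 : ℝ) * J + (c (f j)).2 * p| ≤
          |((c (f j)).1 : ℝ)| * |(J : ℝ)| + |((c (f j)).2 : ℝ)| * p := by
          refine (abs_add_le _ _).trans (le_of_eq ?_)
          rw [abs_mul, abs_mul, abs_of_pos hp']
      _ ≤ (R + t) * (p / 2) + S * p := by gcongr
      _ = Z := by rw [hZdef]; ring
  have hup := norm_det_le_of_rows_approx ρ (by linarith) M (fun i => 3 * A₀ i)
    (fun i => by have := hA₀ i; positivity) x (fun m j => ((zt j : ℂ) / Z) ^ m) ?_ ?_ ?_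
  rotate_left
  · intro i m
    refine (hx i m).trans ?_
    have := hA₀ i
    gcongr; linarith
  · intro m j
    rw [norm_pow]
    refine pow_le_one₀ (norm_nonneg _) ?_
    rw [norm_div, Complex.norm_real, Real.norm_of_nonneg hZ.le]
    exact div_le_one_of_le₀ (hzt j) hZ.le
  · intro i j
    have h1 := hx' i N (zt j) (hzt j)
    have h2 : ‖M i j - F i (zt j)‖ ≤ A₀ i * (ρ ^ N)⁻¹ := by
      have e1 : (choosePoly ℂ (f i).1).eval (zt j : ℂ) = (ch i j : ℂ) :=
        choosePoly_eval_intCast (K := ℂ) _ (zt j)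
      have e2 : (ω ^ (c (f j)).1 * (-1) ^ (c (f j)).2) ^ ev i = Complex.exp
          ((((c (f j)).1 * θ + (c (f j)).2 * Real.pi) * ev i : ℝ) * Complex.I) := by
        rw [← Complex.exp_pi_mul_I, hωdef, ← Complex.exp_int_mul, ← Complex.exp_int_mul,
          ← Complex.exp_add, ← Complex.exp_int_mul]
        congr 1; push_cast; ring
      have e3 : Complex.exp (Real.pi * ev i / p * (zt j : ℂ) * Complex.I) = Complex.exp
          (((Real.pi * ev i / p * (zt j : ℝ)) : ℝ) * Complex.I) := by push_cast; rfl
      have e4 : M i j - F i (zt j) = (ch i j : ℂ) * (Complex.exp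
          ((((c (f j)).1 * θ + (c (f j)).2 * Real.pi) * ev i : ℝ) * Complex.I) - Complex.exp
          (((Real.pi * ev i / p * (zt j : ℝ)) : ℝ) * Complex.I)) := by
        simp only [M, F, Matrix.of_apply]
        rw [e1, e2, e3]; ring
      have hZT : Z ≤ T := by rw [hT]; nlinarith
      rw [e4, norm_mul, ← e1]
      refine (mul_le_mul (norm_choosePoly_eval_le _ _ (f i).1.2 ((hzt j).trans hZT))
        (norm_exp_ofReal_mul_I_sub_le _ _) (norm_nonneg _) (by positivity)).trans ?_
      · simp only [A₀]
        rw [mul_assoc]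
        gcongr
        have e5 : ((c (f j)).1 * θ + (c (f j)).2 * Real.pi) * ev i - Real.pi * ev i / p * (zt j : ℝ)
            = (c (f j)).1 * ev i * (p * θ - Real.pi * J) / p := by
          simp only [zt]; push_cast; field_simp; ring
        rw [e5, abs_div, abs_mul, abs_mul, abs_of_pos hp']
        have h1 : |((c (f j)).1 : ℝ)| ≤ (R + t : ℕ) := by exact_mod_cast hcR (f j)
        have h2 : |(ev i : ℝ)| ≤ t := by exact_mod_cast he (f i).2
        calc _ ≤ (R + t : ℕ) * t * |p * θ - Real.pi * J| / p := by gcongr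
          _ ≤ 1 * (ρ ^ N)⁻¹ := by rw [one_mul]; exact happ
          _ ≤ _ := by
            gcongr
            exact Real.one_le_exp (by positivity)
    calc _ = ‖(M i j - F i (zt j)) + (F i (zt j) - ∑ m ∈ Finset.range N, x i m * ((zt j : ℂ) / Z) ^ m)‖ := by
          rw [sub_add_sub_cancel]
      _ ≤ A₀ i * (ρ ^ N)⁻¹ + 2 * A₀ i * (ρ ^ N)⁻¹ := (norm_add_le _ _).trans (add_le_add h2 h1)
      _ = _ := by ring
  -- taking logarithms
  have hdpos : 0 < ‖M.det‖ := norm_pos_iff.2 hMdet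
  have hy0 : 0 < ‖α * β‖ := by linarith
  have hl1 : 0 ≤ E * Real.log ‖α * β‖ + Real.log ‖M.det‖ := by
    rw [← Real.log_pow, ← Real.log_mul (by positivity) hdpos.ne']
    exact Real.log_nonneg hlow
  have hPA : 0 < ∏ i, 3 * A₀ i := Finset.prod_pos fun i _ => by have := hA₀ i; positivity
  have hl2 : Real.log ‖M.det‖ ≤ N * Real.log (N + 1) + Real.log N.factorial +
      Real.log (∏ i, 3 * A₀ i) - (N * (N - 1) / 2 : ℕ) * Real.log ρ := by
    have := Real.log_le_log hdpos hup
    rw [Real.log_mul (by positivity) (by positivity), Real.log_mul (by positivity) hPA.ne',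
      Real.log_mul (by positivity) (by positivity), Real.log_inv, Real.log_pow, Real.log_pow] at this
    linarith
  have hfac : Real.log N.factorial ≤ N * Real.log N := by
    rw [← Real.log_pow]
    exact Real.log_le_log (by positivity) (by exact_mod_cast Nat.factorial_le_pow N)
  have hNdiv : ((N * (N - 1) / 2 : ℕ) : ℝ) = N * (N - 1) / 2 := by
    rw [Nat.cast_div (even_iff_two_dvd.1 (Nat.even_mul_pred_self N)) (by norm_num)]
    push_cast [Nat.cast_sub hN0]; ring
  have hNk : (N : ℝ) = k * (2 * t + 1) := by rw [hN]; push_cast; ring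
  have habs : ∑ v : Fin (2 * t + 1), |(e v : ℝ)| = t * (t + 1) := by
    have : ∑ v : Fin (2 * t + 1), |(e v : ℝ)| = ((∑ v ∈ Finset.range (2 * t + 1), |(v : ℤ) - t| : ℤ) : ℝ) := by
      rw [← Fin.sum_univ_eq_sum_range (fun v => |(v : ℤ) - t|)]
      push_cast; simp [e]
    rw [this]
    have : ∀ n : ℕ, ∑ v ∈ Finset.range (2 * n + 1), |(v : ℤ) - n| = n * (n + 1) := by
      intro n
      induction n with
      | zero => simp
      | succ n ih =>
        rw [show 2 * (n + 1) + 1 = (2 * n + 1 + 1) + 1 by ring, Finset.sum_range_succ,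
          Finset.sum_range_succ']
        have : ∀ v ∈ Finset.range (2 * n + 1), |((v + 1 : ℕ) : ℤ) - (n + 1 : ℕ)| = |(v : ℤ) - n| := by
          intro v _; push_cast; congr 1; ring
        rw [Finset.sum_congr rfl this, ih]
        push_cast
        rw [abs_of_nonpos (by linarith), abs_of_nonneg (by linarith)]
        ring
    rw [this]; push_cast; ring
  have hlA : Real.log (∏ i, 3 * A₀ i) ≤ N * Real.log 3 + (2 * t + 1) * (k * ((k - 1) / 2 *
      Real.log (2 * Real.exp 1 * (T + k) / (k - 1)))) + k * (Real.pi * T / p * (t * (t + 1))) := by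
    rw [Real.log_prod fun i _ => (by have := hA₀ i; positivity)]
    have e1 : ∀ i, Real.log (3 * A₀ i) = Real.log 3 + ((((f i).1 : ℕ) * Real.log (T + k) -
        Real.log ((f i).1 : ℕ).factorial) + Real.pi * T / p * |(e (f i).2 : ℝ)|) := by
      intro i
      simp only [A₀]
      rw [Real.log_mul (by norm_num) (by positivity), Real.log_mul (by positivity) (by positivity),
        Real.log_div (by positivity) (by positivity), Real.log_pow, Real.log_exp]
      simp only [ev]; ring
    rw [Finset.sum_congr rfl fun i _ => e1 i, Finset.sum_add_distrib, Finset.sum_const,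
      Finset.card_univ, Fintype.card_fin, nsmul_eq_mul, Equiv.sum_comp f (fun q : Fin k × Fin (2 * t + 1) =>
      ((((q.1 : ℕ) : ℝ) * Real.log (T + k) - Real.log (q.1 : ℕ).factorial) +
        Real.pi * T / p * |(e q.2 : ℝ)|)), Finset.sum_add_distrib, Fintype.sum_prod_type,
      Fintype.sum_prod_type]
    simp only [Finset.sum_const, Finset.card_univ, Fintype.card_fin, nsmul_eq_mul]
    rw [← Finset.mul_sum, ← Finset.mul_sum, habs, Fin.sum_univ_eq_sum_range
      (fun u => (u : ℝ) * Real.log (T + k) - Real.log u.factorial)]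
    have := sum_mul_log_sub_log_factorial_le hk (X := T + k) (by positivity)
    have h2 : (0 : ℝ) ≤ (2 * t + 1 : ℕ) := by positivity
    have h3 := mul_le_mul_of_nonneg_left this h2
    push_cast at h3 ⊢
    linarith
  have hfin : N * ((N - 1) / 2 * Real.log ρ) ≤ E * Real.log ‖α * β‖ + N * Real.log (N + 1) +
      N * Real.log N + (N * Real.log 3 + (2 * t + 1) * (k * ((k - 1) / 2 *
      Real.log (2 * Real.exp 1 * (T + k) / (k - 1)))) + k * (Real.pi * T / p * (t * (t + 1)))) := by
    rw [hNdiv] at hl2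
    linarith
  have hNpos : (0 : ℝ) < N := by exact_mod_cast hN0
  have hTp : T / p = ρ * ((R + t) / 2 + S) := by
    rw [hT, hZdef]; field_simp
  rw [← hNk]
  have hgoal : ∀ a b : ℝ, N * a ≤ N * b → a ≤ b := fun a b h => le_of_mul_le_mul_left h hNpos
  apply hgoal
  refine hfin.trans (le_of_eq ?_)
  rw [mul_div_assoc Real.pi T, hTp]
  have ht : (2 * (t : ℝ) + 1) ≠ 0 := by positivity
  have hkt : (N : ℝ) / (2 * t + 1) = k := by rw [hNk]; field_simp
  generalize Real.log (2 * Real.exp 1 * (T + k) / (k - 1)) = X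
  generalize ρ * ((R + t : ℝ) / 2 + S) = Y
  have e1 : Real.pi * Y * (t * (t + 1) / (2 * t + 1)) = k * (Real.pi * Y * (t * (t + 1))) / N := by
    rw [← hkt]; field_simp
  rw [e1]
  field_simp
  rw [hNk]; ring

end

lemma natSqrt_interpolation_le {t m : ℕ} (ht : 8 ≤ t) (hm : 5 ≤ m) :
    Nat.sqrt ((2 * ((2 * t + 1) * m) + 1) *
        ((10 * t + t) * ((10 * t + t) + 1) * (2 * (10 * t + t) + 1) / 3)
        * (40 * t * m * (t * (t + 1) * (2 * t + 1) / 3))) ≤ 166 * ((2 * t + 1) * m * t ^ 3) := by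
  rw [← Nat.sqrt_eq' (166 * ((2 * t + 1) * m * t ^ 3))]
  apply Nat.sqrt_le_sqrt
  have hT : 85 ≤ (2 * t + 1) * m := by nlinarith
  have h1 : 85 * (2 * ((2 * t + 1) * m) + 1) ≤ 171 * ((2 * t + 1) * m) := by omega
  have h2 : 3 * ((10 * t + t) * ((10 * t + t) + 1) * (2 * (10 * t + t) + 1) / 3) * 64 ≤
      11 * 89 * 177 * t ^ 3 := by
    have h0 := Nat.mul_div_le ((10 * t + t) * ((10 * t + t) + 1) * (2 * (10 * t + t) + 1)) 3
    have ha : 8 * (11 * t + 1) ≤ 89 * t := by omega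
    have hb : 8 * (22 * t + 1) ≤ 177 * t := by omega
    calc _ ≤ ((10 * t + t) * ((10 * t + t) + 1) * (2 * (10 * t + t) + 1)) * 64 := by gcongr
      _ = 11 * t * ((8 * (11 * t + 1)) * (8 * (22 * t + 1))) := by ring
      _ ≤ 11 * t * ((89 * t) * (177 * t)) := by gcongr
      _ = _ := by ring
  have h3 : 3 * (t * (t + 1) * (2 * t + 1) / 3) * 8 ≤ 9 * t ^ 2 * (2 * t + 1) := by
    have h0 := Nat.mul_div_le (t * (t + 1) * (2 * t + 1)) 3
    have ha : 8 * (t + 1) ≤ 9 * t := by omega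
    calc _ ≤ (t * (t + 1) * (2 * t + 1)) * 8 := by gcongr
      _ = t * (8 * (t + 1)) * (2 * t + 1) := by ring
      _ ≤ t * (9 * t) * (2 * t + 1) := by gcongr
      _ = _ := by ring
  generalize (10 * t + t) * ((10 * t + t) + 1) * (2 * (10 * t + t) + 1) / 3 = A at *
  generalize t * (t + 1) * (2 * t + 1) / 3 = B at *
  have key := Nat.mul_le_mul (Nat.mul_le_mul h1 h2) (Nat.mul_le_mul (le_refl (40 * t * m)) h3)
  have e1 : 85 * (2 * ((2 * t + 1) * m) + 1) * (3 * A * 64) * (40 * t * m * (3 * B * 8)) =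
    (85 * 3 * 64 * 3 * 8) * ((2 * ((2 * t + 1) * m) + 1) * A * (40 * t * m * B)) := by ring
  have e2 : 171 * ((2 * t + 1) * m) * (11 * 89 * 177 * t ^ 3) * (40 * t * m * (9 * t ^ 2 * (2 * t + 1)))
    = (171 * 11 * 89 * 177 * 40 * 9) * ((2 * t + 1) * m * t ^ 3) ^ 2 := by ring
  rw [e1, e2] at key
  generalize (2 * ((2 * t + 1) * m) + 1) * A * (40 * t * m * B) = Z at *
  rw [mul_pow]
  generalize ((2 * t + 1) * m * t ^ 3) ^ 2 = W at *
  omega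

set_option maxHeartbeats 1000000 in
lemma interpolation_parameters_contradiction {t m p : ℕ} (ht : 8 ≤ t) (hm : 5 ≤ m) {L : ℝ}
    {N : ℕ} {ν : ℝ} (hN : N = 1875 ∧ ν = 3 / 2 ∨ N = 532 ∧ ν = 1 / 2) (hL : ν * L ≤ m)
    (hL0 : 0 ≤ L) (hp : 4 * p ≤ N * (t + 1) ^ 2) :
    Nat.sqrt ((2 * ((2 * t + 1) * m) + 1) *
        ((10 * t + t) * ((10 * t + t) + 1) * (2 * (10 * t + t) + 1) / 3)
        * (40 * t * m * (t * (t + 1) * (2 * t + 1) / 3))) / ((40 * t * m : ℕ) * (2 * t + 1) : ℝ) * L +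
      Real.log ((40 * t * m : ℕ) * (2 * t + 1) + 1) + Real.log ((40 * t * m : ℕ) * (2 * t + 1))
        + Real.log 3 +
      ((40 * t * m : ℕ) - 1) / 2 * Real.log (2 * Real.exp 1 *
        (4 * (p * (((10 * t : ℕ) + t) / 2 + ((2 * t + 1) * m : ℕ))) + (40 * t * m : ℕ)) /
          ((40 * t * m : ℕ) - 1)) +
      Real.pi * (4 * (((10 * t : ℕ) + t) / 2 + ((2 * t + 1) * m : ℕ))) * (t * (t + 1) / (2 * t + 1))
      < ((40 * t * m : ℕ) * (2 * t + 1) - 1 : ℝ) / 2 * Real.log 4 := by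
  have hsq := natSqrt_interpolation_le ht hm
  have hsq' := (Nat.cast_le (α := ℝ)).2 hsq
  set Q : ℝ := _ with hQ
  change Q ≤ _ at hsq'
  push_cast at hsq' ⊢
  have hpR : 4 * (p : ℝ) ≤ N * (t + 1) ^ 2 := by exact_mod_cast hp
  have htR : (8 : ℝ) ≤ t := by exact_mod_cast ht
  have hmR : (5 : ℝ) ≤ m := by exact_mod_cast hm
  clear_value Q
  have hp0 : (0 : ℝ) ≤ p := Nat.cast_nonneg p
  generalize (t : ℝ) = t at *
  generalize (m : ℝ) = m at *
  generalize (p : ℝ) = p at *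
  have hν0 : 0 < ν := by rcases hN with ⟨rfl, rfl⟩ | ⟨rfl, rfl⟩ <;> norm_num
  have hN0 : (532 : ℝ) ≤ N := by rcases hN with ⟨rfl, rfl⟩ | ⟨rfl, rfl⟩ <;> norm_num
  have hu : 40 ≤ t * m := by nlinarith
  have l2 := Real.log_two_gt_d9
  have l2' := Real.log_two_lt_d9
  have l4 : Real.log 4 = 2 * Real.log 2 := by
    rw [show (4 : ℝ) = 2 ^ 2 by norm_num, Real.log_pow]; norm_num
  have t1 : Q / (40 * t * m * (2 * t + 1)) * L ≤ 4.15 * t * (t * m) / ν := by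
    have h1 : Q / (40 * t * m * (2 * t + 1)) ≤ 4.15 * t ^ 2 := by
      rw [div_le_iff₀ (by positivity)]
      nlinarith
    rw [le_div_iff₀ hν0]
    calc _ = Q / (40 * t * m * (2 * t + 1)) * (ν * L) := by ring
      _ ≤ 4.15 * t ^ 2 * m := by
          apply mul_le_mul h1 hL (by positivity) (by positivity)
      _ = _ := by ring
  have logle : ∀ N : ℝ, 0 < N → Real.log N ≤ 11 + N / 65536 := by
    intro N hN
    have h := Real.log_le_sub_one_of_pos (x := N / 2 ^ 16) (by positivity)
    rw [Real.log_div hN.ne' (by norm_num), Real.log_pow] at h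
    norm_num at h ⊢
    linarith
  have t2 : Real.log (40 * t * m * (2 * t + 1) + 1) ≤ 12 + (t * m) * (2 * t + 1) / 1000 := by
    have := logle (40 * t * m * (2 * t + 1) + 1) (by positivity)
    nlinarith
  have t3 : Real.log (40 * t * m * (2 * t + 1)) ≤ 12 + (t * m) * (2 * t + 1) / 1000 := by
    have := logle (40 * t * m * (2 * t + 1)) (by positivity)
    nlinarith
  have t4 : Real.log 3 ≤ 2 := by
    have := Real.log_le_sub_one_of_pos (x := 3) (by norm_num); linarith
  have t5 : (40 * t * m - 1) / 2 * Real.log (2 * Real.exp 1 *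
        (4 * (p * ((10 * t + t) / 2 + (2 * t + 1) * m)) + 40 * t * m) / (40 * t * m - 1)) ≤
        20 * (t * m) * (11.112 + 2 * ((t + 1) / 9 - 1) + (N / 1875 - 1)) := by
    have hk : 0 < 40 * t * m - 1 := by nlinarith
    have hlog : Real.log (2 * Real.exp 1 *
        (4 * (p * ((10 * t + t) / 2 + (2 * t + 1) * m)) + 40 * t * m) / (40 * t * m - 1)) ≤
        11.112 + 2 * ((t + 1) / 9 - 1) + (N / 1875 - 1) := by
      have hG : 2 * Real.exp 1 *
        (4 * (p * ((10 * t + t) / 2 + (2 * t + 1) * m)) + 40 * t * m) / (40 * t * m - 1) ≤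
          2 ^ 16 * (66906 / 65536) * ((t + 1) / 9) ^ 2 * (N / 1875) := by
        rw [div_le_iff₀ hk]
        have he := Real.exp_one_lt_d9
        have ha : (10 * t + t) / 2 + (2 * t + 1) * m ≤ 3.225 * (t * m) := by nlinarith
        have hb : 4 * (p * ((10 * t + t) / 2 + (2 * t + 1) * m)) ≤
            N * (t + 1) ^ 2 * (3.225 * (t * m)) := by
          rw [← mul_assoc]
          exact mul_le_mul hpR ha (by nlinarith) (by positivity)
        have hc : 4 * (p * ((10 * t + t) / 2 + (2 * t + 1) * m)) + 40 * t * m ≤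
            (3.226 * N * (t * m)) * (t + 1) ^ 2 := by
          have h81 : 81 ≤ (t + 1) ^ 2 := by nlinarith
          have : 40 * (t * m) ≤ 0.495 * (t * m) * (t + 1) ^ 2 := by
            nlinarith [mul_le_mul_of_nonneg_left h81 (by linarith : 0 ≤ t * m)]
          have h532 := mul_le_mul_of_nonneg_right hN0
            (by positivity : 0 ≤ t * m * (t + 1) ^ 2)
          linarith
        calc _ ≤ 2 * 2.7182818286 * ((3.226 * N * (t * m)) * (t + 1) ^ 2) := by
              gcongr
          _ ≤ _ := by
              have : 2 * 2.7182818286 * (3.226 * (t * m)) ≤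
                  66906 / 81 / 1875 * (40 * t * m - 1) := by nlinarith
              nlinarith [mul_le_mul_of_nonneg_right this
                (by positivity : 0 ≤ N * (t + 1) ^ 2)]
      refine (Real.log_le_log ?_ hG).trans ?_
      · positivity
      rw [Real.log_mul (by positivity) (by positivity), Real.log_mul (by norm_num) (by positivity),
        Real.log_mul (by norm_num) (by norm_num), Real.log_pow, Real.log_pow]
      have h0 := Real.log_le_sub_one_of_pos (x := (N : ℝ) / 1875) (by positivity)
      have h1 := Real.log_le_sub_one_of_pos (x := 66906 / 65536) (by norm_num)
      have h2 := Real.log_le_sub_one_of_pos (x := (t + 1) / 9) (by positivity)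
      norm_num at h1 ⊢
      linarith
    refine (mul_le_mul_of_nonneg_left hlog (by linarith)).trans ?_
    apply mul_le_mul_of_nonneg_right _ _
    · linarith
    · have : 0 ≤ (N : ℝ) / 1875 := by positivity
      linarith
  have t6 : Real.pi * (4 * ((10 * t + t) / 2 + (2 * t + 1) * m)) * (t * (t + 1) / (2 * t + 1)) ≤
      19.48 * (t * m) * (t + 1) := by
    have h1 : (4 * ((10 * t + t) / 2 + (2 * t + 1) * m)) * (t * (t + 1) / (2 * t + 1)) ≤
        6.2 * (t * m) * (t + 1) := by
      rw [← mul_div_assoc, div_le_iff₀ (by positivity)]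
      have : 4 * ((10 * t + t) / 2 + (2 * t + 1) * m) ≤ 6.2 * m * (2 * t + 1) := by nlinarith
      nlinarith [mul_le_mul_of_nonneg_right this (by positivity : 0 ≤ t * (t + 1))]
    have hpi := Real.pi_lt_d6
    rw [mul_assoc]
    calc _ ≤ 3.141593 * (6.2 * (t * m) * (t + 1)) := by
          apply mul_le_mul hpi.le h1 (by positivity) (by norm_num)
      _ ≤ _ := by nlinarith [mul_nonneg (by linarith : 0 ≤ t * m) (by linarith : 0 ≤ t + 1)]
  rw [l4]
  have hk0 : 0 ≤ 40 * t * m * (2 * t + 1) - 1 := by nlinarith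
  have hfin : 0.6931 * (40 * t * m * (2 * t + 1) - 1) ≤
      (40 * t * m * (2 * t + 1) - 1) / 2 * (2 * Real.log 2) := by
    nlinarith [mul_le_mul_of_nonneg_left l2.le hk0]
  have hut : t * m * 8 ≤ t * m * t := mul_le_mul_of_nonneg_left htR (by linarith)
  have e1 : 40 * t * m * (2 * t + 1) = 80 * (t * m * t) + 40 * (t * m) := by ring
  have e2 : (t * m) * (2 * t + 1) / 1000 = (2 * (t * m * t) + t * m) / 1000 := by ring
  have e3 : 20 * (t * m) * (11.112 + 2 * ((t + 1) / 9 - 1) + (N / 1875 - 1)) =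
    20 * (11.112 - 16 / 9 + (N / 1875 - 1)) * (t * m) + 40 / 9 * (t * m * t) := by ring
  have e4 : 19.48 * (t * m) * (t + 1) = 19.48 * (t * m * t) + 19.48 * (t * m) := by ring
  have e5 : 4.15 * t * (t * m) / ν = 4.15 / ν * (t * m * t) := by ring
  rw [← hQ]
  rw [e1] at hfin hk0 ⊢
  rw [e1, e2] at t2 t3
  rw [e1, e5] at t1
  rw [e3] at t5
  rw [e4] at t6
  rcases hN with ⟨rfl, rfl⟩ | ⟨rfl, rfl⟩ <;> norm_num at t1 t5 ⊢ <;> linarith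

section

open Complex

lemma zsqrtd_pow_im_zmod {d : ℤ} (A : ℤ√d) (m : ℕ) :
    A.norm ∣ (A ^ (m + 1)).im - (2 * A.re) ^ m * A.im := by
  have key : ∀ m : ℕ, A.norm ∣ (A ^ (m + 1)).im - (2 * A.re) ^ m * A.im ∧
      A.norm ∣ (A ^ (m + 2)).im - (2 * A.re) ^ (m + 1) * A.im := by
    intro m
    induction m with
    | zero => exact ⟨by simp, ⟨0, by simp [pow_succ]; ring⟩⟩
    | succ m ih =>
      refine ⟨ih.2, ?_⟩
      have h : A ^ (m + 1 + 2) = (2 * A.re : ℤ) * A ^ (m + 2) - (A.norm : ℤ) * A ^ (m + 1) := by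
        have h2 : A ^ 2 = (2 * A.re : ℤ) * A - (A.norm : ℤ) := by
          ext <;> simp [pow_two, Zsqrtd.norm] <;> ring
        rw [show m + 1 + 2 = m + 1 + 2 from rfl, pow_add, h2]; ring
      rw [h]
      have him : ((2 * A.re : ℤ) * A ^ (m + 2) - (A.norm : ℤ) * A ^ (m + 1)).im =
          (2 * A.re) * (A ^ (m + 2)).im - A.norm * (A ^ (m + 1)).im := by
        simp
      rw [him]
      have := (ih.2.mul_left (2 * A.re)).sub (dvd_mul_right A.norm (A ^ (m + 1)).im)
      have e : 2 * A.re * (A ^ (m + 2)).im - A.norm * (A ^ (m + 1)).im -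
          (2 * A.re) ^ (m + 1 + 1) * A.im = 2 * A.re * ((A ^ (m + 2)).im -
          (2 * A.re) ^ (m + 1) * A.im) - A.norm * (A ^ (m + 1)).im := by ring
      rw [e]; exact this
  exact (key m).1

noncomputable def sqrtNegEleven : {r : ℂ // r * r = ((-11 : ℤ) : ℂ)} :=
  ⟨(√11 : ℝ) * I, by
    rw [mul_mul_mul_comm, ← ofReal_mul, Real.mul_self_sqrt (by norm_num), I_mul_I]; norm_num⟩

noncomputable def toComplexEleven : ℤ√(-11) →+* ℂ := Zsqrtd.lift sqrtNegEleven

lemma toComplexEleven_re (A : ℤ√(-11)) : (toComplexEleven A).re = A.re := by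
  simp [toComplexEleven, Zsqrtd.lift, sqrtNegEleven]

lemma toComplexEleven_im (A : ℤ√(-11)) : (toComplexEleven A).im = A.im * √11 := by
  simp [toComplexEleven, Zsqrtd.lift, sqrtNegEleven]

lemma toComplexEleven_star (A : ℤ√(-11)) :
    toComplexEleven (star A) = (starRingEnd ℂ) (toComplexEleven A) := by
  apply Complex.ext <;> simp [toComplexEleven_re, toComplexEleven_im]

lemma normSq_toComplexEleven (A : ℤ√(-11)) :
    Complex.normSq (toComplexEleven A) = A.norm := by
  rw [Complex.normSq_apply, toComplexEleven_re, toComplexEleven_im, Zsqrtd.norm]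
  have : √(11 : ℝ) * √11 = 11 := Real.mul_self_sqrt (by norm_num)
  push_cast
  linear_combination (A.im : ℝ) ^ 2 * this

lemma one_le_norm_toComplexEleven_range (x : ℂ) (hx : x ∈ toComplexEleven.range) (h0 : x ≠ 0) :
    1 ≤ ‖x‖ := by
  obtain ⟨A, rfl⟩ := hx
  have h := Complex.normSq_pos.2 h0
  rw [normSq_toComplexEleven] at h
  have h1 : (1 : ℝ) ≤ A.norm := by
    have : 0 < A.norm := by exact_mod_cast h
    exact_mod_cast this
  rw [← normSq_toComplexEleven, Complex.normSq_eq_norm_sq] at h1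
  nlinarith [norm_nonneg (toComplexEleven A)]

lemma exists_angle {z : ℂ} (hz : ‖z‖ = 1) :
    ∃ θ : ℝ, |θ| ≤ Real.pi / 2 ∧ (exp (θ * I) = z ∨ exp (θ * I) = -z) := by
  by_cases h : 0 ≤ z.re
  · refine ⟨arg z, ?_, Or.inl ?_⟩
    · exact abs_arg_le_pi_div_two_iff.2 h
    · have := norm_mul_exp_arg_mul_I z
      rwa [hz, ofReal_one, one_mul] at this
  · refine ⟨arg (-z), ?_, Or.inr ?_⟩
    · exact abs_arg_le_pi_div_two_iff.2 (by simp; linarith)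
    · have := norm_mul_exp_arg_mul_I (-z)
      rwa [norm_neg, hz, ofReal_one, one_mul] at this

lemma exists_int_abs_sub_le (x : ℝ) : 
    |x - Real.pi * round (x / Real.pi)| ≤ Real.pi / 2 * |Real.sin x| := by
  set J := round (x / Real.pi)
  have h1 : |x - Real.pi * J| ≤ Real.pi / 2 := by
    have := abs_sub_round (x / Real.pi)
    have e : x - Real.pi * J = Real.pi * (x / Real.pi - J) := by
      field_simp [Real.pi_pos.ne']
    rw [e, abs_mul, abs_of_pos Real.pi_pos]
    have hp := Real.pi_pos
    nlinarith
  have h2 : |Real.sin x| = |Real.sin (x - Real.pi * J)| := by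
    rw [mul_comm, Real.sin_sub_int_mul_pi]
    rw [abs_mul]
    simp
  rw [h2]
  have := Real.mul_abs_le_abs_sin h1
  have hp := Real.pi_pos
  calc |x - Real.pi * J| = Real.pi / 2 * (2 / Real.pi * |x - Real.pi * J|) := by
        field_simp
    _ ≤ _ := by gcongr

lemma abs_sin_mul_norm_pow {A : ℤ√(-11)} {θ : ℝ}
    (hA : toComplexEleven A ≠ 0)
    (hθ : exp (θ * I) = toComplexEleven A / toComplexEleven (star A) ∨
      exp (θ * I) = -(toComplexEleven A / toComplexEleven (star A))) (n : ℕ) :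
    |Real.sin (n * θ)| * (A.norm : ℝ) ^ n = 2 * |((A ^ n).re : ℝ)| * |((A ^ n).im : ℝ) * √11| := by
  have hconj : toComplexEleven A / toComplexEleven (star A) =
      (toComplexEleven A) ^ 2 / ((A.norm : ℝ) : ℂ) := by
    rw [← normSq_toComplexEleven, ← mul_conj, toComplexEleven_star]
    have : (starRingEnd ℂ) (toComplexEleven A) ≠ 0 := by simpa using hA
    field_simp
  have hN : (A.norm : ℝ) ≠ 0 := by
    rw [← normSq_toComplexEleven]; simpa using hA
  have hexp : exp ((n * θ : ℝ) * I) = exp (θ * I) ^ n := by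
    rw [← exp_nat_mul]; congr 1; push_cast; ring
  have him : Real.sin (n * θ) = (exp ((n * θ : ℝ) * I)).im := by rw [exp_ofReal_mul_I_im]
  have hsq : ((toComplexEleven A ^ 2 / ((A.norm : ℝ) : ℂ)) ^ n).im =
      2 * (((A ^ n).re : ℝ) * (((A ^ n).im : ℝ) * √11)) / (A.norm : ℝ) ^ n := by
    rw [div_pow, ← pow_mul, mul_comm 2 n, pow_mul, ← ofReal_pow, div_ofReal_im, ← map_pow, pow_two,
      mul_im, toComplexEleven_re, toComplexEleven_im]
    ring
  have habs : |Real.sin (n * θ)| = |((toComplexEleven A ^ 2 / ((A.norm : ℝ) : ℂ)) ^ n).im| := by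
    rw [him, hexp]
    rcases hθ with h | h <;> rw [h, hconj]
    rw [neg_pow]
    rcases neg_one_pow_eq_or ℂ n with h | h <;> rw [h] <;> simp
  have hNpos : 0 < (A.norm : ℝ) := by
    rw [← normSq_toComplexEleven]; exact normSq_pos.2 hA
  rw [habs, hsq, abs_div, abs_of_pos (pow_pos hNpos n), div_mul_cancel₀ _ (pow_pos hNpos n).ne',
    abs_mul, abs_mul]
  norm_num [mul_assoc]

lemma injective_pow_of_isCoprime {A : ℤ√(-11)} {θ : ℝ} (hcop : IsCoprime (2 * A.re * A.im) A.norm)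
    (hy : 1 < A.norm) (hA : toComplexEleven A ≠ 0)
    (hθ : exp (θ * I) = toComplexEleven A / toComplexEleven (star A) ∨
      exp (θ * I) = -(toComplexEleven A / toComplexEleven (star A))) {m : ℕ} (hm : m ≠ 0) :
    exp (θ * I) ^ m ≠ 1 := by
  intro h
  have h0 : Real.sin ((2 * m : ℕ) * θ) = 0 ∧ Real.sin ((m : ℕ) * θ) = 0 := by
    have hexp : ∀ n : ℕ, Real.sin (n * θ) = (exp (θ * I) ^ n).im := by
      intro n
      rw [← exp_nat_mul, ← exp_ofReal_mul_I_im]; congr 2; push_cast; ring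
    rw [hexp, hexp, mul_comm 2 m, pow_mul, h]
    simp
  have h1 := abs_sin_mul_norm_pow hA hθ m
  rw [h0.2] at h1
  simp only [abs_zero, zero_mul] at h1
  have hre_im : 2 * ((A ^ m).re * (A ^ m).im) = 0 := by
    have h11 : |√(11 : ℝ)| ≠ 0 := by positivity
    have : |((A ^ m).re : ℝ)| * |((A ^ m).im : ℝ)| = 0 := by
      rw [abs_mul] at h1
      have : (|((A ^ m).re : ℝ)| * |((A ^ m).im : ℝ)|) * |√(11 : ℝ)| = 0 := by linarith
      exact (mul_eq_zero.1 this).resolve_right h11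
    rw [← abs_mul, abs_eq_zero] at this
    have h2 : (A ^ m).re * (A ^ m).im = 0 := by exact_mod_cast this
    rw [h2]; rfl
  have h2m : (A ^ (2 * m)).im = 0 := by
    rw [mul_comm 2 m, pow_mul, pow_two, Zsqrtd.im_mul]
    linarith
  obtain ⟨j, hj⟩ : ∃ j, 2 * m = j + 1 := ⟨2 * m - 1, by omega⟩
  have hd := zsqrtd_pow_im_zmod A j
  rw [← hj, h2m, zero_sub, dvd_neg] at hd
  have hc1 : IsCoprime (2 * A.re) A.norm := hcop.of_mul_left_left
  have hc2 : IsCoprime A.im A.norm := hcop.of_mul_left_right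
  have := ((hc1.pow_left (m := j)).mul_left hc2).symm.isUnit_of_dvd' dvd_rfl hd
  rw [Int.isUnit_iff] at this
  omega

lemma six_mul_le_pow {Y : ℝ} (hY : 15 ≤ Y) {q : ℕ} (hq : 2 ≤ q) : 6 * Y ≤ Y ^ q := by
  obtain ⟨r, rfl⟩ : ∃ r, q = r + 2 := ⟨q - 2, by omega⟩
  have : (1 : ℝ) ≤ Y ^ r := one_le_pow₀ (by linarith)
  calc 6 * Y ≤ 1 * Y * Y := by nlinarith
    _ ≤ Y ^ r * Y * Y := by gcongr
    _ = Y ^ (r + 2) := by ring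

lemma four_pow_exponent_mul_log_le {t m q L l2 N c : ℝ} (ht : 8 ≤ t) (hL : 0 ≤ L)
    (hm0 : 0 ≤ m) (hm : m ≤ c * L) (hc0 : 0 ≤ c) (h2 : l2 < 0.6931471808)
    (hc : 8 * 118 * c + 0.0625 ≤ N) (htq : N * t ^ 2 ≤ 4 * (2 * q + 1)) :
    40 * t * m * (2 * t + 1) * (2 * l2) ≤ q * L := by
  have h3 : 2 * t ^ 2 + t ≤ 2.125 * t ^ 2 := by nlinarith
  have h4 : 118 * c * t ^ 2 ≤ q := by
    have := mul_le_mul_of_nonneg_right hc (sq_nonneg t)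
    have ht2 : 64 ≤ t ^ 2 := by nlinarith
    linarith
  calc 40 * t * m * (2 * t + 1) * (2 * l2) = (80 * l2) * (2 * t ^ 2 + t) * m := by ring
    _ ≤ (80 * 0.6931471808) * (2.125 * t ^ 2) * (c * L) := by
        apply mul_le_mul _ hm _ (by positivity)
        · apply mul_le_mul (by linarith) h3 (by positivity) (by norm_num)
        · exact hm0
    _ ≤ 118 * c * t ^ 2 * L := by
        have : 0 ≤ c * t ^ 2 * L := by positivity
        linarith
    _ ≤ q * L := by gcongr

set_option maxHeartbeats 1000000 in
theorem prime_lt_of_abs_pow_im_eq_aux {A : ℤ√(-11)} (ha : A.re ≠ 0) (hb : A.im ≠ 0)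
    (hcop : IsCoprime (2 * A.re * A.im) A.norm) (hy : 15 ≤ A.norm) {p : ℕ} (hp : p.Prime)
    (hp2 : p ≠ 2) (him : |(A ^ p).im| = |A.im|) {N : ℕ} {ν c : ℝ}
    (hN : N = 1875 ∧ ν = 3 / 2 ∨ N = 532 ∧ ν = 1 / 2) (hc : 8 * 118 * c + 0.0625 ≤ N)
    (hνc : 1 ≤ (c - ν) * Real.log A.norm) : p < 16 * N := by
  by_contra! hlt
  have hA : toComplexEleven A ≠ 0 := by
    intro h
    have := toComplexEleven_re A
    rw [h] at this
    exact ha (by exact_mod_cast this.symm)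
  have hA' : toComplexEleven (star A) ≠ 0 := by
    rw [toComplexEleven_star]; simpa using hA
  have hyR : (15 : ℝ) ≤ A.norm := by exact_mod_cast hy
  have hnormz : ‖toComplexEleven A / toComplexEleven (star A)‖ = 1 := by
    rw [norm_div, toComplexEleven_star, RCLike.norm_conj, div_self (by simpa using hA)]
  obtain ⟨θ, hθ1, hθ⟩ := exists_angle hnormz
  obtain ⟨q, hpq⟩ := hp.odd_of_ne_two hp2
  rw [hpq] at him
  have hsin := abs_sin_mul_norm_pow hA hθ (2 * q + 1)
  set Y : ℝ := (A.norm : ℝ) with hYdef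
  have hY0 : 0 < Y := by linarith
  have h11 : √(11 : ℝ) * √11 = 11 := Real.mul_self_sqrt (by norm_num)
  have h11p : 3 ≤ √(11 : ℝ) := Real.le_sqrt_of_sq_le (by norm_num)
  -- the sine is tiny
  have hsmall : |Real.sin ((2 * q + 1 : ℕ) * θ)| ≤ 2 / Y ^ q := by
    have hN : ((A ^ (2 * q + 1)).norm : ℝ) = Y ^ (2 * q + 1) := by
      have := map_pow (Zsqrtd.normMonoidHom (d := -11)) A (2 * q + 1)
      rw [hYdef]; exact_mod_cast this
    have e1 : ((A ^ (2 * q + 1)).norm : ℝ) =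
        ((A ^ (2 * q + 1)).re : ℝ) ^ 2 + 11 * ((A ^ (2 * q + 1)).im : ℝ) ^ 2 := by
      rw [Zsqrtd.norm]; push_cast; ring
    have e2 : Y = (A.re : ℝ) ^ 2 + 11 * (A.im : ℝ) ^ 2 := by
      rw [hYdef, Zsqrtd.norm]; push_cast; ring
    have e3 : ((A ^ (2 * q + 1)).im : ℝ) ^ 2 = (A.im : ℝ) ^ 2 := by
      rw [sq_eq_sq_iff_abs_eq_abs]; exact_mod_cast him
    rw [le_div_iff₀ (by positivity)]
    have h3 : (|Real.sin ((2 * q + 1 : ℕ) * θ)| * Y ^ (2 * q + 1)) ^ 2 ≤ (2 * Y ^ (q + 1)) ^ 2 := by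
      rw [hsin, mul_pow, mul_pow, sq_abs, sq_abs, mul_pow, e3, pow_two (√11), h11]
      have h4 : ((A ^ (2 * q + 1)).re : ℝ) ^ 2 ≤ Y ^ (2 * q + 1) := by nlinarith [sq_nonneg ((A ^ (2 * q + 1)).im : ℝ)]
      have h5 : (A.im : ℝ) ^ 2 * 11 ≤ Y := by nlinarith [sq_nonneg (A.re : ℝ)]
      calc _ ≤ 2 ^ 2 * Y ^ (2 * q + 1) * Y := by gcongr
        _ = _ := by ring
    have h6 := abs_le_of_sq_le_sq h3 (by positivity)
    have h7 : |Real.sin ((2 * q + 1 : ℕ) * θ)| * Y ^ q * Y ^ (q + 1) ≤ 2 * Y ^ (q + 1) := by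
      calc _ = |Real.sin ((2 * q + 1 : ℕ) * θ)| * Y ^ (2 * q + 1) := by ring
        _ ≤ _ := (le_abs_self _).trans h6
    exact le_of_mul_le_mul_right h7 (by positivity)
  have hN1 : 532 ≤ N ∧ N ≤ 1875 := by omega
  have hq : 4000 < q := by omega
  have hYq : 6 * Y ≤ Y ^ q := by
    exact six_mul_le_pow hyR (by omega)
  rw [← hpq] at hsmall
  set P : ℝ := (p : ℝ) with hP
  have hP0 : 8512 ≤ P := by rw [hP]; exact_mod_cast (by omega : 8512 ≤ p)
  have hpi := Real.pi_pos
  have hpi4 := Real.pi_lt_d2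
  set J : ℤ := round (P * θ / Real.pi) with hJ
  have happ := exists_int_abs_sub_le (P * θ)
  rw [← hJ] at happ
  have happ' : |P * θ - Real.pi * J| ≤ Real.pi / Y ^ q := by
    refine happ.trans ?_
    calc _ ≤ Real.pi / 2 * (2 / Y ^ q) := by gcongr
      _ = _ := by ring
  have happ1 : |P * θ - Real.pi * J| < Real.pi / 2 := by
    refine happ'.trans_lt ?_
    apply div_lt_div_of_pos_left hpi (by norm_num); linarith
  have hJ2 : 2 * |J| ≤ p := by
    by_contra! h
    have h1 : (q : ℤ) + 1 ≤ |J| := by omega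
    have h2 : (q : ℝ) + 1 ≤ |(J : ℝ)| := by exact_mod_cast h1
    have h3 : Real.pi * |(J : ℝ)| ≤ |P * θ| + |P * θ - Real.pi * J| := by
      have := abs_sub_abs_le_abs_sub (Real.pi * (J : ℝ)) (P * θ)
      rw [abs_mul, abs_of_pos hpi, abs_sub_comm] at this
      linarith
    rw [abs_mul, abs_of_pos (by linarith : 0 < P)] at h3
    have : P = 2 * q + 1 := by rw [hP, hpq]; push_cast; ring
    have h4 : P * |θ| ≤ P * (Real.pi / 2) := by gcongr
    nlinarith
  have hJ0 : J ≠ 0 := by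
    intro h
    rw [h] at happ'
    simp only [Int.cast_zero, mul_zero, sub_zero] at happ'
    have hs1 := abs_sin_mul_norm_pow hA hθ 1
    simp only [pow_one, Nat.cast_one, one_mul] at hs1
    have h1 : (1 : ℝ) ≤ |(A.re : ℝ)| := by exact_mod_cast Int.one_le_abs ha
    have h2 : (1 : ℝ) ≤ |(A.im : ℝ)| := by exact_mod_cast Int.one_le_abs hb
    rw [abs_mul, abs_of_pos (by linarith : 0 < √(11 : ℝ))] at hs1
    have h3 : 6 ≤ |Real.sin θ| * Y := by
      rw [hs1]
      have : 1 ≤ |(A.re : ℝ)| * |(A.im : ℝ)| := by nlinarith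
      nlinarith
    have h4 : |Real.sin θ| ≤ |θ| := Real.abs_sin_le_abs
    rw [abs_mul, abs_of_pos (by linarith : 0 < P), le_div_iff₀ (by positivity)] at happ'
    have h5 : 6 ≤ |θ| * Y := h3.trans (by gcongr)
    nlinarith [abs_nonneg θ, mul_le_mul_of_nonneg_left hYq (abs_nonneg θ)]
  -- parameters
  obtain ⟨t, ht⟩ : ∃ t, t = Nat.sqrt (4 * p / N) := ⟨_, rfl⟩
  have ht1 : 8 ≤ t := by
    rw [ht, Nat.le_sqrt, Nat.le_div_iff_mul_le (by omega)]; omega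
  have ht2 : N * t ^ 2 ≤ 4 * p := by
    have := Nat.sqrt_le' (4 * p / N)
    rw [← ht, Nat.le_div_iff_mul_le (by omega)] at this
    linarith
  have ht3 : 4 * p ≤ N * (t + 1) ^ 2 := by
    have := Nat.lt_succ_sqrt' (4 * p / N)
    rw [← ht, Nat.succ_eq_add_one, Nat.div_lt_iff_lt_mul (by omega)] at this
    linarith
  have ht532 : 532 * t ^ 2 ≤ 4 * p := (Nat.mul_le_mul_right _ hN1.1).trans ht2
  have htp : 20 * t < p := by nlinarith
  set L := Real.log Y with hL
  have l2 := Real.log_two_gt_d9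
  have l2' := Real.log_two_lt_d9
  have hL1 : 2.7 ≤ L := by
    have h1 : Real.log 15 ≤ L := Real.log_le_log (by norm_num) hyR
    have h2 : Real.log (2 ^ 39) ≤ Real.log (15 ^ 10) := Real.log_le_log (by norm_num) (by norm_num)
    rw [Real.log_pow, Real.log_pow] at h2
    norm_num at h2
    linarith
  have hν0 : 1 / 2 ≤ ν := by rcases hN with ⟨-, rfl⟩ | ⟨-, rfl⟩ <;> norm_num
  have hcν : 0 < c - ν := by
    by_contra! h
    nlinarith
  set m := ⌈ν * L⌉₊ with hm
  have hm1 : ν * L ≤ m := Nat.le_ceil _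
  have hm2 : (m : ℝ) < ν * L + 1 := Nat.ceil_lt_add_one (by positivity)
  have hm5 : 5 ≤ m := by
    have : (4 : ℝ) < m := by
      rcases hN with ⟨rfl, rfl⟩ | ⟨rfl, rfl⟩
      · linarith
      · have : c - 1 / 2 ≤ 0.064 := by norm_num at hc; linarith
        nlinarith
    have : 4 < m := by exact_mod_cast this
    omega
  have hT : (2 * t + 1) * m ≥ 85 := by nlinarith
  have hineq := interpolation_inequality toComplexEleven.range one_le_norm_toComplexEleven_range
    (α := toComplexEleven A) (β := toComplexEleven (star A)) ⟨A, rfl⟩ ⟨_, rfl⟩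
    (by
      rw [toComplexEleven_star, mul_conj, normSq_toComplexEleven, norm_real, Real.norm_eq_abs]
      exact le_trans (by linarith) (le_abs_self _))
    hθ hp.pos hJ2 (k := 40 * t * m) (t := t) (R := 10 * t) (S := (2 * t + 1) * m) (by nlinarith)
    (by
      have key : ∀ v w : Fin (2 * t + 1), v < w →
          exp (θ * I) ^ ((v : ℤ) - t) ≠ exp (θ * I) ^ ((w : ℤ) - t) := by
        intro v w hvw h
        apply injective_pow_of_isCoprime hcop (by omega) hA hθ (m := (w : ℕ) - v) (by omega)
        have hne : exp (θ * I) ≠ 0 := exp_ne_zero _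
        rw [← zpow_natCast, Nat.cast_sub (by omega),
          show ((w : ℕ) : ℤ) - (v : ℕ) = ((w : ℤ) - t) - ((v : ℤ) - t) by ring, zpow_sub₀ hne, h,
          div_self (zpow_ne_zero _ hne)]
      intro v w h
      rcases lt_trichotomy v w with h1 | h1 | h1
      · exact absurd h (key v w h1)
      · exact h1
      · exact absurd h.symm (key w v h1))
    (by
      intro r s r' s' hr _ hr' _ h
      have hd : (p : ℤ) ∣ (r - r') * J := ⟨s' - s, by linarith⟩
      have hnJ : ¬ (p : ℤ) ∣ J := by
        intro hd
        have := Int.le_of_dvd (abs_pos.2 hJ0) ((dvd_abs _ _).2 hd)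
        have := abs_pos.2 hJ0
        omega
      have hpp : Prime (p : ℤ) := Nat.prime_iff_prime_int.1 hp
      have hrr := (hpp.dvd_or_dvd hd).resolve_right hnJ
      have hz : r - r' = 0 := by
        apply Int.eq_zero_of_abs_lt_dvd hrr
        have := abs_sub r r'
        push_cast at hr hr'
        omega
      have hr0 : r = r' := by omega
      refine ⟨hr0, ?_⟩
      rw [hr0] at h
      have : s * (p : ℤ) = s' * p := by linarith
      exact mul_right_cancel₀ hpp.ne_zero this)
    (by
      have : 40 * t * m - 1 ≤ 40 * t * m := Nat.sub_le _ _
      calc _ ≤ (2 * t + 1) * (40 * t * m) := by gcongr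
        _ < _ := by nlinarith)
    (by nlinarith) (ρ := 4) (by norm_num)
    (by
      have hY4 : (4 : ℝ) ^ (40 * t * m * (2 * t + 1)) ≤ Y ^ q := by
        rw [← Real.log_le_log_iff (by positivity) (by positivity), Real.log_pow, Real.log_pow,
          show (4 : ℝ) = 2 ^ 2 by norm_num, Real.log_pow]
        push_cast
        refine four_pow_exponent_mul_log_le (N := N) (c := c) (by exact_mod_cast ht1)
          (by linarith) (Nat.cast_nonneg m) (by linarith) (by linarith) l2' hc ?_
        exact_mod_cast hpq ▸ ht2
      have htR2 : 532 * (t : ℝ) ^ 2 ≤ 4 * P := by rw [hP]; exact_mod_cast ht532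
      have h1 : ((10 * t + t : ℕ) : ℝ) * t * Real.pi / P ≤ 1 := by
        rw [div_le_one (by linarith)]
        push_cast
        nlinarith [sq_nonneg (t : ℝ)]
      calc _ ≤ ((10 * t + t : ℕ) : ℝ) * t * (Real.pi / Y ^ q) / P := by gcongr
        _ = (((10 * t + t : ℕ) : ℝ) * t * Real.pi / P) * (Y ^ q)⁻¹ := by ring
        _ ≤ 1 * (4 ^ (40 * t * m * (2 * t + 1)))⁻¹ := by gcongr
        _ = _ := one_mul _)
  have hno := interpolation_parameters_contradiction ht1 hm5 hN hm1 (by linarith) ht3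
  have hnorm : ‖toComplexEleven A * toComplexEleven (star A)‖ = Y := by
    rw [toComplexEleven_star, mul_conj, normSq_toComplexEleven, norm_real, Real.norm_eq_abs,
      abs_of_pos hY0]
  rw [hnorm] at hineq
  linarith

theorem prime_lt_of_abs_pow_im_eq {A : ℤ√(-11)} (ha : A.re ≠ 0) (hb : A.im ≠ 0)
    (hcop : IsCoprime (2 * A.re * A.im) A.norm) (hy : 15 ≤ A.norm) {p : ℕ} (hp : p.Prime)
    (hp2 : p ≠ 2) (him : |(A ^ p).im| = |A.im|) : p < 30000 := by
  refine prime_lt_of_abs_pow_im_eq_aux ha hb hcop hy hp hp2 him (N := 1875) (ν := 3 / 2)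
    (c := 1.88) (Or.inl ⟨rfl, rfl⟩) (by norm_num) ?_
  have h1 : Real.log 15 ≤ Real.log A.norm :=
    Real.log_le_log (by norm_num) (by exact_mod_cast hy)
  have h2 : Real.log (2 ^ 39) ≤ Real.log (15 ^ 10) := Real.log_le_log (by norm_num) (by norm_num)
  rw [Real.log_pow, Real.log_pow] at h2
  have := Real.log_two_gt_d9
  norm_num at h2 ⊢
  linarith

theorem prime_lt_of_abs_pow_im_eq_of_le_norm {A : ℤ√(-11)} (ha : A.re ≠ 0) (hb : A.im ≠ 0)
    (hcop : IsCoprime (2 * A.re * A.im) A.norm) (hy : 2 ^ 24 ≤ A.norm) {p : ℕ} (hp : p.Prime)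
    (hp2 : p ≠ 2) (him : |(A ^ p).im| = |A.im|) : p < 8512 := by
  refine prime_lt_of_abs_pow_im_eq_aux ha hb hcop (le_trans (by norm_num) hy) hp hp2 him
    (N := 532) (ν := 1 / 2) (c := 0.5625) (Or.inr ⟨rfl, rfl⟩) (by norm_num) ?_
  have h1 : Real.log (2 ^ 24) ≤ Real.log A.norm :=
    Real.log_le_log (by norm_num) (by exact_mod_cast hy)
  rw [Real.log_pow] at h1
  have := Real.log_two_gt_d9
  norm_num at h1 ⊢
  linarith

end

section

open NumberField IsCyclotomicExtension.Rat

lemma intCast_dvd_intCast_ringOfIntegers (K : Type*) [Field K] [NumberField K] {m n : ℤ} : (m : 𝓞 K) ∣ n ↔ m ∣ n := by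
  refine ⟨fun h => ?_, fun h => by exact_mod_cast (map_dvd (Int.castRingHom (𝓞 K)) h)⟩
  by_cases hm : m = 0
  · subst hm
    rw [Int.cast_zero, zero_dvd_iff] at h
    rw [zero_dvd_iff]; exact_mod_cast h
  obtain ⟨c, hc⟩ := h
  have hmQ : (m : ℚ) ≠ 0 := by exact_mod_cast hm
  have hmK : (m : K) ≠ 0 := by exact_mod_cast hm
  have hcK : algebraMap (𝓞 K) K c = algebraMap ℚ K (n / m) := by
    have : (n : K) = m * algebraMap (𝓞 K) K c := by
      have := congrArg (algebraMap (𝓞 K) K) hc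
      rwa [map_mul, map_intCast, map_intCast] at this
    rw [map_div₀, map_intCast, map_intCast, this, mul_div_cancel_left₀ _ hmK]
  have hint : IsIntegral ℤ ((n : ℚ) / m) := by
    have : IsIntegral ℤ (algebraMap (𝓞 K) K c) := RingOfIntegers.isIntegral_coe c
    rw [hcK] at this
    exact (isIntegral_algebraMap_iff (algebraMap ℚ K).injective).1 this
  obtain ⟨d, hd⟩ := IsIntegrallyClosed.isIntegral_iff.1 hint
  refine ⟨d, ?_⟩
  have : (n : ℚ) = m * d := by
    rw [show (d : ℚ) = n / m by simpa using hd]; field_simp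
  exact_mod_cast this

section
variable {p : ℕ} [hp : Fact p.Prime] {K : Type*} [Field K] [NumberField K]
  [IsCyclotomicExtension {p} ℚ K] {z : K} (hz : IsPrimitiveRoot z p)

include hz in
lemma ringHom_ext_of_toInteger {R : Type*} [CommRing R] {f g : 𝓞 K →+* R}
    (h : f hz.toInteger = g hz.toInteger) : f = g := by
  let b := hz.integralPowerBasis
  let f' : 𝓞 K →ₐ[ℤ] R := f.toIntAlgHom
  let g' : 𝓞 K →ₐ[ℤ] R := g.toIntAlgHom
  have : f' = g' := b.algHom_ext (by simpa [b, f', g'] using h)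
  ext x
  exact DFunLike.congr_fun this x

include hz in
lemma exists_gal_smul_toInteger (n : ℕ) (hn : ¬ p ∣ n) :
    ∃ σ : Gal(K/ℚ), σ • hz.toInteger = hz.toInteger ^ n := by
  have hc : n.Coprime p := ((Nat.Prime.coprime_iff_not_dvd hp.out).2 hn).symm
  refine ⟨(galEquivZMod p K).symm (ZMod.unitOfCoprime n hc), ?_⟩
  have h1 : hz.toInteger ^ p = 1 := hz.toInteger_isPrimitiveRoot.pow_eq_one
  rw [galEquivZMod_smul_of_pow_eq p K _ h1]
  simp only [MulEquiv.apply_symm_apply, ZMod.coe_unitOfCoprime, ZMod.val_natCast]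
  rw [← pow_mod_orderOf hz.toInteger n, ← hz.toInteger_isPrimitiveRoot.eq_orderOf]

include hz in
lemma exists_smul_toInteger_eq_pow (σ : Gal(K/ℚ)) : ∃ n : ℕ, ¬ p ∣ n ∧ σ • hz.toInteger = hz.toInteger ^ n := by
  have h1 : hz.toInteger ^ p = 1 := hz.toInteger_isPrimitiveRoot.pow_eq_one
  refine ⟨_, ?_, galEquivZMod_smul_of_pow_eq p K σ h1⟩
  have := ZMod.val_coe_unit_coprime (galEquivZMod p K σ)
  exact (Nat.Prime.coprime_iff_not_dvd hp.out).1 this.symm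

include hz in
lemma prime_toInteger_sub_one : Prime (hz.toInteger - 1) := hz.zeta_sub_one_prime'

include hz in
lemma toInteger_sub_one_dvd_intCast_iff {n : ℤ} : hz.toInteger - 1 ∣ (n : 𝓞 K) ↔ (p : ℤ) ∣ n := by
  constructor
  · intro h
    by_contra hn
    have hc : IsCoprime (p : ℤ) n :=
      ((Nat.prime_iff_prime_int.1 hp.out).irreducible.coprime_iff_not_dvd).2 hn
    obtain ⟨u, v, huv⟩ := hc
    have h1 : hz.toInteger - 1 ∣ (1 : 𝓞 K) := by
      have e : (1 : 𝓞 K) = (u : 𝓞 K) * (p : 𝓞 K) + v * n := by exact_mod_cast huv.symm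
      have h2 : hz.toInteger - 1 ∣ (u : 𝓞 K) * (p : 𝓞 K) + v * n :=
        (hz.toInteger_sub_one_dvd_prime'.mul_left _).add (h.mul_left _)
      rwa [← e] at h2
    exact (prime_toInteger_sub_one hz).not_isUnit (isUnit_of_dvd_one h1)
  · rintro ⟨m, rfl⟩
    push_cast
    exact hz.toInteger_sub_one_dvd_prime'.mul_right _

include hz in
lemma exists_int_toInteger_sub_one_dvd_sub (x : 𝓞 K) : ∃ n : ℤ, hz.toInteger - 1 ∣ x - n := by
  let b := hz.integralPowerBasis
  obtain ⟨f, hf⟩ := b.exists_eq_aeval' x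
  refine ⟨f.eval 1, ?_⟩
  have hb : b.gen = hz.toInteger := hz.integralPowerBasis_gen
  rw [hf, hb]
  have := Polynomial.sub_dvd_eval_sub hz.toInteger 1 (f.map (algebraMap ℤ (𝓞 K)))
  rw [Polynomial.eval_map_algebraMap, Polynomial.eval_map_algebraMap] at this
  convert this using 2
  rw [Polynomial.aeval_def, Polynomial.eval₂_at_one]; simp

include hz in
lemma toInteger_sub_one_dvd_smul_sub (σ : Gal(K/ℚ)) (x : 𝓞 K) :
    hz.toInteger - 1 ∣ σ • x - x := by
  obtain ⟨n, hn⟩ := exists_int_toInteger_sub_one_dvd_sub hz x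
  obtain ⟨m, -, hm⟩ := exists_smul_toInteger_eq_pow hz σ
  have h1 : hz.toInteger - 1 ∣ σ • (x - n) := by
    obtain ⟨c, hc⟩ := hn
    rw [hc, smul_mul', smul_sub, hm, smul_one]
    exact (sub_one_dvd_pow_sub_one _ _).mul_right _
  have hn' : σ • ((n : ℤ) : 𝓞 K) = n := map_intCast (MulSemiringAction.toRingHom Gal(K/ℚ) (𝓞 K) σ) n
  rw [smul_sub, hn'] at h1
  have := h1.sub hn
  rwa [sub_sub_sub_cancel_right] at this

variable (p K) in
include hp in
lemma isCyclic_gal : IsCyclic Gal(K/ℚ) := by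
  exact (galEquivZMod p K).isCyclic.2 inferInstance

include hz in
lemma dvd_smul_sub_pow (l : ℕ) [hl : Fact l.Prime] (σ : Gal(K/ℚ)) (j : ℕ)
    (hσ : σ • hz.toInteger = hz.toInteger ^ (l ^ j)) (x : 𝓞 K) :
    (l : 𝓞 K) ∣ σ • x - x ^ (l ^ j) := by
  have hlK : ¬ IsUnit (l : 𝓞 K) := by
    intro h
    have h1 := (intCast_dvd_intCast_ringOfIntegers K (m := l) (n := 1)).1
      (by exact_mod_cast h.dvd)
    have := Int.isUnit_iff.1 (isUnit_of_dvd_one h1)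
    have := hl.out.one_lt
    omega
  let I : Ideal (𝓞 K) := Ideal.span {(l : 𝓞 K)}
  have : Nontrivial (𝓞 K ⧸ I) := Ideal.Quotient.nontrivial_iff.2 (by
    rwa [Ne, Ideal.span_singleton_eq_top])
  have : CharP (𝓞 K ⧸ I) l := by
    have hl0 : ((l : ℕ) : 𝓞 K ⧸ I) = 0 := by
      rw [← map_natCast (Ideal.Quotient.mk I), Ideal.Quotient.eq_zero_iff_mem]
      exact Ideal.mem_span_singleton_self _
    exact (CharP.charP_iff_prime_eq_zero hl.out).2 hl0
  have : ExpChar (𝓞 K ⧸ I) l := ExpChar.prime hl.out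
  have heq : (Ideal.Quotient.mk I).comp (MulSemiringAction.toRingHom Gal(K/ℚ) (𝓞 K) σ) =
      (iterateFrobenius (𝓞 K ⧸ I) l j).comp (Ideal.Quotient.mk I) := by
    apply ringHom_ext_of_toInteger hz
    simp [hσ, iterateFrobenius_def]
  have h := DFunLike.congr_fun heq x
  simp only [RingHom.comp_apply, MulSemiringAction.toRingHom_apply, iterateFrobenius_def,
    ← map_pow] at h
  rw [Ideal.Quotient.eq, Ideal.mem_span_singleton] at h
  exact h

include hz in
lemma prod_smul_sub_one_dvd {x : 𝓞 K} (hx : ¬ hz.toInteger - 1 ∣ x) :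
    hz.toInteger - 1 ∣ ∏ σ : Gal(K/ℚ), σ • x - 1 := by
  obtain ⟨n, hn⟩ := exists_int_toInteger_sub_one_dvd_sub hz x
  have h1 : hz.toInteger - 1 ∣ ∏ σ : Gal(K/ℚ), σ • x - ∏ σ : Gal(K/ℚ), (n : 𝓞 K) := by
    rw [← Ideal.mem_span_singleton, ← Ideal.Quotient.eq, map_prod, map_prod]
    refine Finset.prod_congr rfl fun σ _ => ?_
    rw [Ideal.Quotient.eq, Ideal.mem_span_singleton]
    have := (toInteger_sub_one_dvd_smul_sub hz σ x).add hn
    rwa [sub_add_sub_cancel] at this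
  have hcard : Fintype.card Gal(K/ℚ) = p - 1 := by
    rw [← Nat.card_eq_fintype_card, Nat.card_congr (galEquivZMod p K).toEquiv,
      Nat.card_eq_fintype_card, ZMod.card_units]
  rw [Finset.prod_const, Finset.card_univ, hcard] at h1
  have hpn : ¬ (p : ℤ) ∣ n := by
    intro h
    rw [← toInteger_sub_one_dvd_intCast_iff hz] at h
    exact hx ((dvd_sub_left h).1 hn)
  have h2 : hz.toInteger - 1 ∣ (n : 𝓞 K) ^ (p - 1) - 1 := by
    have : (p : ℤ) ∣ n ^ (p - 1) - 1 := by
      have := Int.ModEq.pow_card_sub_one_eq_one hp.out (n := n)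
        (((Nat.prime_iff_prime_int.1 hp.out).irreducible.coprime_iff_not_dvd).2 hpn).symm
      exact this.symm.dvd
    rw [← toInteger_sub_one_dvd_intCast_iff hz] at this
    exact_mod_cast this
  have := h1.add h2
  rwa [sub_add_sub_cancel] at this

omit [IsCyclotomicExtension {p} ℚ K] in
include hz in
lemma exists_sq_eq_neg_one_pow_mul (hp2 : p ≠ 2) : ∃ g : 𝓞 K, g ^ 2 = p ∨ g ^ 2 = -p := by
  have hζ := hz.toInteger_isPrimitiveRoot
  have hchar : ringChar (ZMod p) ≠ 2 := by rwa [ZMod.ringChar_zmod_n]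
  let χ := (quadraticChar (ZMod p)).ringHomComp (Int.castRingHom (𝓞 K))
  have hχ2 : χ.IsQuadratic := (quadraticChar_isQuadratic (ZMod p)).comp _
  have hχ1 : χ ≠ 1 := by
    exact (MulChar.ringHomComp_ne_one_iff (RingHom.injective_int _)).2 (quadraticChar_ne_one hchar)
  let ψ := AddChar.zmodChar p (ζ := hz.toInteger) hζ.pow_eq_one
  have hψ : ψ.IsPrimitive := AddChar.zmodChar_primitive_of_primitive_root p hζ
  have := gaussSum_sq hχ1 hχ2 hψ
  refine ⟨gaussSum χ ψ, ?_⟩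
  rw [this, ZMod.card]
  have h1 := hχ2 (-1)
  rcases h1 with h | h | h
  · have : IsUnit (χ (-1)) := (isUnit_one.neg : IsUnit (-1 : ZMod p)).map χ
    exact absurd h this.ne_zero
  · left; rw [h, one_mul]
  · right; rw [h, neg_one_mul]

end

end

section

open NumberField IsCyclotomicExtension.Rat

section
variable {p : ℕ} [hp : Fact p.Prime] {K : Type} [Field K] [NumberField K]
  [IsCyclotomicExtension {p} ℚ K] {z : K} (hz : IsPrimitiveRoot z p)

include hz in
lemma natCast_dvd_of_dvd_pow (l : ℕ) [hl : Fact l.Prime] (hlp : l ≠ p) {x : 𝓞 K} {n : ℕ}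
    (h : (l : 𝓞 K) ∣ x ^ n) : (l : 𝓞 K) ∣ x := by
  have hpl : ¬ l ∣ p := fun h => hlp ((Nat.prime_dvd_prime_iff_eq hl.out hp.out).1 h)
  have hc : l.Coprime p := (Nat.Prime.coprime_iff_not_dvd hl.out).2 hpl
  let j := n * (p - 1)
  have hmod : l ^ j % p = 1 % p := by
    have h1 : l ^ (p - 1) ≡ 1 [MOD p] := by
      rw [← Nat.totient_prime hp.out]; exact Nat.ModEq.pow_totient hc
    have := h1.pow n
    rw [one_pow, ← pow_mul, mul_comm] at this
    exact this
  have hζ : (1 : Gal(K/ℚ)) • hz.toInteger = hz.toInteger ^ (l ^ j) := by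
    rw [one_smul, ← pow_mod_orderOf, ← hz.toInteger_isPrimitiveRoot.eq_orderOf, hmod,
      Nat.mod_eq_of_lt hp.out.one_lt, pow_one]
  have h2 := dvd_smul_sub_pow hz l 1 j hζ x
  rw [one_smul] at h2
  have hnj : n ≤ l ^ j := by
    refine le_trans ?_ (Nat.lt_pow_self hl.out.one_lt).le
    exact Nat.le_mul_of_pos_right _ (Nat.sub_pos_of_lt hp.out.one_lt)
  have h3 := h2.add (h.trans (pow_dvd_pow x hnj))
  rwa [sub_add_cancel] at h3

lemma exists_intCast_of_forall_smul_eq {σ : Gal(K/ℚ)} (hσ : ∀ g, g ∈ Subgroup.zpowers σ)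
    [IsGalois ℚ K] {x : K} (hx : σ x = x) : ∃ q : ℚ, x = algebraMap ℚ K q := by
  have hall : ∀ g : Gal(K/ℚ), g x = x := by
    intro g
    have hs : σ ∈ MulAction.stabilizer Gal(K/ℚ) x := hx
    have : Subgroup.zpowers σ ≤ MulAction.stabilizer Gal(K/ℚ) x := by
      rwa [Subgroup.zpowers_le]
    exact this (hσ g)
  obtain ⟨q, hq⟩ := (IsGalois.mem_range_algebraMap_iff_fixed x).2 hall
  exact ⟨q, hq.symm⟩

/-- Non-divisible by the prime above `p`, a square as an ideal, and an odd square modulo `4`. -/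
def AlmostSquare (π x : 𝓞 K) : Prop :=
  ¬ π ∣ x ∧ (∃ A : Ideal (𝓞 K), Ideal.span {x} = A ^ 2) ∧
    ∃ w : 𝓞 K, IsCoprime w 2 ∧ 4 ∣ x - w ^ 2

include hz in
lemma AlmostSquare.mul_smul {x : 𝓞 K} (hx : AlmostSquare (hz.toInteger - 1) x)
    (σ : Gal(K/ℚ)) : AlmostSquare (hz.toInteger - 1) (x * σ • x) := by
  obtain ⟨h1, ⟨A, hA⟩, w, hw, h4⟩ := hx
  let f := MulSemiringAction.toRingHom Gal(K/ℚ) (𝓞 K) σ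
  refine ⟨fun h => ?_, ⟨A * A.map f, ?_⟩, w * σ • w, ?_, ?_⟩
  · rcases (prime_toInteger_sub_one hz).dvd_or_dvd h with h | h
    · exact h1 h
    · exact h1 ((dvd_sub_right h).1 (toInteger_sub_one_dvd_smul_sub hz σ x))
  · rw [mul_pow, ← Ideal.map_pow, ← hA, Ideal.map_span, Set.image_singleton,
      Ideal.span_singleton_mul_span_singleton]
    rfl
  · refine hw.mul_left ?_
    have := hw.map f
    rwa [map_ofNat] at this
  · have h5 : 4 ∣ σ • x - (σ • w) ^ 2 := by
      have := map_dvd f h4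
      rwa [map_ofNat, map_sub, map_pow] at this
    obtain ⟨c, hc⟩ := h4
    obtain ⟨d, hd⟩ := h5
    refine ⟨c * σ • x + w ^ 2 * d, ?_⟩
    linear_combination (σ • x) * hc + w ^ 2 * hd

include hz in
lemma prod_smul_eq_of_sq_eq (hp2 : p ≠ 2) {x w : 𝓞 K} {σ : Gal(K/ℚ)}
    (hx : ¬ hz.toInteger - 1 ∣ x) (hw : x * σ • x = w ^ 2) :
    ∏ g : Gal(K/ℚ), g • w = ∏ g : Gal(K/ℚ), g • x := by
  have hsx : ¬ hz.toInteger - 1 ∣ σ • x := fun h =>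
    hx ((dvd_sub_right h).1 (toInteger_sub_one_dvd_smul_sub hz σ x))
  have hP := prime_toInteger_sub_one hz
  have hww : ¬ hz.toInteger - 1 ∣ w := fun h => by
    have : hz.toInteger - 1 ∣ x * σ • x := by rw [hw]; exact dvd_pow h two_ne_zero
    exact (hP.dvd_or_dvd this).elim hx hsx
  have h1 := prod_smul_sub_one_dvd hz hx
  have h2 := prod_smul_sub_one_dvd hz hww
  have hs : ∏ g : Gal(K/ℚ), g • (σ • x) = ∏ g : Gal(K/ℚ), g • x := by
    simp_rw [← mul_smul]
    exact Fintype.prod_equiv (Equiv.mulRight σ) _ _ (fun g => rfl)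
  have h3 : (∏ g : Gal(K/ℚ), g • w) ^ 2 = (∏ g : Gal(K/ℚ), g • x) ^ 2 := by
    rw [← Finset.prod_pow]
    simp_rw [← smul_pow', ← hw, smul_mul', Finset.prod_mul_distrib]
    rw [hs, sq]
  rcases sq_eq_sq_iff_eq_or_eq_neg.1 h3 with h | h
  · exact h
  · exfalso
    rw [h] at h2
    have h4 : hz.toInteger - 1 ∣ ((-2 : ℤ) : 𝓞 K) := by
      have := h1.add h2
      convert this using 1
      push_cast; ring
    rw [toInteger_sub_one_dvd_intCast_iff hz, dvd_neg] at h4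
    have h5 : p ∣ 2 := by exact_mod_cast h4
    exact hp2 ((Nat.prime_dvd_prime_iff_eq hp.out Nat.prime_two).1 h5)

include hz in
lemma exists_mul_sq_eq_intCast (hp2 : p ≠ 2) {x w : 𝓞 K} {σ : Gal(K/ℚ)}
    (hσ : ∀ g, g ∈ Subgroup.zpowers σ)
    (hx : ¬ hz.toInteger - 1 ∣ x) (hw : x * σ • x = w ^ 2) :
    ∃ (v : 𝓞 K) (m : ℤ), v ≠ 0 ∧ x * v ^ 2 = m := by
  have : IsGalois ℚ K := IsCyclotomicExtension.isGalois {p} ℚ K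
  have hx0 : x ≠ 0 := by rintro rfl; exact hx (dvd_zero _)
  have hxK : (x : K) ≠ 0 := by exact_mod_cast hx0
  have hsmul : ∀ (g : Gal(K/ℚ)) (y : 𝓞 K), ((g • y : 𝓞 K) : K) = g (y : K) := fun _ _ => rfl
  have hnorm : ∀ y : 𝓞 K, algebraMap ℚ K (Algebra.norm ℚ (y : K)) =
      ((∏ g : Gal(K/ℚ), g • y : 𝓞 K) : K) := by
    intro y
    rw [Algebra.norm_eq_prod_automorphisms]
    exact (map_prod (algebraMap (𝓞 K) K) (fun g : Gal(K/ℚ) => g • y) Finset.univ).symm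
  have hn : Algebra.norm ℚ ((w : K) / x) = 1 := by
    have h1 : Algebra.norm ℚ (w : K) = Algebra.norm ℚ (x : K) := by
      apply (algebraMap ℚ K).injective
      rw [hnorm, hnorm, prod_smul_eq_of_sq_eq hz hp2 hx hw]
    rw [div_eq_mul_inv, map_mul, Algebra.norm_inv, h1, mul_inv_cancel₀]
    rwa [Algebra.norm_ne_zero_iff]
  have : IsCyclic Gal(K/ℚ) := isCyclic_gal p K
  obtain ⟨v, hv⟩ := groupCohomology.exists_div_of_norm_eq_one hσ hn
  have hwK : (x : K) * σ (x : K) = (w : K) ^ 2 := by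
    have := congrArg (algebraMap (𝓞 K) K) hw
    simp only [map_mul, map_pow] at this
    exact this
  have hv0 : (v : K) ≠ 0 := v.ne_zero
  have hsv0 : σ (v : K) ≠ 0 := by simp [hv0]
  have hfix : σ ((x : K) * (v : K) ^ 2) = (x : K) * (v : K) ^ 2 := by
    rw [map_mul, map_pow]
    have e : (v : K) = w / x * σ v := by
      rw [← hv]; field_simp
    have hsx : σ (x : K) = (w : K) ^ 2 / x := by rw [← hwK]; field_simp
    rw [hsx]
    conv_rhs => rw [e]
    field_simp
  obtain ⟨q, hq⟩ := exists_intCast_of_forall_smul_eq hσ hfix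
  obtain ⟨v1, n, hn0, hvn⟩ : ∃ (v1 : 𝓞 K) (n : ℤ), n ≠ 0 ∧ algebraMap (𝓞 K) K v1 = v * n := by
    obtain ⟨⟨a, ⟨n, hn⟩⟩, h⟩ := IsLocalization.surj (Algebra.algebraMapSubmonoid (𝓞 K) (nonZeroDivisors ℤ)) (v : K)
    obtain ⟨k, hk, rfl⟩ := hn
    refine ⟨a, k, nonZeroDivisors.ne_zero hk, ?_⟩
    simpa using h.symm
  have hval : algebraMap (𝓞 K) K (x * v1 ^ 2) = algebraMap ℚ K (q * n ^ 2) := by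
    rw [map_mul, map_pow, hvn, map_mul, ← hq]; simp; ring
  have hint : IsIntegral ℤ (q * (n : ℚ) ^ 2) := by
    have := RingOfIntegers.isIntegral_coe (x * v1 ^ 2)
    change IsIntegral ℤ (algebraMap (𝓞 K) K _) at this
    rw [hval] at this
    exact (isIntegral_algebraMap_iff (algebraMap ℚ K).injective).1 this
  obtain ⟨m, hm⟩ := IsIntegrallyClosed.isIntegral_iff.1 hint
  refine ⟨v1, m, ?_, ?_⟩
  · rintro rfl
    have : (v : K) * n = 0 := by rw [← hvn]; simp
    rcases mul_eq_zero.1 this with h | h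
    · exact hv0 h
    · exact hn0 (by exact_mod_cast h)
  · apply RingOfIntegers.coe_injective
    rw [hval, ← hm]; simp

include hz in
lemma natAbs_eq_of_span_sq {d e : ℤ} (hd : Squarefree d) (he : e ≠ 0) {x v : 𝓞 K}
    {A : Ideal (𝓞 K)} (hA : Ideal.span {x} = A ^ 2) (h : x * v ^ 2 = d * (e : 𝓞 K) ^ 2)
    {l : ℕ} (hl : l.Prime) (hld : (l : ℤ) ∣ d) : l = p := by
  by_contra hlp
  have := Fact.mk hl
  let C : Ideal (𝓞 K) := Ideal.span {(e : 𝓞 K)}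
  have hC : C ≠ 0 := by
    simp only [C, Ne, Ideal.zero_eq_bot, Ideal.span_singleton_eq_bot]
    exact_mod_cast he
  have h1 : (A * Ideal.span {v}) ^ 2 = Ideal.span {(d : 𝓞 K)} * C ^ 2 := by
    rw [mul_pow, ← hA, Ideal.span_singleton_pow, Ideal.span_singleton_pow,
      Ideal.span_singleton_mul_span_singleton, Ideal.span_singleton_mul_span_singleton, h]
  have h2 : C ∣ A * Ideal.span {v} := by
    rw [← UniqueFactorizationMonoid.pow_dvd_pow_iff_dvd two_ne_zero, h1]
    exact dvd_mul_left _ _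
  obtain ⟨D, hD⟩ := h2
  have h3 : D ^ 2 = Ideal.span {(d : 𝓞 K)} := by
    rw [hD, mul_pow, mul_comm] at h1
    exact mul_right_cancel₀ (pow_ne_zero 2 hC) h1
  have h4 : Ideal.span {(l : 𝓞 K)} ∣ D := by
    rw [Ideal.dvd_iff_le]
    intro t ht
    rw [Ideal.mem_span_singleton]
    apply natCast_dvd_of_dvd_pow hz l hlp (n := 2)
    have : t ^ 2 ∈ D ^ 2 := Ideal.pow_mem_pow ht 2
    rw [h3, Ideal.mem_span_singleton] at this
    refine dvd_trans ?_ this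
    rw [← Int.cast_natCast (R := 𝓞 K), intCast_dvd_intCast_ringOfIntegers]
    exact hld
  obtain ⟨E, hE⟩ := h4
  have h5 : Ideal.span {(((l : ℤ) ^ 2 : ℤ) : 𝓞 K)} ∣ Ideal.span {(d : 𝓞 K)} := by
    rw [← h3, hE, mul_pow, Ideal.span_singleton_pow]
    push_cast
    exact dvd_mul_right _ _
  rw [Ideal.dvd_span_singleton, Ideal.mem_span_singleton, intCast_dvd_intCast_ringOfIntegers, sq] at h5
  have := hd _ h5
  have := Int.isUnit_iff.1 this
  have := hl.one_lt
  omega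

include hz in
lemma AlmostSquare.isSquare_of_mul_smul (hp2 : p ≠ 2) {x w : 𝓞 K} {σ : Gal(K/ℚ)}
    (hσ : ∀ g, g ∈ Subgroup.zpowers σ)
    (hx : AlmostSquare (hz.toInteger - 1) x) (hw : x * σ • x = w ^ 2) : ∃ u, x = u ^ 2 := by
  obtain ⟨h1, ⟨A, hA⟩, w0, hw0, h4⟩ := hx
  obtain ⟨v, m, hv, hm⟩ := exists_mul_sq_eq_intCast hz hp2 hσ h1 hw
  have hx0 : x ≠ 0 := by rintro rfl; exact h1 (dvd_zero _)
  have hm0 : m ≠ 0 := by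
    rintro rfl
    rw [Int.cast_zero] at hm
    exact mul_ne_zero hx0 (pow_ne_zero 2 hv) hm
  obtain ⟨d, e, hde, hd⟩ : ∃ d e : ℤ, m = d * e ^ 2 ∧ Squarefree d := by
    obtain ⟨a, b, hab, ha⟩ := Nat.sq_mul_squarefree m.natAbs
    refine ⟨m.sign * a, b, ?_, ?_⟩
    · conv_lhs => rw [← Int.sign_mul_natAbs m, ← hab]
      push_cast; ring
    · rw [← Int.squarefree_natAbs, Int.natAbs_mul, Int.natAbs_sign_of_ne_zero hm0, one_mul]
      simpa using ha
  have he : e ≠ 0 := by rintro rfl; exact hm0 (by simp [hde])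
  have hm' : x * v ^ 2 = d * (e : 𝓞 K) ^ 2 := by rw [hm, hde]; push_cast; ring
  have hdp : d.natAbs ∣ p := by
    have hsq : Squarefree d.natAbs := Int.squarefree_natAbs.2 hd
    rw [← Nat.prod_primeFactors_of_squarefree hsq]
    have hsub : d.natAbs.primeFactors ⊆ {p} := by
      intro l hl
      rw [Finset.mem_singleton]
      have := Nat.dvd_of_mem_primeFactors hl
      exact natAbs_eq_of_span_sq hz hd he hA hm' (Nat.prime_of_mem_primeFactors hl)
        (Int.natCast_dvd.2 this)
    calc _ ∣ ∏ l ∈ {p}, l := Finset.prod_dvd_prod_of_subset _ _ _ hsub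
      _ = p := by simp
  obtain ⟨h, hh⟩ : ∃ h : 𝓞 K, (d : 𝓞 K) = h ^ 2 ∨ (d : 𝓞 K) = - h ^ 2 := by
    rcases (Nat.dvd_prime hp.out).1 hdp with hd1 | hd1
    · refine ⟨1, ?_⟩
      rcases Int.natAbs_eq_iff.1 hd1 with h | h <;> simp [h]
    · obtain ⟨g, hg⟩ := exists_sq_eq_neg_one_pow_mul hz hp2
      refine ⟨g, ?_⟩
      rcases Int.natAbs_eq_iff.1 hd1 with h | h <;> rcases hg with hg | hg <;> simp [h, hg]
  have hdiv : v ∣ h * e := by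
    rw [← IsIntegrallyClosed.pow_dvd_pow_iff two_ne_zero, mul_pow]
    rcases hh with hh | hh
    · rw [← hh, ← hm']; exact dvd_mul_left _ _
    · rw [← dvd_neg, ← neg_mul, ← hh, ← hm']; exact dvd_mul_left _ _
  obtain ⟨u, hu⟩ := hdiv
  have hv2 : v ^ 2 ≠ 0 := pow_ne_zero 2 hv
  rcases hh with hh | hh
  · refine ⟨u, mul_right_cancel₀ hv2 ?_⟩
    rw [hm', hh, ← mul_pow, hu]; ring
  · exfalso
    have hxu : x = - u ^ 2 := by
      apply mul_right_cancel₀ hv2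
      rw [hm', hh, neg_mul, ← mul_pow, hu]; ring
    have : Fact (Nat.Prime 2) := ⟨Nat.prime_two⟩
    obtain ⟨c, hc⟩ := h4
    rw [hxu] at hc
    have h20 : (2 : 𝓞 K) ≠ 0 := two_ne_zero
    have e1 : (2 : 𝓞 K) ∣ w0 + u := by
      have := natCast_dvd_of_dvd_pow hz 2 hp2.symm (x := w0 + u) (n := 2)
      push_cast at this
      refine this ⟨w0 * u - 2 * c, ?_⟩
      linear_combination -hc
    obtain ⟨f, hf⟩ := e1
    have e2 : (2 : 𝓞 K) ∣ w0 * u := by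
      refine ⟨f ^ 2 + c, ?_⟩
      apply mul_left_cancel₀ h20
      linear_combination (w0 + u + 2 * f) * hf + hc
    have e3 : (2 : 𝓞 K) ∣ u := hw0.symm.dvd_of_dvd_mul_left e2
    have e4 : (2 : 𝓞 K) ∣ w0 := (dvd_add_left e3).1 ⟨f, hf⟩
    have e5 : IsUnit (2 : 𝓞 K) := hw0.isUnit_of_dvd' e4 dvd_rfl
    have := (intCast_dvd_intCast_ringOfIntegers K (m := 2) (n := 1)).1 (by exact_mod_cast e5.dvd)
    omega

include hz in
lemma AlmostSquare.isSquare (hp2 : p ≠ 2) {x : 𝓞 K} {σ : Gal(K/ℚ)}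
    (hσ : ∀ g, g ∈ Subgroup.zpowers σ)
    (hx : AlmostSquare (hz.toInteger - 1) x) {r : ℕ} (hr : (σ ^ 2 ^ r) • x = x) :
    ∃ u, x = u ^ 2 := by
  let T : 𝓞 K → 𝓞 K := fun y => y * σ • y
  have hTmul : ∀ (n : ℕ) (a b : 𝓞 K), T^[n] (a * b) = T^[n] a * T^[n] b := by
    intro n
    induction n with
    | zero => intro a b; rfl
    | succ n ih =>
      intro a b
      rw [Function.iterate_succ_apply, Function.iterate_succ_apply, Function.iterate_succ_apply,
        ← ih]
      congr 1
      simp only [T, smul_mul']; ring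
  have hTs : ∀ (n : ℕ) (k : ℕ) (a : 𝓞 K), T^[n] (σ ^ k • a) = σ ^ k • T^[n] a := by
    intro n k
    induction n with
    | zero => intro a; rfl
    | succ n ih =>
      intro a
      rw [Function.iterate_succ_apply, Function.iterate_succ_apply, ← ih]
      congr 1
      simp only [T, smul_mul', ← SemigroupAction.mul_smul, ← pow_succ, ← pow_succ']
  have hT2 : ∀ (r : ℕ) (y : 𝓞 K), ∃ s, T^[2 ^ r] y = y * (σ ^ 2 ^ r) • y * s ^ 2 := by
    intro r
    induction r with
    | zero => intro y; exact ⟨1, by simp [T]⟩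
    | succ r ih =>
      intro y
      obtain ⟨s, hs⟩ := ih y
      refine ⟨(σ ^ 2 ^ r) • y * s * (σ ^ 2 ^ r) • s * T^[2 ^ r] s, ?_⟩
      rw [pow_succ 2 r, mul_two, Function.iterate_add_apply, hs, hTmul, hTmul, hTs, sq, hTmul, hs,
        smul_mul', smul_mul', ← SemigroupAction.mul_smul, ← pow_add, smul_pow']
      ring
  have hdesc : ∀ (n : ℕ) (y : 𝓞 K), AlmostSquare (hz.toInteger - 1) y →
      (∃ u, T^[n] y = u ^ 2) → ∃ u, y = u ^ 2 := by
    intro n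
    induction n with
    | zero => intro y _ h; exact h
    | succ n ih =>
      intro y hy h
      rw [Function.iterate_succ_apply] at h
      obtain ⟨w, hw⟩ := ih (T y) (hy.mul_smul hz σ) h
      exact hy.isSquare_of_mul_smul hz hp2 hσ hw
  obtain ⟨s, hs⟩ := hT2 r x
  exact hdesc (2 ^ r) x hx ⟨x * s, by rw [hs, hr]; ring⟩

end

end

section

open NumberField IsCyclotomicExtension.Rat

lemma IsPrimitiveRoot.prod_range_add_pow_mul {R : Type*} [CommRing R] [IsDomain R] {n : ℕ} {ζ : R}
    (hodd : Odd n) (h : IsPrimitiveRoot ζ n) (x y : R) :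
    ∏ j ∈ Finset.range n, (x + ζ ^ j * y) = x ^ n + y ^ n := by
  have hpos := hodd.pos
  rw [h.pow_add_pow_eq_prod_add_mul x y hodd]
  refine Finset.prod_bij (fun j _ => ζ ^ j) ?_ ?_ ?_ (fun _ _ => rfl)
  · intro j _
    rw [Polynomial.mem_nthRootsFinset hpos, ← pow_mul, mul_comm, pow_mul, h.pow_eq_one, one_pow]
  · intro i hi j hj hij
    exact h.pow_inj (Finset.mem_range.1 hi) (Finset.mem_range.1 hj) hij
  · intro μ hμ
    rw [Polynomial.mem_nthRootsFinset hpos] at hμ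
    have := NeZero.mk hpos.ne'
    obtain ⟨i, hi, hi'⟩ := h.eq_pow_of_pow_eq_one hμ
    exact ⟨i, Finset.mem_range.2 hi, hi'⟩

lemma GaussianInt.toComplex_pow_add_pow (a b : ℤ) (n : ℕ) :
    (b + a * Complex.I : ℂ) ^ n + (b - a * Complex.I : ℂ) ^ n = 2 * ((⟨b, a⟩ ^ n : GaussianInt).re : ℂ) := by
  have h1 : (b + a * Complex.I : ℂ) = GaussianInt.toComplex ⟨b, a⟩ := by
    rw [GaussianInt.toComplex_def]
  have h2 : (b - a * Complex.I : ℂ) = GaussianInt.toComplex (star ⟨b, a⟩) := by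
    rw [GaussianInt.toComplex_def]; simp; ring
  have h3 : ∀ w : GaussianInt, w.toComplex + (star w).toComplex = 2 * (w.re : ℂ) := by
    intro w
    rw [GaussianInt.toComplex_def, GaussianInt.toComplex_def]
    simp; ring
  rw [h1, h2, ← map_pow, ← map_pow, ← star_pow, h3]

section
variable {p : ℕ} [hp : Fact p.Prime] {K : Type*} [Field K] [NumberField K]
  [IsCyclotomicExtension {p} ℚ K] {z : K} (hz : IsPrimitiveRoot z p)

omit [IsCyclotomicExtension {p} ℚ K] in
include hz in
lemma isUnit_quadratic_of_re_pow_eq (hp2 : p ≠ 2) {a b : ℤ} (hb : b ≠ 0)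
    (hre : (⟨b, a⟩ ^ p : GaussianInt).re = b) :
    IsUnit ((a ^ 2 + b ^ 2) * hz.toInteger ^ 2 + 2 * (b ^ 2 - a ^ 2) * hz.toInteger +
      (a ^ 2 + b ^ 2)) := by
  have hodd : Odd p := hp.out.odd_of_ne_two hp2
  let ψ : K →+* ℂ := Classical.arbitrary (K →+* ℂ)
  let φ : 𝓞 K →+* ℂ := ψ.comp (algebraMap (𝓞 K) K)
  have hφ : Function.Injective φ := ψ.injective.comp RingOfIntegers.coe_injective
  let M : ℕ → 𝓞 K := fun j => (a ^ 2 + b ^ 2) * (hz.toInteger ^ j) ^ 2 +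
    2 * (b ^ 2 - a ^ 2) * hz.toInteger ^ j + (a ^ 2 + b ^ 2)
  have hroot : IsPrimitiveRoot (φ hz.toInteger) p :=
    hz.toInteger_isPrimitiveRoot.map_of_injective hφ
  have hprod : ∏ j ∈ Finset.range p, M j = 4 * b ^ 2 := by
    apply hφ
    rw [map_prod]
    have e : ∀ j ∈ Finset.range p, φ (M j) =
        ((b + a * Complex.I) + φ hz.toInteger ^ j * (b - a * Complex.I)) *
        ((b - a * Complex.I) + φ hz.toInteger ^ j * (b + a * Complex.I)) := by
      intro j _
      simp only [M, map_add, map_mul, map_pow, map_sub, map_intCast, map_ofNat]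
      linear_combination ((a : ℂ) ^ 2 * (φ hz.toInteger ^ j) ^ 2 + (a : ℂ) ^ 2 - 2 * (a : ℂ) ^ 2 * φ hz.toInteger ^ j) * Complex.I_sq
    rw [Finset.prod_congr rfl e, Finset.prod_mul_distrib,
      hroot.prod_range_add_pow_mul hodd, hroot.prod_range_add_pow_mul hodd,
      add_comm ((b - a * Complex.I : ℂ) ^ p), GaussianInt.toComplex_pow_add_pow, hre]
    simp only [map_mul, map_pow, map_intCast, map_ofNat]
    ring
  obtain ⟨q, hq⟩ : ∃ q, p = q + 2 := ⟨p - 2, by have := hp.out.two_le; omega⟩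
  rw [hq, Finset.prod_range_succ', Finset.prod_range_succ'] at hprod
  have hM0 : M 0 = 4 * b ^ 2 := by simp only [M]; ring
  have h0 : (4 * (b : 𝓞 K) ^ 2) ≠ 0 := by
    have : (b : 𝓞 K) ≠ 0 := by exact_mod_cast hb
    exact mul_ne_zero (OfNat.ofNat_ne_zero 4) (pow_ne_zero 2 this)
  rw [hM0] at hprod
  have h1 : _ * M 1 = 1 := mul_right_cancel₀ h0 (hprod.trans (one_mul _).symm)
  have h2 : IsUnit (M 1) := IsUnit.of_mul_eq_one_right _ h1
  simpa [M] using h2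

include hz in
lemma exists_mul_toInteger_add_one_eq (hp2 : p ≠ 2) :
    IsUnit (hz.toInteger + 1) ∧ ∃ τ : 𝓞 K, τ * (hz.toInteger + 1) = hz.toInteger - 1 := by
  have hu : IsUnit (hz.toInteger + 1) := by
    have h1 : IsUnit (hz.toInteger ^ 2 - 1) → IsUnit (hz.toInteger + 1) := fun h =>
      isUnit_of_dvd_unit ⟨hz.toInteger - 1, by ring⟩ h
    obtain ⟨m, hm⟩ := hp.out.odd_of_ne_two hp2
    have h2 : hz.toInteger ^ 2 - 1 ∣ hz.toInteger - 1 := by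
      have := sub_one_dvd_pow_sub_one (hz.toInteger ^ 2) (m + 1)
      rw [← pow_mul, show 2 * (m + 1) = p + 1 by omega, pow_succ hz.toInteger p,
        hz.toInteger_isPrimitiveRoot.pow_eq_one, one_mul] at this
      exact this
    have h3 : hz.toInteger - 1 ≠ 0 := (prime_toInteger_sub_one hz).ne_zero
    obtain ⟨c, hc⟩ := h2
    have : (hz.toInteger + 1) * c = 1 := by
      apply mul_left_cancel₀ h3
      linear_combination -hc
    exact IsUnit.of_mul_eq_one _ this
  refine ⟨hu, (hz.toInteger - 1) * ↑hu.unit⁻¹, ?_⟩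
  rw [mul_assoc, IsUnit.val_inv_mul, mul_one]

end

namespace QuadraticAlgebra

/-- The action of a ring homomorphism on coordinates. -/
def mapRingHom {R S : Type*} [CommRing R] [CommRing S] (f : R →+* S) :
    QuadraticAlgebra R (-1) 0 →+* QuadraticAlgebra S (-1) 0 where
  toFun w := ⟨f w.re, f w.im⟩
  map_one' := by ext <;> simp
  map_zero' := by ext <;> simp
  map_mul' w v := by ext <;> simp
  map_add' w v := by ext <;> simp

variable {R : Type*} [CommRing R] (a b : R) (y : ℕ → R) (n : ℕ)

/-- The product of `b + a y_m i` over `m < n`, where `i² = -1`. -/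
def linProd : QuadraticAlgebra R (-1) 0 := ∏ m ∈ Finset.range n, ⟨b, a * y m⟩

variable {a b y n}

lemma linProd_succ_re : (linProd a b y (n + 1)).re =
    (linProd a b y n).re * b - (linProd a b y n).im * (a * y n) := by
  rw [linProd, Finset.prod_range_succ, ← linProd]; simp; ring

lemma linProd_succ_im : (linProd a b y (n + 1)).im =
    (linProd a b y n).re * (a * y n) + (linProd a b y n).im * b := by
  rw [linProd, Finset.prod_range_succ, ← linProd]; simp

lemma dvd_linProd_im : a ∣ (linProd a b y n).im := by
  induction n with
  | zero => simp [linProd]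
  | succ n ih =>
    rw [linProd_succ_im]
    exact ((dvd_mul_right a _).mul_left _).add (ih.mul_right _)

lemma dvd_linProd_re_sub : a ∣ (linProd a b y n).re - b ^ n := by
  induction n with
  | zero => simp [linProd]
  | succ n ih =>
    rw [linProd_succ_re, pow_succ, sub_right_comm, ← sub_mul]
    exact (ih.mul_right _).sub ((dvd_mul_right a _).mul_left _)

lemma dvd_linProd_im_of_forall {q : R} (h : ∀ m, q ∣ y m) : q ∣ (linProd a b y n).im := by
  induction n with
  | zero => simp [linProd]
  | succ n ih =>
    rw [linProd_succ_im]
    exact (((h n).mul_left _).mul_left _).add (ih.mul_right _)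

lemma dvd_linProd_re_of_odd (hn : Odd n) : b ∣ (linProd a b y n).re := by
  have : ∀ n, b ∣ (if Even n then (linProd a b y n).im else (linProd a b y n).re) := by
    intro n
    induction n with
    | zero => simp [linProd]
    | succ n ih =>
      by_cases hn : Even n
      · rw [if_pos hn] at ih
        rw [if_neg (by simpa [Nat.even_add_one] using hn), linProd_succ_re]
        exact (dvd_mul_left _ _).sub (ih.mul_right _)
      · rw [if_neg hn] at ih
        rw [if_pos (by simpa [Nat.even_add_one] using hn), linProd_succ_im]
        exact (ih.mul_right _).add (dvd_mul_left _ _)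
  have := this n
  rwa [if_neg (Nat.not_even_iff_odd.2 hn)] at this

lemma linProd_re_sq_add_im_sq : (linProd a b y n).re ^ 2 + (linProd a b y n).im ^ 2 =
    ∏ m ∈ Finset.range n, (b ^ 2 + (a * y m) ^ 2) := by
  induction n with
  | zero => simp [linProd]
  | succ n ih => rw [linProd_succ_im, linProd_succ_re, Finset.prod_range_succ, ← ih]; ring

lemma linProd_shift (h : y n = y 0) : linProd a b (fun m => y (m + 1)) n = linProd a b y n := by
  cases n with
  | zero => rfl
  | succ n =>
    rw [linProd, linProd, Finset.prod_range_succ' (fun m => (⟨b, a * y m⟩ : QuadraticAlgebra R (-1) 0)),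
      Finset.prod_range_succ, h]

lemma mapRingHom_linProd {S : Type*} [CommRing S] (f : R →+* S) :
    mapRingHom f (linProd a b y n) = linProd (f a) (f b) (fun m => f (y m)) n := by
  rw [linProd, map_prod, linProd]
  refine Finset.prod_congr rfl fun m _ => ?_
  ext <;> simp [mapRingHom]

lemma star_linProd : star (linProd a b y n) = linProd a b (fun m => - y m) n := by
  rw [linProd, linProd, star_prod]
  refine Finset.prod_congr rfl fun m _ => ?_
  ext <;> simp

end QuadraticAlgebra

end

section

open NumberField IsCyclotomicExtension.Rat

section
variable {p : ℕ} [hp : Fact p.Prime] {K : Type} [Field K] [NumberField K]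
  [IsCyclotomicExtension {p} ℚ K] {z : K} (hz : IsPrimitiveRoot z p)

include hz in
lemma smul_eq_of_sq_eq (hp2 : p ≠ 2) {σ : Gal(K/ℚ)} {x y : 𝓞 K} (h : y = x ^ 2)
    (hy : σ • y = y) (hx : ¬ hz.toInteger - 1 ∣ x) : σ • x = x := by
  have h1 : (σ • x) ^ 2 = x ^ 2 := by rw [← smul_pow', ← h, hy]
  rcases sq_eq_sq_iff_eq_or_eq_neg.1 h1 with h2 | h2
  · exact h2
  · exfalso
    have h3 := toInteger_sub_one_dvd_smul_sub hz σ x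
    rw [h2, show -x - x = ((-2 : ℤ) : 𝓞 K) * x by push_cast; ring] at h3
    rcases (prime_toInteger_sub_one hz).dvd_or_dvd h3 with h4 | h4
    · rw [toInteger_sub_one_dvd_intCast_iff hz, dvd_neg] at h4
      have h5 : p ∣ 2 := by exact_mod_cast h4
      exact hp2 ((Nat.prime_dvd_prime_iff_eq hp.out Nat.prime_two).1 h5)
    · exact hx h4

lemma not_natCast_dvd_natCast {l m : ℕ} (h : ¬ l ∣ m) {x : 𝓞 K} (hx : IsUnit x) :
    ¬ (l : 𝓞 K) ∣ m * x := by
  rw [hx.dvd_mul_right]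
  intro h1
  apply h
  have := (intCast_dvd_intCast_ringOfIntegers K (m := l) (n := m)).1 (by exact_mod_cast h1)
  exact_mod_cast this

lemma two_pow_modEq {o : ℕ} (ho : Odd o) : ∃ h, 11 ^ o = 2 * h + 1 ∧ 11 ∣ 2 ^ h + 1 := by
  obtain ⟨k, rfl⟩ := ho
  have : ∀ k, ∃ h, 11 ^ (2 * k + 1) = 2 * h + 1 ∧ h % 10 = 5 := by
    intro k
    induction k with
    | zero => exact ⟨5, by norm_num⟩
    | succ k ih =>
      obtain ⟨h, h1, h2⟩ := ih
      refine ⟨121 * h + 60, ?_, by omega⟩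
      rw [show 2 * (k + 1) + 1 = 2 * k + 1 + 2 by ring, pow_add, h1]; ring
  obtain ⟨h, h1, h2⟩ := this k
  refine ⟨h, h1, ?_⟩
  obtain ⟨m, rfl⟩ : ∃ m, h = 10 * m + 5 := ⟨h / 10, by omega⟩
  apply Nat.dvd_of_mod_eq_zero
  rw [pow_add, pow_mul, Nat.add_mod, Nat.mul_mod, Nat.pow_mod]
  norm_num

include hz in
lemma not_exists_sq_add_smul_sq (hp11 : p ≠ 11) {c : Gal(K/ℚ)}
    (hc : c • hz.toInteger = hz.toInteger ^ (p - 1)) {t Δ : 𝓞 K}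
    (hΔ : IsUnit Δ) (h1 : t ^ 2 + (c • t) ^ 2 = 2 * Δ ^ 2) (h2 : (11 : 𝓞 K) ∣ t * c • t) : False := by
  have h11 : Fact (Nat.Prime 11) := ⟨by norm_num⟩
  have h11' : (((11 : ℕ) : 𝓞 K)) = 11 := by norm_num
  have hred : ∀ {x : 𝓞 K} {n : ℕ}, (11 : 𝓞 K) ∣ x ^ n → (11 : 𝓞 K) ∣ x := by
    intro x n h
    rw [← h11'] at h ⊢
    exact natCast_dvd_of_dvd_pow hz 11 hp11.symm h
  have hno : ¬ (11 : 𝓞 K) ∣ 2 * Δ ^ 2 := by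
    have := not_natCast_dvd_natCast (l := 11) (m := 2) (by norm_num) (hΔ.pow 2)
    exact_mod_cast this
  have hcop : Nat.Coprime 11 p := (Nat.coprime_primes h11.out hp.out).2 hp11.symm
  let e := ZMod.unitOfCoprime 11 hcop
  have hζ : ∀ m n : ℕ, (m : ZMod p) = n → hz.toInteger ^ m = hz.toInteger ^ n := by
    intro m n h
    have h' : m % p = n % p := (ZMod.natCast_eq_natCast_iff _ _ _).1 h
    rw [← pow_mod_orderOf _ m, ← pow_mod_orderOf _ n, ← hz.toInteger_isPrimitiveRoot.eq_orderOf, h']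
  rcases Nat.even_or_odd (orderOf e) with ho | ho
  · obtain ⟨j, hj⟩ := ho
    have hpos := orderOf_pos e
    have hsq : (e ^ j) ^ 2 = 1 := by rw [← pow_mul, mul_two, ← hj, pow_orderOf_eq_one]
    have hne : e ^ j ≠ 1 := pow_ne_one_of_lt_orderOf (by omega) (by omega)
    have hval : ((11 ^ j : ℕ) : ZMod p) = ((p - 1 : ℕ) : ZMod p) := by
      have hs : (((e ^ j : (ZMod p)ˣ)) : ZMod p) ^ 2 = 1 := by
        rw [← Units.val_pow_eq_pow_val, hsq, Units.val_one]
      have he : ((e ^ j : (ZMod p)ˣ) : ZMod p) = ((11 ^ j : ℕ) : ZMod p) := by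
        simp [e]
      rw [Nat.cast_sub hp.out.one_lt.le, Nat.cast_one, ZMod.natCast_self, zero_sub, ← he]
      rcases sq_eq_one_iff.1 hs with h | h
      · exact absurd (Units.ext h) hne
      · exact h
    have h3 := dvd_smul_sub_pow hz 11 c j (by rw [hc]; exact (hζ _ _ hval).symm) t
    rw [h11'] at h3
    have h4 : (11 : 𝓞 K) ∣ t ^ (11 ^ j + 1) := by
      have := h2.sub (h3.mul_left t)
      convert this using 1
      ring
    have h5 := hred h4
    obtain ⟨d, hd⟩ := h5
    apply hno
    rw [← h1, hd, smul_mul', show c • (11 : 𝓞 K) = 11 from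
      map_ofNat (MulSemiringAction.toRingHom Gal(K/ℚ) (𝓞 K) c) 11]
    exact ⟨11 * d ^ 2 + 11 * (c • d) ^ 2, by ring⟩
  · obtain ⟨h, hh1, hh2⟩ := two_pow_modEq ho
    have hval : ((11 ^ orderOf e : ℕ) : ZMod p) = ((1 : ℕ) : ZMod p) := by
      have : (((e ^ orderOf e : (ZMod p)ˣ)) : ZMod p) = 1 := by rw [pow_orderOf_eq_one]; rfl
      rw [Nat.cast_one, ← this, Units.val_pow_eq_pow_val]; simp [e]
    have hfrob := dvd_smul_sub_pow hz 11 1 (orderOf e) (by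
      rw [one_smul, hζ _ _ hval, pow_one])
    rw [h11', hh1] at hfrob
    simp only [one_smul] at hfrob
    have hw := hfrob (t + c • t)
    have hD := hfrob Δ
    let I : Ideal (𝓞 K) := Ideal.span {(11 : 𝓞 K)}
    have hI : ∀ x y : 𝓞 K, (11 : 𝓞 K) ∣ x - y ↔ Ideal.Quotient.mk I x = Ideal.Quotient.mk I y := by
      intro x y
      rw [Ideal.Quotient.eq, Ideal.mem_span_singleton]
    have hw2 : (11 : 𝓞 K) ∣ (t + c • t) ^ 2 - 2 * Δ ^ 2 := by
      rw [← h1, show (t + c • t) ^ 2 - (t ^ 2 + (c • t) ^ 2) = 2 * (t * c • t) by ring]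
      exact h2.mul_left _
    have h2h : (11 : 𝓞 K) ∣ 2 ^ h - (-1) := by
      rw [sub_neg_eq_add]
      have := map_dvd (Nat.castRingHom (𝓞 K)) hh2
      simpa using this
    rw [hI] at hw hD hw2 h2h
    simp only [map_pow, map_mul, pow_succ _ (2 * h), pow_mul _ 2 h] at hw hD hw2 h2h
    have hDu := hΔ.map (Ideal.Quotient.mk I)
    have hD' : (Ideal.Quotient.mk I Δ ^ 2) ^ h = 1 := by
      apply hDu.mul_right_cancel
      rw [← hD, one_mul]
    rw [hw2, mul_pow, hD', h2h, mul_one, map_neg, map_one, neg_one_mul] at hw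
    have h5 : (11 : 𝓞 K) ∣ 2 * (t + c • t) := by
      have : Ideal.Quotient.mk I (t + c • t) = Ideal.Quotient.mk I (-(t + c • t)) := by
        rw [map_neg]; exact hw
      rw [← hI] at this
      convert this using 1; ring
    have h6 : (11 : 𝓞 K) ∣ t + c • t := by
      have : (11 : 𝓞 K) ∣ 11 * (t + c • t) - 5 * (2 * (t + c • t)) :=
        (dvd_mul_right _ _).sub (h5.mul_left _)
      convert this using 1; ring
    apply hno
    rw [← h1, show t ^ 2 + (c • t) ^ 2 = (t + c • t) * (t + c • t) - 2 * (t * c • t) by ring]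
    exact (h6.mul_left _).sub (h2.mul_left _)

end

end

section

open NumberField IsCyclotomicExtension.Rat QuadraticAlgebra

lemma exists_re_im_of_isUnit {p : ℕ} [hp : Fact p.Prime] {K : Type} [Field K] [NumberField K]
    [IsCyclotomicExtension {p} ℚ K] {z : K} (hz : IsPrimitiveRoot z p) (hp2 : p ≠ 2)
    {a b : ℤ} (hb : b ≠ 0) (hre : (⟨b, a⟩ ^ p : GaussianInt).re = b) {c : Gal(K/ℚ)}
    (hc : c • hz.toInteger = hz.toInteger ^ (p - 1)) (ρ : Gal(K/ℚ)) {g : ℕ} (hg : Odd g)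
    (hρ : ρ ^ g = 1) :
    ∃ X Y : 𝓞 K, (a : 𝓞 K) ∣ Y ∧ (a : 𝓞 K) ∣ X - b ^ g ∧ (b : 𝓞 K) ∣ X ∧ hz.toInteger - 1 ∣ Y ∧
      IsUnit (X ^ 2 + Y ^ 2) ∧ ρ • X = X ∧ ρ • Y = Y ∧ c • X = X ∧ c • Y = - Y := by
  obtain ⟨hu, τ, hτ⟩ := exists_mul_toInteger_add_one_eq hz hp2
  have hcomm : ∀ m : ℕ, c * ρ ^ m = ρ ^ m * c := by
    intro m
    apply (galEquivZMod p K).injective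
    rw [map_mul, map_mul, mul_comm]
  have hcτ : c • τ = - τ := by
    have h1 := congrArg (c • ·) hτ
    simp only [smul_mul', smul_add, smul_sub, smul_one, hc] at h1
    apply hu.mul_right_cancel
    have h2 : hz.toInteger ^ (p - 1) * hz.toInteger = 1 := by
      rw [← pow_succ, Nat.sub_add_cancel hp.out.one_lt.le,
        hz.toInteger_isPrimitiveRoot.pow_eq_one]
    linear_combination hz.toInteger * h1 + (1 - c • τ) * h2 + hτ
  let y : ℕ → 𝓞 K := fun m => ρ ^ m • τ
  let Z := linProd (a : 𝓞 K) b y g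
  have hmap : ∀ σ : Gal(K/ℚ), mapRingHom (MulSemiringAction.toRingHom Gal(K/ℚ) (𝓞 K) σ) Z =
      linProd (a : 𝓞 K) b (fun m => σ • y m) g := by
    intro σ
    rw [mapRingHom_linProd, map_intCast, map_intCast]
    rfl
  have hρZ : mapRingHom (MulSemiringAction.toRingHom Gal(K/ℚ) (𝓞 K) ρ) Z = Z := by
    rw [hmap]
    have : (fun m => ρ • y m) = fun m => y (m + 1) := by
      ext1 m
      simp only [y, pow_succ', SemigroupAction.mul_smul]
    rw [this, linProd_shift]
    simp [y, hρ]
  have hcZ : mapRingHom (MulSemiringAction.toRingHom Gal(K/ℚ) (𝓞 K) c) Z = star Z := by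
    rw [hmap, star_linProd]
    congr 1
    ext1 m
    simp only [y, ← SemigroupAction.mul_smul, hcomm]
    rw [SemigroupAction.mul_smul, hcτ, smul_neg]
  have hPτ : hz.toInteger - 1 ∣ τ := by
    rw [← hu.dvd_mul_right, hτ]
  refine ⟨Z.re, Z.im, dvd_linProd_im, dvd_linProd_re_sub, dvd_linProd_re_of_odd hg,
    dvd_linProd_im_of_forall fun m => ?_, ?_, congrArg QuadraticAlgebra.re hρZ,
    congrArg QuadraticAlgebra.im hρZ, ?_, ?_⟩
  · exact (dvd_sub_left hPτ).1 (toInteger_sub_one_dvd_smul_sub hz (ρ ^ m) τ)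
  · rw [linProd_re_sq_add_im_sq]
    refine (Finset.prod_induction _ IsUnit (fun _ _ => IsUnit.mul) isUnit_one fun m _ => ?_)
    have h1 : IsUnit ((b : 𝓞 K) ^ 2 + (a * τ) ^ 2) := by
      have h2 := isUnit_quadratic_of_re_pow_eq hz hp2 hb hre
      apply isUnit_of_dvd_unit _ h2
      refine ⟨(hz.toInteger + 1) ^ 2, ?_⟩
      linear_combination -(a : 𝓞 K) ^ 2 * (τ * (hz.toInteger + 1) + hz.toInteger - 1) * hτ
    have h3 := h1.map (MulSemiringAction.toRingHom Gal(K/ℚ) (𝓞 K) (ρ ^ m))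
    rw [map_add, map_pow, map_pow, map_mul, map_intCast, map_intCast] at h3
    exact h3
  · have := congrArg QuadraticAlgebra.re hcZ
    simpa [mapRingHom] using this
  · have := congrArg QuadraticAlgebra.im hcZ
    simpa [mapRingHom] using this

lemma almostSquare_of_sq_add_sq {K : Type} [Field K] [NumberField K] {π Δ X Y : 𝓞 K}
    (hπ : Prime π) (hΔ : IsUnit Δ) (hX : IsCoprime X 2) (hY : 4 ∣ Y) (hπY : π ∣ Y)
    (h : X ^ 2 + Y ^ 2 = Δ ^ 2) : AlmostSquare π (Δ * (Δ + Y)) := by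
  refine ⟨fun hd => ?_, ⟨Ideal.span {Δ + Y, X}, ?_⟩, Δ, ?_, ?_⟩
  · rw [hΔ.dvd_mul_left, dvd_add_left hπY] at hd
    exact hπ.not_isUnit (isUnit_of_dvd_unit hd hΔ)
  · rw [show Ideal.span {Δ * (Δ + Y)} = Ideal.span {Δ + Y} from
      Ideal.span_singleton_mul_left_unit hΔ _, sq, Ideal.span_pair_mul_span_pair]
    obtain ⟨r, s, hrs⟩ := hX
    obtain ⟨d, hd⟩ := hΔ.exists_left_inv
    apply le_antisymm
    · rw [Ideal.span_singleton_le_iff_mem]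
      have e : Δ + Y = r * (X * (Δ + Y)) + s * d * ((Δ + Y) * (Δ + Y) + X * X) := by
        linear_combination (-(Δ + Y)) * hrs - s * d * h - 2 * s * (Δ + Y) * hd
      refine (congrArg (· ∈ _) e).mpr (add_mem (Ideal.mul_mem_left _ _ (Ideal.subset_span (by simp)))
        (Ideal.mul_mem_left _ _ (add_mem (Ideal.subset_span (by simp))
          (Ideal.subset_span (by simp)))))
    · rw [Ideal.span_le]
      intro w hw
      simp only [Set.mem_insert_iff, Set.mem_singleton_iff] at hw
      rw [SetLike.mem_coe, Ideal.mem_span_singleton]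
      rcases hw with rfl | rfl | rfl | rfl
      · exact dvd_mul_right _ _
      · exact dvd_mul_right _ _
      · exact dvd_mul_left _ _
      · exact ⟨Δ - Y, by linear_combination h⟩
  · exact hΔ.exists_left_inv.imp fun d hd => ⟨0, by rw [hd]; ring⟩
  · rw [show Δ * (Δ + Y) - Δ ^ 2 = Δ * Y by ring]
    exact hY.mul_left _

lemma re_pow_ne_of_isPrimitiveRoot {p : ℕ} [hp : Fact p.Prime] {K : Type} [Field K] [NumberField K]
    [IsCyclotomicExtension {p} ℚ K] {z : K} (hz : IsPrimitiveRoot z p) (hp2 : p ≠ 2)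
    (hp11 : p ≠ 11) {a b : ℤ} (ha : 4 ∣ a) (hb : 11 ∣ b) (hbo : Odd b) :
    (⟨b, a⟩ ^ p : GaussianInt).re ≠ b := by
  intro hre
  have hP := prime_toInteger_sub_one hz
  have hb0 : b ≠ 0 := by rintro rfl; simp at hbo
  obtain ⟨σ, hσ⟩ := (isCyclic_gal p K).exists_generator
  have hcard : Nat.card Gal(K/ℚ) = p - 1 := by
    rw [Nat.card_congr (galEquivZMod p K).toEquiv, Nat.card_eq_fintype_card, ZMod.card_units]
  obtain ⟨s, g, hg, hsg⟩ := Nat.exists_eq_two_pow_mul_odd (n := p - 1)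
    (by have := hp.out.two_le; omega)
  have hρ : (σ ^ 2 ^ s) ^ g = 1 := by
    rw [← pow_mul, ← hsg, ← hcard, pow_card_eq_one']
  have hpdvd : ¬ p ∣ p - 1 := Nat.not_dvd_of_pos_of_lt (by have := hp.out.two_le; omega)
    (by have := hp.out.two_le; omega)
  obtain ⟨c, hc⟩ := exists_gal_smul_toInteger hz (p - 1) hpdvd
  obtain ⟨X, Y, haY, haX, hbX, hPY, hN, hρX, hρY, hcX, hcY⟩ :=
    exists_re_im_of_isUnit hz hp2 hb0 hre hc (σ ^ 2 ^ s) hg hρ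
  have h4Y : (4 : 𝓞 K) ∣ Y := by
    refine dvd_trans ?_ haY
    simpa using map_dvd (Int.castRingHom (𝓞 K)) ha
  have hX2 : IsCoprime X 2 := by
    have h1 : IsCoprime ((b : 𝓞 K) ^ g) 2 := by
      obtain ⟨m, hm⟩ := hbo
      refine IsCoprime.pow_left ⟨1, -m, ?_⟩
      rw [hm]; push_cast; ring
    have h2 : (2 : 𝓞 K) ∣ X - b ^ g := by
      refine dvd_trans ?_ haX
      refine dvd_trans ⟨2, by norm_num⟩ (show (4 : 𝓞 K) ∣ a by
        simpa using map_dvd (Int.castRingHom (𝓞 K)) ha)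
    obtain ⟨d, hd⟩ := h2
    rw [show X = b ^ g + 2 * d by linear_combination hd]
    exact h1.add_mul_left_left d
  have hNsq : AlmostSquare (hz.toInteger - 1) (X ^ 2 + Y ^ 2) := by
    refine ⟨fun h => hP.not_isUnit (isUnit_of_dvd_unit h hN), ⟨⊤, ?_⟩, X, hX2, ?_⟩
    · rw [Ideal.span_singleton_eq_top.2 hN, sq, Ideal.mul_top]
    · rw [add_sub_cancel_left]
      exact dvd_pow h4Y two_ne_zero
  obtain ⟨Δ, hΔ⟩ := hNsq.isSquare hz hp2 hσ (r := s) (by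
    rw [smul_add, smul_pow', smul_pow', hρX, hρY])
  have hΔu : IsUnit Δ := by
    rw [hΔ] at hN
    exact (isUnit_pow_iff two_ne_zero).1 hN
  have hPΔ : ¬ hz.toInteger - 1 ∣ Δ := fun h => hP.not_isUnit (isUnit_of_dvd_unit h hΔu)
  have hρΔ : (σ ^ 2 ^ s) • Δ = Δ := smul_eq_of_sq_eq hz hp2 hΔ
    (by rw [smul_add, smul_pow', smul_pow', hρX, hρY]) hPΔ
  have hcΔ : c • Δ = Δ := smul_eq_of_sq_eq hz hp2 hΔ
    (by rw [smul_add, smul_pow', smul_pow', hcX, hcY, neg_sq]) hPΔ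
  obtain ⟨t, ht⟩ := (almostSquare_of_sq_add_sq hP hΔu hX2 h4Y hPY hΔ).isSquare hz hp2 hσ
    (r := s) (by rw [smul_mul', smul_add, hρΔ, hρY])
  have hct : (c • t) ^ 2 = Δ * (Δ - Y) := by
    rw [← smul_pow', ← ht, smul_mul', smul_add, hcΔ, hcY, sub_eq_add_neg]
  refine not_exists_sq_add_smul_sq hz hp11 hc hΔu (t := t) ?_ ?_
  · rw [hct, ← ht]; ring
  · have h11 : Fact (Nat.Prime 11) := ⟨by norm_num⟩
    have h1 : (11 : 𝓞 K) ∣ X := by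
      refine dvd_trans ?_ hbX
      simpa using map_dvd (Int.castRingHom (𝓞 K)) hb
    have h2 : (11 : 𝓞 K) ∣ (t * c • t) ^ 2 := by
      rw [mul_pow, hct, ← ht, show Δ * (Δ + Y) * (Δ * (Δ - Y)) = X * (X * Δ ^ 2) by
        linear_combination (-Δ ^ 2) * hΔ]
      exact h1.mul_right _
    have := natCast_dvd_of_dvd_pow hz 11 hp11.symm (x := t * c • t) (n := 2)
    rw [show ((11 : ℕ) : 𝓞 K) = 11 by norm_num] at this
    exact this h2

lemma re_pow_ne_of_dvd {p : ℕ} (hp : p.Prime) (hp2 : p ≠ 2) (hp11 : p ≠ 11) {a b : ℤ}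
    (ha : 4 ∣ a) (hb : 11 ∣ b) (hbo : Odd b) : (⟨b, a⟩ ^ p : GaussianInt).re ≠ b := by
  have := Fact.mk hp
  have : NeZero p := ⟨hp.ne_zero⟩
  have : IsCyclotomicExtension {p} ℚ (CyclotomicField p ℚ) := by
    have h := CyclotomicField.isCyclotomicExtension p ℚ
    rwa [Subsingleton.elim (CyclotomicField.algebra p ℚ) DivisionRing.toRatAlgebra] at h
  exact re_pow_ne_of_isPrimitiveRoot
    (IsCyclotomicExtension.zeta_spec p ℚ (CyclotomicField p ℚ)) hp2 hp11 ha hb hbo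

end

lemma exists_gaussianInt_pow_of_odd {a b : ℤ} (ha : Even a) (hb : Odd b) (m : ℕ) :
    ∃ C D : ℤ, Odd C ∧ Odd D ∧ (⟨b, a⟩ ^ (2 * m + 1) : GaussianInt) = ⟨C, a * D⟩ := by
  induction m with
  | zero => exact ⟨b, 1, hb, odd_one, by simp⟩
  | succ m ih =>
    obtain ⟨C, D, hC, hD, h⟩ := ih
    obtain ⟨k, rfl⟩ := hb
    obtain ⟨c, rfl⟩ := ha
    refine ⟨C * ((2 * k + 1) ^ 2 - (c + c) ^ 2) - 2 * (c + c) ^ 2 * (2 * k + 1) * D,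
      D * ((2 * k + 1) ^ 2 - (c + c) ^ 2) + 2 * (2 * k + 1) * C, ?_, ?_, ?_⟩
    · simp [parity_simps, hC]
    · simp [parity_simps, hD]
    · rw [show 2 * (m + 1) + 1 = 2 * m + 1 + 2 by ring, pow_add, h]
      ext <;> simp [pow_two] <;> ring

lemma exists_gaussianInt_pow {a b : ℤ} (ha : Even a) (hb : Odd b) (m s : ℕ) :
    ∃ C D : ℤ, Odd C ∧ Odd D ∧
      (⟨b, a⟩ ^ (2 ^ s * (2 * m + 1)) : GaussianInt) = ⟨C, a * 2 ^ s * D⟩ := by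
  induction s with
  | zero => simpa using exists_gaussianInt_pow_of_odd ha hb m
  | succ s ih =>
    obtain ⟨C, D, hC, hD, h⟩ := ih
    refine ⟨C ^ 2 - (a * 2 ^ s * D) ^ 2, C * D, ?_, hC.mul hD, ?_⟩
    · exact hC.pow.sub_even (((ha.mul_right _).mul_right _).pow_of_ne_zero two_ne_zero)
    · rw [pow_succ, mul_right_comm, pow_mul, h]
      ext <;> simp [pow_succ] <;> ring

lemma exists_pow_sub_one_eq {y : ℤ} (hy : 4 ∣ y - 1) (m s : ℕ) :
    ∃ M : ℤ, Odd M ∧ y ^ (2 ^ s * (2 * m + 1)) - 1 = (y - 1) * 2 ^ s * M := by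
  induction s with
  | zero =>
    have hyo : Odd y := by
      obtain ⟨c, hc⟩ := hy
      exact ⟨2 * c, by linarith⟩
    refine ⟨∑ i ∈ Finset.range (2 * m + 1), y ^ i, ?_, ?_⟩
    · induction m with
      | zero => simp
      | succ m ih =>
        rw [show 2 * (m + 1) + 1 = 2 * m + 1 + 1 + 1 by ring, Finset.sum_range_succ,
          Finset.sum_range_succ, add_assoc]
        exact ih.add_even (hyo.pow.add_odd hyo.pow)
    · have := mul_geom_sum y (2 * m + 1)
      simp [this]
  | succ s ih =>
    obtain ⟨M, hM, h⟩ := ih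
    obtain ⟨c, hc⟩ := hy
    refine ⟨M * (2 * (c * 2 ^ s * M) + 1), hM.mul ⟨_, rfl⟩, ?_⟩
    rw [pow_succ, mul_right_comm, pow_mul]
    have : y ^ (2 ^ s * (2 * m + 1)) = 4 * c * 2 ^ s * M + 1 := by
      rw [← hc]; linarith
    rw [this, hc]; ring

/-- If `re (b + a i) ^ p = b` then a two-adic comparison of `re` with the norm forces `4 ∣ a`
and `b ≠ ± 1`. -/
lemma four_dvd_of_re_pow_eq {p : ℕ} (hp : Odd p) (hp1 : 1 < p) {a b : ℤ} (ha : Even a)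
    (ha0 : a ≠ 0) (hb : Odd b) (h : (⟨b, a⟩ ^ p : GaussianInt).re = b) : 4 ∣ a ∧ b ^ 2 ≠ 1 := by
  obtain ⟨s, g, hg, hsg⟩ := Nat.exists_eq_two_pow_mul_odd (n := p - 1) (by omega)
  obtain ⟨m, rfl⟩ := hg
  have hs : s ≠ 0 := by
    rintro rfl
    obtain ⟨q, rfl⟩ := hp
    omega
  obtain ⟨C, D, hC, hD, hCD⟩ := exists_gaussianInt_pow ha hb m s
  obtain ⟨a', rfl⟩ := ha.two_dvd
  have hb8 : (8 : ℤ) ∣ b ^ 2 - 1 := Int.eight_dvd_sq_sub_one_of_odd hb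
  have hy4 : (4 : ℤ) ∣ (2 * a') ^ 2 + b ^ 2 - 1 := by
    obtain ⟨c, hc⟩ := hb8
    exact ⟨a' ^ 2 + 2 * c, by linarith⟩
  obtain ⟨M, hM, hyM⟩ := exists_pow_sub_one_eq hy4 m s
  have hre : b * C - (2 * a') ^ 2 * 2 ^ s * D = b := by
    rw [show p = 2 ^ s * (2 * m + 1) + 1 by omega, pow_succ, hCD] at h
    simp at h
    linarith
  have hnorm : ((2 * a') ^ 2 + b ^ 2) ^ (2 ^ s * (2 * m + 1)) =
      C ^ 2 + (2 * a' * 2 ^ s * D) ^ 2 := by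
    have h1 := congrArg Zsqrtd.norm hCD
    have h2 := map_pow (Zsqrtd.normMonoidHom (d := -1)) ⟨b, 2 * a'⟩ (2 ^ s * (2 * m + 1))
    change Zsqrtd.norm _ = Zsqrtd.norm _ ^ _ at h2
    rw [h2] at h1
    simp only [Zsqrtd.norm_def] at h1
    rw [show (2 * a') ^ 2 + b ^ 2 = b * b - -1 * (2 * a') * (2 * a') by ring, h1]
    ring
  rw [hnorm] at hyM
  obtain ⟨C', rfl⟩ := hC
  obtain ⟨t, rfl⟩ := Nat.exists_eq_succ_of_ne_zero hs
  have key : b * M * ((2 * a') ^ 2 + b ^ 2 - 1) =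
      (2 * a') ^ 2 * (2 * (D * (C' + 1) + b * 2 ^ t * D ^ 2)) := by
    have h2 : (2 : ℤ) ^ (t + 1) ≠ 0 := by positivity
    apply mul_left_cancel₀ h2
    simp only [Nat.succ_eq_add_one, pow_succ] at *
    linear_combination (-b) * hyM + (2 * C' + 2) * hre
  have hbM := hb.mul hM
  have ha'0 : a' ≠ 0 := by rintro rfl; simp at ha0
  constructor
  · rcases Int.even_or_odd a' with he | ho
    · obtain ⟨c, rfl⟩ := he
      exact ⟨c, by ring⟩
    · exfalso
      have h8 : (8 : ℤ) ∣ (2 * a') ^ 2 + b ^ 2 - 1 := by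
        refine (show IsCoprime (8 : ℤ) (b * M) from ?_).dvd_of_dvd_mul_left ?_
        · exact (Int.isCoprime_two_left.2 hbM).pow_left (m := 3)
        · rw [key]; exact ⟨a' ^ 2 * (D * (C' + 1) + b * 2 ^ t * D ^ 2), by ring⟩
      have h8' : (8 : ℤ) ∣ (2 * a') ^ 2 := by
        have := dvd_sub h8 hb8
        ring_nf at this ⊢
        exact this
      obtain ⟨c, rfl⟩ := ho
      obtain ⟨d, hd⟩ := h8'
      ring_nf at hd
      omega
  · intro h1
    rw [show (2 * a') ^ 2 + b ^ 2 - 1 = (2 * a') ^ 2 by linarith, mul_comm] at key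
    have := mul_left_cancel₀ (by positivity) key
    rw [this] at hbM
    exact (Int.not_odd_iff_even.2 (even_two_mul _)) hbM

lemma re_pow_ne_of_eq_pow {p : ℕ} (hp : p.Prime) (hp2 : p ≠ 2) (hp11 : p ≠ 11) {a b : ℤ}
    (ha : Even a) (ha0 : a ≠ 0) {k : ℕ} (hb : b = 11 ^ k ∨ b = -11 ^ k) :
    (⟨b, a⟩ ^ p : GaussianInt).re ≠ b := by
  intro h
  have hbo : Odd b := by
    have : Odd ((11 : ℤ) ^ k) := Odd.pow (by decide)
    rcases hb with rfl | rfl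
    · exact this
    · exact this.neg
  obtain ⟨h4, hb1⟩ := four_dvd_of_re_pow_eq (hp.odd_of_ne_two hp2) hp.one_lt ha ha0 hbo h
  have hk : k ≠ 0 := by
    rintro rfl
    rcases hb with rfl | rfl <;> simp at hb1
  have h11 : (11 : ℤ) ∣ b := by
    have : (11 : ℤ) ∣ 11 ^ k := dvd_pow_self _ hk
    rcases hb with rfl | rfl
    · exact this
    · exact this.neg_right
  exact re_pow_ne_of_dvd hp hp2 hp11 h4 h11 hbo h

def forceNat {α : Type} (x : ℕ) (f : ℕ → α) : α :=
  match x with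
  | 0 => f 0
  | n + 1 => f (n + 1)

/-- The bitwise union of `f lo, …, f (lo + n - 1)`, for `n ≤ 2 ^ fuel`. -/
def orRange (f : ℕ → ℕ) : ℕ → ℕ → ℕ → ℕ
  | 0, lo, _ => f lo
  | d + 1, lo, n => bif n.beq 0 then 0 else bif n.beq 1 then f lo else
      orRange f d lo (n / 2) ||| orRange f d (lo + n / 2) (n - n / 2)

def zsqrtdPowImAux (r : ℕ) : ℕ → ℕ → ℕ → ℕ → ℕ → ℕ → ℕ
  | 0, _, _, _, _, d => d
  | f + 1, e, a, b, c, d =>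
    bif e.beq 0 then d else
    zsqrtdPowImAux r f (e / 2) ((a * a + 11 * (r - 1) * (b * b)) % r) ((2 * a * b) % r)
     (bif (e % 2).beq 1 then (a * c + 11 * (r - 1) * (b * d)) % r else c)
     (bif (e % 2).beq 1 then (a * d + b * c) % r else d)

/-- A multiple (by `1`, or by `2 * s` where `s ^ 2 = -11`) of the imaginary part of
`(t + √-11) ^ e` modulo `r`. -/
def powImMod (r s e t : ℕ) : ℕ :=
  bif s.beq 0 then zsqrtdPowImAux r 16 e t 1 1 0
  else ((t + s) ^ e + r - (t + (r - s)) ^ e % r) % r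

/-- The set of the exponents `k < o` for which `Im (a + 11 ^ k √-11) ^ e = 11 ^ k` is solvable
modulo `r`, as a bit mask. -/
def exponentMask (r s e o : ℕ) : ℕ :=
  forceNat (orRange (fun t => 1 <<< powImMod r s e t) 16 0 (r / 2 + 1)) fun Y =>
  forceNat ((11 ^ (r - 2) % r) ^ (e - 1) % r) fun g =>
  forceNat (bif s.beq 0 then 1 else 2 * s) fun c =>
  orRange (fun k => ((Y >>> (c * g ^ k % r)) % 2) <<< k) 16 0 o

def repeatMask (x o : ℕ) : ℕ → ℕ
  | 0 => x
  | d + 1 => forceNat (repeatMask x o d) fun y => y ||| (y <<< (o * 2 ^ d))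

def periodicMask (x o M : ℕ) : ℕ := repeatMask x o ((M / o).log2 + 1) % 2 ^ M

def residueMask (p M : ℕ) : ℕ :=
  bif (p % 5).beq 1 then (bif (p % 8).beq 3 then 1 else 0) else
  periodicMask (bif (p % 8).beq 1 then 8 else bif (p % 8).beq 5 then 2 else
    bif (p % 8).beq 3 then 1 else 4) 4 M

structure SieveModulus where
  r : ℕ
  s : ℕ
  o : ℕ

def SieveModulus.valid (q : SieveModulus) : Bool :=
  ((q.s.beq 0) || ((q.s * q.s + 11) % q.r).beq 0 && q.s.ble q.r) && (11 ^ q.o % q.r).beq 1 &&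
    ((11 ^ (q.r - 2) % q.r * 11) % q.r).beq 1 && Nat.ble 1 q.o && q.r.ble 65536 && q.o.ble 65536

def checkCertificate (p M : ℕ) (l : List SieveModulus) : Bool :=
  (l.all fun q => q.valid && (M % q.o).beq 0) && (M % 4).beq 0 &&
  (l.foldr (fun q C => periodicMask (exponentMask q.r q.s p q.o) q.o M &&& C)
    (residueMask p M)).beq 0

structure SieveTable extends SieveModulus where
  P : ℕ
  T : ℕ

def SieveTable.entry (q : SieveTable) (p : ℕ) : ℕ := (q.T >>> (p % q.P * q.o)) % 2 ^ q.o

def SieveTable.check (q : SieveTable) : Bool :=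
  q.toSieveModulus.valid && (11 ^ q.P % q.r).beq 1 &&
  (orRange (fun i => bif (Nat.gcd (2 * i + 1) q.P).beq 1 then
    exponentMask q.r q.s (2 * i + 1) q.o ^^^ q.entry (2 * i + 1) else 0) 16 0 (q.P / 2)).beq 0

def sieveTables : List SieveTable :=
  [⟨⟨7, 0, 3⟩, 48,
    13942761621985234536814730928933090579513400⟩,
   ⟨⟨13, 0, 12⟩, 168,
    2985139807713061763005366323061973158458026084328258864314030947597325950567730086938938449262743073800923976713585639544120942331919594591263121859769142328396069934931838214341843305434947276256794292882021519574263665099145839991530462681939375113909247764121606579010497145029496783751399955069658446365128202686974010258976259854473049494260123096075679820393487516492003754921468516379687565780611722723813200804536439078482146179487767493225311683143831064001123591089482123845916694146598727646658387303601960833105549658882320998116224224630693892078088000210634222630983391080930936252770115645440⟩,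
   ⟨⟨17, 0, 16⟩, 288,
    12739758553031530084593419977352012666841734181314402409098539332136809113923230533173646691000902456446922475774053659205712998929337240546501607402979190057071512298558930711389658675598435437142173437914373656610500128730039039724534655607012238768266039823067140815658776719525458167699080634109179165666886264866119440126689960389418272837230581082372433321671639812621450167380806857042259247153130994003531494554853772533782104451637170280424244856937543279337560473030389266397009727382960419113867042401942243630692024995518347261263106201700185829138259207359787387144058654022166135729372298055369903977231836787315805977174384104591154655977722605049296366067862931386588591494424084256459372423271727547334467331438668207403896777065764642449067738856481637897860762754650096561740449731996374676011231346587658683933085586017552937638453481158797254601845797941364151259076002179992627517275291739095200603537590047527951146248575669313013280107156105965961435495518414254511303562170397317664587874860950558693124620256730086644610875191219469925030454641947328064059486432728801920458254042975552777795874456925078007037404903449006377406721425979800027170740834201109086092761860597545576336556207509043989199551726789403223145988533083136218322152695369029163245939842185127963260843495364219626143966299876792847254664067714668421548624016692537834495038108124760178688⟩,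
   ⟨⟨19, 0, 3⟩, 360,
    11334569433575143871426585372221551300268646179421929552720602250947247556204732138262866858035815618179496478818598621124859083181557182213360205795328134261461123336742216017163571420916905349699892119364587477534088627382474594429402872424656339402377825562719739292951496582110250841167731625427962752195084799264384090168⟩,
   ⟨⟨37, 10, 6⟩, 36,
    103666793291551044629567950021753479022699393874281698001309142976⟩,
   ⟨⟨97, 38, 48⟩, 96,
    1042049413811681941508261907622680123668058603420082276102591436702084834457786322837250015548491247835235565744122386294975554952725324985459593569024280103386209336956660134992135355435690484821487747165598464111978328934106531934050166081482200668926533252215821067562100070141753284102982929665301679502561455703501567214601518031429564497041153913630817295396380086946793475500210963278898607969349181701403619151503418439271047781726583122248474314891315985149424008956476845559025996230926130697517023952939164353118431754810210168443894596976466261017931297225392882348742677869588161661409680241526392561065375963612133167755559548745008658715779279862197698918597946184554353382105352993040919213249058048951989547930475402559491589996241782019308127426055985539123442018610287878394059504805220835484046099453529707324041660196981353324571046791299070751881649131190781608062022830404423515462143709083448234897644546488265997100761520486882793148741401119846120047584203222001966397522688123739759580588345616262972030752248754731640149314687384509179825028209752400020838767936783224344477559634246844149366008916113646545621362758541949213357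6943701740522307228359997716456165931486665937316511126928993522815642677447042803089807219568833797400608357523682986893692655099316336374618434794048751088669561639797694034217959571970351119153427374153226539556521067418470055936⟩]

def sieveModulus7 : SieveModulus := ⟨7, 0, 3⟩
def sieveModulus13 : SieveModulus := ⟨13, 0, 12⟩
def sieveModulus19 : SieveModulus := ⟨19, 0, 3⟩
def sieveModulus29 : SieveModulus := ⟨29, 0, 28⟩
def sieveModulus31 : SieveModulus := ⟨31, 12, 30⟩
def sieveModulus37 : SieveModulus := ⟨37, 10, 6⟩
def sieveModulus41 : SieveModulus := ⟨41, 0, 40⟩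
def sieveModulus53 : SieveModulus := ⟨53, 25, 26⟩
def sieveModulus61 : SieveModulus := ⟨61, 0, 4⟩
def sieveModulus71 : SieveModulus := ⟨71, 29, 70⟩
def sieveModulus73 : SieveModulus := ⟨73, 0, 72⟩
def sieveModulus113 : SieveModulus := ⟨113, 21, 56⟩
def sieveModulus181 : SieveModulus := ⟨181, 52, 90⟩
def sieveModulus191 : SieveModulus := ⟨191, 84, 38⟩
def sieveModulus193 : SieveModulus := ⟨193, 0, 64⟩
def sieveModulus229 : SieveModulus := ⟨229, 26, 38⟩
def sieveModulus257 : SieveModulus := ⟨257, 62, 64⟩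
def sieveModulus337 : SieveModulus := ⟨337, 0, 112⟩
def sieveModulus421 : SieveModulus := ⟨421, 71, 105⟩
def sieveModulus449 : SieveModulus := ⟨449, 82, 56⟩
def sieveModulus457 : SieveModulus := ⟨457, 0, 152⟩
def sieveModulus521 : SieveModulus := ⟨521, 79, 260⟩
def sieveModulus577 : SieveModulus := ⟨577, 208, 96⟩
def sieveModulus631 : SieveModulus := ⟨631, 294, 90⟩
def sieveModulus641 : SieveModulus := ⟨641, 98, 160⟩
def sieveModulus673 : SieveModulus := ⟨673, 0, 672⟩
def sieveModulus769 : SieveModulus := ⟨769, 0, 768⟩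
def sieveModulus911 : SieveModulus := ⟨911, 30, 26⟩
def sieveModulus1093 : SieveModulus := ⟨1093, 128, 13⟩
def sieveModulus1301 : SieveModulus := ⟨1301, 380, 130⟩
def sieveModulus6043 : SieveModulus := ⟨6043, 2871, 114⟩
def sieveModulus7297 : SieveModulus := ⟨7297, 2127, 1216⟩
def sieveModulus13313 : SieveModulus := ⟨13313, 3712, 6656⟩
def sieveModulus58369 : SieveModulus := ⟨58369, 6812, 4864⟩

def sieveCertificates : List (ℕ × ℕ × List SieveModulus) :=
  [(97, 64, [sieveModulus193]),
   (257, 3840, [sieveModulus31, sieveModulus41, sieveModulus769]),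
   (313, 64, [sieveModulus257]),
   (353, 480, [sieveModulus31, sieveModulus577, sieveModulus41]),
   (433, 64, [sieveModulus257]),
   (449, 64, [sieveModulus193]),
   (577, 64, [sieveModulus193]),
   (757, 4, [sieveModulus61]),
   (929, 96, [sieveModulus19, sieveModulus577]),
   (1093, 64, [sieveModulus257]),
   (1103, 192, [sieveModulus257, sieveModulus577]),
   (1153, 1536, [sieveModulus769]),
   (1409, 1536, [sieveModulus13, sieveModulus769]),
   (1489, 480, [sieveModulus641]),
   (1567, 336, [sieveModulus113, sieveModulus29]),
   (1609, 64, [sieveModulus193]),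
   (1697, 3360, [sieveModulus31, sieveModulus71, sieveModulus421, sieveModulus577]),
   (1709, 336, [sieveModulus449]),
   (1753, 64, [sieveModulus257]),
   (1873, 64, [sieveModulus257]),
   (2017, 64, [sieveModulus193]),
   (2113, 64, [sieveModulus193]),
   (2137, 64, [sieveModulus257]),
   (2143, 336, [sieveModulus449]),
   (2269, 960, [sieveModulus257, sieveModulus641]),
   (2377, 3360, [sieveModulus71, sieveModulus449, sieveModulus641]),
   (2447, 192, [sieveModulus257, sieveModulus13, sieveModulus577]),
   (2473, 3360, [sieveModulus71, sieveModulus113, sieveModulus449, sieveModulus641]),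
   (2689, 33280, [sieveModulus53, sieveModulus521, sieveModulus911, sieveModulus1301, sieveModulus13313]),
   (2753, 64, [sieveModulus193]),
   (2953, 1440, [sieveModulus31, sieveModulus641, sieveModulus631]),
   (3169, 64, [sieveModulus193]),
   (3217, 64, [sieveModulus257]),
   (3433, 64, [sieveModulus257]),
   (3457, 29184, [sieveModulus191, sieveModulus6043, sieveModulus58369]),
   (3529, 64, [sieveModulus257]),
   (3557, 336, [sieveModulus449]),
   (3613, 64, [sieveModulus193]),
   (3617, 96, [sieveModulus37, sieveModulus577]),
   (3697, 64, [sieveModulus257]),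
   (3793, 64, [sieveModulus193]),
   (3919, 336, [sieveModulus113, sieveModulus449]),
   (4057, 64, [sieveModulus257]),
   (4129, 64, [sieveModulus193]),
   (4159, 336, [sieveModulus449]),
   (4229, 28, [sieveModulus29]),
   (4273, 64, [sieveModulus257]),
   (4513, 64, [sieveModulus193]),
   (4657, 336, [sieveModulus113, sieveModulus29, sieveModulus337]),
   (4673, 2432, [sieveModulus229, sieveModulus457, sieveModulus7297]),
   (4733, 64, [sieveModulus257]),
   (4789, 960, [sieveModulus257, sieveModulus641]),
   (5039, 336, [sieveModulus113, sieveModulus449]),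
   (5113, 336, [sieveModulus449]),
   (5153, 1440, [sieveModulus31, sieveModulus181, sieveModulus577, sieveModulus641, sieveModulus73]),
   (5237, 28, [sieveModulus29]),
   (5449, 336, [sieveModulus113, sieveModulus449]),
   (5569, 64, [sieveModulus193]),
   (5839, 336, [sieveModulus449]),
   (5857, 672, [sieveModulus113, sieveModulus29, sieveModulus673]),
   (6073, 96, [sieveModulus577]),
   (6337, 64, [sieveModulus193]),
   (6469, 64, [sieveModulus257]),
   (6637, 336, [sieveModulus449]),
   (6689, 96, [sieveModulus13, sieveModulus577]),
   (6977, 6656, [sieveModulus53, sieveModulus911, sieveModulus1093, sieveModulus13313]),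
   (7129, 64, [sieveModulus257]),
   (7177, 64, [sieveModulus257]),
   (7247, 192, [sieveModulus257, sieveModulus577]),
   (7253, 336, [sieveModulus449]),
   (7297, 1536, [sieveModulus769]),
   (7309, 64, [sieveModulus257]),
   (7393, 64, [sieveModulus193]),
   (7417, 480, [sieveModulus641]),
   (7489, 64, [sieveModulus193]),
   (7649, 96, [sieveModulus37, sieveModulus577]),
   (7753, 96, [sieveModulus577]),
   (8017, 64, [sieveModulus257]),
   (8089, 1680, [sieveModulus71, sieveModulus31, sieveModulus449]),
   (8209, 3360, [sieveModulus71, sieveModulus641, sieveModulus421]),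
   (8233, 64, [sieveModulus257, sieveModulus193]),
   (8317, 64, [sieveModulus257]),
   (8353, 64, [sieveModulus193]),
   (8429, 336, [sieveModulus449]),
   (9157, 144, [sieveModulus73]),
   (9199, 336, [sieveModulus449]),
   (9839, 1680, [sieveModulus31, sieveModulus71, sieveModulus113, sieveModulus421]),
   (10079, 4, [sieveModulus61]),
   (10333, 4, [sieveModulus61]),
   (10607, 192, [sieveModulus257, sieveModulus577]),
   (11003, 1680, [sieveModulus31, sieveModulus71, sieveModulus113, sieveModulus29]),
   (11279, 1680, [sieveModulus31, sieveModulus71, sieveModulus113, sieveModulus421]),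
   (12527, 192, [sieveModulus13, sieveModulus257, sieveModulus577]),
   (12853, 960, [sieveModulus257, sieveModulus641]),
   (13693, 64, [sieveModulus257]),
   (14029, 64, [sieveModulus257]),
   (14543, 240, [sieveModulus31, sieveModulus13, sieveModulus41]),
   (14639, 1680, [sieveModulus31, sieveModulus71, sieveModulus113, sieveModulus421]),
   (15679, 28, [sieveModulus29]),
   (15877, 64, [sieveModulus257]),
   (15887, 192, [sieveModulus37, sieveModulus577, sieveModulus257]),
   (16493, 336, [sieveModulus449]),
   (17053, 4, [sieveModulus61]),
   (17359, 336, [sieveModulus113, sieveModulus449]),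
   (17389, 336, [sieveModulus449]),
   (17669, 64, [sieveModulus257]),
   (18397, 144, [sieveModulus73]),
   (19237, 336, [sieveModulus449]),
   (19853, 64, [sieveModulus257]),
   (19919, 1680, [sieveModulus31, sieveModulus71, sieveModulus113, sieveModulus421]),
   (20287, 336, [sieveModulus449]),
   (20749, 4, [sieveModulus61]),
   (20959, 336, [sieveModulus449]),
   (22093, 4, [sieveModulus61]),
   (22639, 336, [sieveModulus449]),
   (23269, 336, [sieveModulus449]),
   (23279, 1680, [sieveModulus31, sieveModulus71, sieveModulus113, sieveModulus421]),
   (23743, 336, [sieveModulus113, sieveModulus29]),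
   (24623, 240, [sieveModulus31, sieveModulus13, sieveModulus41]),
   (25117, 960, [sieveModulus257, sieveModulus641]),
   (25733, 28, [sieveModulus29]),
   (26293, 960, [sieveModulus257, sieveModulus641]),
   (28307, 336, [sieveModulus113, sieveModulus449]),
   (28477, 336, [sieveModulus449]),
   (28813, 64, [sieveModulus257]),
   (29327, 192, [sieveModulus257, sieveModulus577]),
   (29423, 720, [sieveModulus31, sieveModulus7, sieveModulus181, sieveModulus631]),
   (29429, 28, [sieveModulus29]),
   (29989, 336, [sieveModulus449])]

def sieveBad (p : ℕ) : ℕ :=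
  bif !(Nat.gcd p 30030).beq 1 && Nat.ble 14 p then 0 else
  bif !(Nat.gcd p 166589903787325219380851695350896256250980509594874862046961683989710).beq 1 && Nat.ble 174 p then 0 else
  bif !((p % 11).beq 1 || (p % 11).beq 3 || (p % 11).beq 4 || (p % 11).beq 5 || (p % 11).beq 9) then 0 else
  bif (p % 8).beq 1 && Nat.ble 8512 p then 0 else
  bif (sieveTables.foldr (fun q C => periodicMask (q.entry p) q.o 192 &&& C)
    (residueMask p 192)).beq 0 then 0 else
  bif sieveCertificates.any (fun c => c.1.beq p) then 0 else 1

theorem sieveTables_check : sieveTables.all SieveTable.check = true := by decide +kernel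

theorem sieveCertificates_check :
    (sieveCertificates.all fun c => checkCertificate c.1 c.2.1 c.2.2) = true := by decide +kernel

theorem orRange_sieveBad : (orRange (fun i => sieveBad (2 * i + 1)) 16 6 14994).beq 0 = true := by decide +kernel

lemma Nat.beq_eq_false_of_ne {a b : ℕ} (h : a ≠ b) : a.beq b = false := by
  rw [← Bool.not_eq_true, Nat.beq_eq]; exact h

lemma forceNat_eq {α : Type} (x : ℕ) (f : ℕ → α) : forceNat x f = f x := by
  cases x <;> rfl

lemma testBit_orRange (f : ℕ → ℕ) {i j : ℕ} (h : (f i).testBit j = true) : ∀ d lo n : ℕ,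
    n ≤ 2 ^ d → lo ≤ i → i < lo + n → (orRange f d lo n).testBit j = true := by
  intro d
  induction d with
  | zero =>
    intro lo n hn hlo hi
    obtain rfl : i = lo := by simp at hn; omega
    exact h
  | succ d ih =>
    intro lo n hn hlo hi
    rw [pow_succ] at hn
    rw [orRange]
    rcases Nat.lt_or_ge n 2 with h2 | h2
    · obtain rfl : n = 1 := by omega
      obtain rfl : i = lo := by omega
      exact h
    · have h0 : n.beq 0 = false := Nat.beq_eq_false_of_ne (by omega)
      have h1 : n.beq 1 = false := Nat.beq_eq_false_of_ne (by omega)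
      rw [h0, h1, cond_false, cond_false, Nat.testBit_or, Bool.or_eq_true]
      rcases Nat.lt_or_ge i (lo + n / 2) with h3 | h3
      · exact Or.inl (ih _ _ (by omega) hlo h3)
      · exact Or.inr (ih _ _ (by omega) h3 (by omega))

lemma eq_zero_of_orRange_eq_zero {f : ℕ → ℕ} {i d lo n : ℕ} (h : orRange f d lo n = 0)
    (hn : n ≤ 2 ^ d) (hlo : lo ≤ i) (hi : i < lo + n) : f i = 0 := by
  apply Nat.eq_of_testBit_eq
  intro j
  rw [Nat.zero_testBit]
  by_contra h1
  have := testBit_orRange f (j := j) (by simpa using h1) d lo n hn hlo hi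
  rw [h, Nat.zero_testBit] at this
  exact Bool.false_ne_true this

lemma testBit_repeatMask {x o i : ℕ} : ∀ {d j : ℕ}, x.testBit j = true → i < 2 ^ d →
    (repeatMask x o d).testBit (j + o * i) = true := by
  intro d
  induction d generalizing i with
  | zero =>
    intro j hj hi
    obtain rfl : i = 0 := by simpa using hi
    exact hj
  | succ d ih =>
    intro j hj hi
    rw [repeatMask, forceNat_eq, Nat.testBit_or, Bool.or_eq_true]
    rcases Nat.lt_or_ge i (2 ^ d) with h3 | h3
    · exact Or.inl (ih hj h3)
    · right
      obtain ⟨i', rfl⟩ : ∃ i', i = 2 ^ d + i' := ⟨i - 2 ^ d, by omega⟩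
      have := ih hj (i := i') (by rw [pow_succ] at hi; omega)
      rw [Nat.testBit_shiftLeft, mul_add]
      have h4 : j + (o * 2 ^ d + o * i') - o * 2 ^ d = j + o * i' := by omega
      rw [h4, this]
      simp; omega

lemma testBit_periodicMask {x o M k : ℕ} (hM : M % o = 0) (hM0 : 0 < M)
    (h : x.testBit (k % o) = true) : (periodicMask x o M).testBit (k % M) = true := by
  rw [periodicMask, Nat.testBit_mod_two_pow]
  have h1 : k % M < M := Nat.mod_lt _ hM0
  have h2 : k % M % o = k % o := Nat.mod_mod_of_dvd _ (Nat.dvd_of_mod_eq_zero hM)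
  have h3 : k % M / o < 2 ^ ((M / o).log2 + 1) :=
    (Nat.div_le_div_right h1.le).trans_lt Nat.lt_log2_self
  have := testBit_repeatMask (o := o) h h3
  rw [← h2, Nat.mod_add_div] at this
  simp [h1, this]

abbrev SieveRing (r : ℕ) : Type := QuadraticAlgebra (ZMod r) (-11) 0

lemma zsqrtdPowImAux_spec {r : ℕ} [NeZero r] : ∀ (f e a b c d : ℕ), e < 2 ^ f →
    ((zsqrtdPowImAux r f e a b c d : ℕ) : ZMod r) =
      ((⟨a, b⟩ : SieveRing r) ^ e * ⟨c, d⟩).im := by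
  have h11 : ((11 * (r - 1) : ℕ) : ZMod r) = -11 := by
    rw [Nat.cast_mul, Nat.cast_sub NeZero.one_le]; simp
  intro f
  induction f with
  | zero => intro e a b c d he; obtain rfl : e = 0 := by simpa using he
            simp [zsqrtdPowImAux]
  | succ f ih =>
    intro e a b c d he
    rw [zsqrtdPowImAux]
    rcases Nat.eq_zero_or_pos e with rfl | h0
    · simp
    have h1 : e.beq 0 = false := Nat.beq_eq_false_of_ne (by omega)
    rw [h1, cond_false, ih _ _ _ _ _ (by rw [pow_succ] at he; omega)]
    have hsq : (⟨((a * a + 11 * (r - 1) * (b * b)) % r : ℕ), ((2 * a * b) % r : ℕ)⟩ : SieveRing r)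
        = ⟨a, b⟩ ^ 2 := by
      rw [pow_two]
      ext
      · rw [QuadraticAlgebra.re_mul, ZMod.natCast_mod, Nat.cast_add, Nat.cast_mul (11 * (r - 1)), h11]
        push_cast; ring
      · rw [QuadraticAlgebra.im_mul]; dsimp only; rw [ZMod.natCast_mod]; push_cast; ring
    rw [hsq, ← pow_mul]
    rcases Nat.even_or_odd e with h2 | h2
    · have h3 : (e % 2).beq 1 = false := Nat.beq_eq_false_of_ne (by rw [Nat.even_iff.1 h2]; omega)
      rw [h3, cond_false, cond_false, Nat.two_mul_div_two_of_even h2]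
    · have h3 : (e % 2).beq 1 = true := by rw [Nat.beq_eq]; exact Nat.odd_iff.1 h2
      rw [h3, cond_true, cond_true]
      have : (⟨((a * c + 11 * (r - 1) * (b * d)) % r : ℕ), ((a * d + b * c) % r : ℕ)⟩ : SieveRing r)
          = ⟨a, b⟩ * ⟨c, d⟩ := by
        ext
        · rw [QuadraticAlgebra.re_mul, ZMod.natCast_mod, Nat.cast_add, Nat.cast_mul (11 * (r - 1)), h11]
          push_cast; ring
        · rw [QuadraticAlgebra.im_mul]; dsimp only; rw [ZMod.natCast_mod]; push_cast; ring
      rw [this, ← mul_assoc, ← pow_succ]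
      congr 3
      have := Nat.odd_iff.1 h2; omega

lemma map_sq_eq_neg_eleven {r : ℕ} (s : ZMod r) (hs : s * s = -11) (z : SieveRing r) (e : ℕ) :
    (z ^ e).re + s * (z ^ e).im = (z.re + s * z.im) ^ e := by
  induction e with
  | zero => simp [pow_zero, QuadraticAlgebra.re_one, QuadraticAlgebra.im_one]
  | succ e ih =>
    rw [pow_succ, pow_succ, ← ih, QuadraticAlgebra.re_mul, QuadraticAlgebra.im_mul]
    linear_combination (-(z ^ e).im * z.im) * hs

lemma SieveModulus.valid_iff {q : SieveModulus} (h : q.valid = true) :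
    (q.s = 0 ∨ ((q.s * q.s + 11) % q.r = 0 ∧ q.s ≤ q.r)) ∧ 11 ^ q.o % q.r = 1 ∧
      (11 ^ (q.r - 2) % q.r * 11) % q.r = 1 ∧ 1 ≤ q.o ∧ q.r ≤ 65536 ∧ q.o ≤ 65536 := by
  simp only [SieveModulus.valid, Bool.and_eq_true, Bool.or_eq_true, Nat.beq_eq, Nat.ble_eq] at h
  obtain ⟨⟨⟨⟨⟨h1, h2⟩, h3⟩, h4⟩, h5⟩, h6⟩ := h
  exact ⟨h1, h2, h3, h4, h5, h6⟩

lemma powImMod_spec {q : SieveModulus} (hq : q.valid = true) [NeZero q.r] {e t : ℕ}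
    (he : e < 2 ^ 16) :
    ((powImMod q.r q.s e t : ℕ) : ZMod q.r) =
      ((bif q.s.beq 0 then 1 else 2 * q.s : ℕ) : ZMod q.r) * ((⟨t, 1⟩ : SieveRing q.r) ^ e).im := by
  obtain ⟨hs, -⟩ := SieveModulus.valid_iff hq
  rw [powImMod]
  rcases Nat.eq_zero_or_pos q.s with h0 | h0
  · rw [h0]
    change ((zsqrtdPowImAux q.r 16 e t 1 1 0 : ℕ) : ZMod q.r) = ((1 : ℕ) : ZMod q.r) * _
    have := zsqrtdPowImAux_spec (r := q.r) 16 e t 1 1 0 he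
    have h1 : (⟨((1 : ℕ) : ZMod q.r), ((0 : ℕ) : ZMod q.r)⟩ : SieveRing q.r) = 1 := by
      ext <;> simp [QuadraticAlgebra.re_one, QuadraticAlgebra.im_one]
    rw [this, h1, mul_one]
    simp
  · obtain ⟨hs1, hs2⟩ := hs.resolve_left h0.ne'
    rw [Nat.beq_eq_false_of_ne h0.ne', cond_false, cond_false, ZMod.natCast_mod]
    have hss : (q.s : ZMod q.r) * q.s = -11 := by
      have : ((q.s * q.s + 11 : ℕ) : ZMod q.r) = 0 := by
        rw [ZMod.natCast_eq_zero_iff]; exact Nat.dvd_of_mod_eq_zero hs1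
      push_cast at this
      linear_combination this
    have e1 := map_sq_eq_neg_eleven (q.s : ZMod q.r) hss ⟨t, 1⟩ e
    have e2 := map_sq_eq_neg_eleven (-q.s : ZMod q.r) (by rw [neg_mul_neg, hss]) ⟨t, 1⟩ e
    have h3 : (t + (q.r - q.s)) ^ e % q.r ≤ (t + q.s) ^ e + q.r :=
      (Nat.mod_lt _ (NeZero.pos _)).le.trans (Nat.le_add_left _ _)
    rw [Nat.cast_sub h3, ZMod.natCast_mod]
    push_cast [Nat.cast_sub hs2]
    simp only [CharP.cast_eq_zero, zero_sub, add_zero, mul_one] at e1 e2 ⊢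
    linear_combination e2 - e1

lemma zsqrtdPowImAux_lt {r : ℕ} (hr : 0 < r) : ∀ (f e a b c d : ℕ), d < r →
    zsqrtdPowImAux r f e a b c d < r := by
  intro f
  induction f with
  | zero => intro e a b c d hd; exact hd
  | succ f ih =>
    intro e a b c d hd
    rw [zsqrtdPowImAux]
    cases e.beq 0
    · rw [cond_false]
      apply ih
      cases (e % 2).beq 1
      · exact hd
      · exact Nat.mod_lt _ hr
    · exact hd

lemma powImMod_lt {r s e t : ℕ} (hr : 0 < r) : powImMod r s e t < r := by
  rw [powImMod]
  cases s.beq 0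
  · exact Nat.mod_lt _ hr
  · exact zsqrtdPowImAux_lt hr _ _ _ _ _ _ hr

lemma im_neg_mk_pow {r : ℕ} (t : ZMod r) {e : ℕ} (he : Odd e) :
    ((⟨-t, 1⟩ : SieveRing r) ^ e).im = ((⟨t, 1⟩ : SieveRing r) ^ e).im := by
  have key : ∀ e : ℕ, ((⟨-t, 1⟩ : SieveRing r) ^ e).re = (-1) ^ e * ((⟨t, 1⟩ : SieveRing r) ^ e).re
      ∧ ((⟨-t, 1⟩ : SieveRing r) ^ e).im = (-1) ^ (e + 1) * ((⟨t, 1⟩ : SieveRing r) ^ e).im := by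
    intro e
    induction e with
    | zero => simp [QuadraticAlgebra.re_one, QuadraticAlgebra.im_one]
    | succ e ih =>
      rw [pow_succ, pow_succ (⟨t, 1⟩ : SieveRing r)]
      simp only [QuadraticAlgebra.re_mul, QuadraticAlgebra.im_mul, ih.1, ih.2]
      constructor <;> ring
  rw [(key e).2, (he.add_one).neg_one_pow, one_mul]

lemma testBit_one_shiftLeft_self (n : ℕ) : (1 <<< n).testBit n = true := by
  simp [Nat.testBit_shiftLeft]

lemma testBit_exponentMask {q : SieveModulus} (hq : q.valid = true) [NeZero q.r] {e k : ℕ}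
    (he : Odd e) (he' : e < 2 ^ 16) (t : ZMod q.r)
    (h : ((⟨t, 1⟩ : SieveRing q.r) ^ e).im * (11 ^ (e - 1)) ^ k = 1) :
    (exponentMask q.r q.s e q.o).testBit (k % q.o) = true := by
  obtain ⟨hs, ho, hi, ho1, hr, hoo⟩ := SieveModulus.valid_iff hq
  have hr0 : 0 < q.r := NeZero.pos _
  obtain ⟨n, hn, hnt⟩ : ∃ n : ℕ, n < q.r / 2 + 1 ∧ ((n : ZMod q.r) = t ∨ (n : ZMod q.r) = -t) := by
    have hv := ZMod.val_lt t
    have hc := ZMod.natCast_zmod_val t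
    rcases Nat.lt_or_ge t.val (q.r / 2 + 1) with h1 | h1
    · exact ⟨t.val, h1, Or.inl hc⟩
    · refine ⟨q.r - t.val, by omega, Or.inr ?_⟩
      rw [Nat.cast_sub hv.le, hc]; simp
  have him : ((⟨n, 1⟩ : SieveRing q.r) ^ e).im = ((⟨t, 1⟩ : SieveRing q.r) ^ e).im := by
    rcases hnt with h1 | h1
    · rw [h1]
    · rw [h1, im_neg_mk_pow t he]
  rw [exponentMask, forceNat_eq, forceNat_eq, forceNat_eq]
  have hY := testBit_orRange (fun t => 1 <<< powImMod q.r q.s e t) (i := n)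
    (testBit_one_shiftLeft_self _) 16 0 (q.r / 2 + 1) (by omega) (Nat.zero_le _) (by omega)
  set Y := orRange (fun t => 1 <<< powImMod q.r q.s e t) 16 0 (q.r / 2 + 1)
  set c := (bif q.s.beq 0 then 1 else 2 * q.s) with hc
  set g := (11 ^ (q.r - 2) % q.r) ^ (e - 1) % q.r with hg
  have hidx : c * g ^ (k % q.o) % q.r = powImMod q.r q.s e n := by
    rw [← Nat.mod_eq_of_lt (powImMod_lt (s := q.s) (e := e) (t := n) hr0)]
    rw [← ZMod.natCast_eq_natCast_iff', powImMod_spec hq he', him, ← hc, Nat.cast_mul]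
    congr 1
    have hi' : ((11 ^ (q.r - 2) % q.r : ℕ) : ZMod q.r) * 11 = 1 := by
      have : ((11 ^ (q.r - 2) % q.r * 11 : ℕ) : ZMod q.r) = ((1 : ℕ) : ZMod q.r) := by
        rw [← ZMod.natCast_mod, hi]
      rw [Nat.cast_mul] at this
      exact_mod_cast this
    have ho' : (11 : ZMod q.r) ^ q.o = 1 := by
      have : ((11 ^ q.o : ℕ) : ZMod q.r) = ((1 : ℕ) : ZMod q.r) := by
        rw [← ZMod.natCast_mod, ho]
      exact_mod_cast this
    have hG : (g : ZMod q.r) * 11 ^ (e - 1) = 1 := by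
      rw [hg, ZMod.natCast_mod, Nat.cast_pow, ← mul_pow, hi', one_pow]
    have hGo : (g : ZMod q.r) ^ q.o = 1 := by
      have h1 : ((g : ZMod q.r) * 11 ^ (e - 1)) ^ q.o = 1 := by rw [hG, one_pow]
      rwa [mul_pow, ← pow_mul, mul_comm (e - 1), pow_mul 11, ho', one_pow, mul_one] at h1
    have hGk : (g : ZMod q.r) ^ (k % q.o) = (g : ZMod q.r) ^ k := by
      conv_rhs => rw [← Nat.mod_add_div k q.o, pow_add, pow_mul, hGo, one_pow, mul_one]
    have hGk' : (g : ZMod q.r) ^ k * (11 ^ (e - 1)) ^ k = 1 := by rw [← mul_pow, hG, one_pow]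
    rw [Nat.cast_pow, hGk]
    calc (g : ZMod q.r) ^ k = (g : ZMod q.r) ^ k * (((⟨t, 1⟩ : SieveRing q.r) ^ e).im * (11 ^ (e - 1)) ^ k) := by
          rw [h, mul_one]
      _ = ((g : ZMod q.r) ^ k * (11 ^ (e - 1)) ^ k) * ((⟨t, 1⟩ : SieveRing q.r) ^ e).im := by ring
      _ = _ := by rw [hGk', one_mul]
  refine testBit_orRange _ (i := k % q.o) ?_ 16 0 q.o (by omega) (Nat.zero_le _)
    (by rw [zero_add]; exact Nat.mod_lt _ (by omega))
  rw [hidx]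
  have : (Y >>> powImMod q.r q.s e n) % 2 = 1 := by
    rw [Nat.testBit_eq_decide_div_mod_eq] at hY
    rw [Nat.shiftRight_eq_div_pow]; simpa using hY
  rw [this]
  exact testBit_one_shiftLeft_self _

lemma exists_sieveRing_pow_im {r : ℕ} [NeZero r] (u : ZMod r) (hu : u * 11 = 1) {a : ℤ} {k e : ℕ}
    (he : 1 ≤ e) (h : ((⟨a, 11 ^ k⟩ : ℤ√(-11)) ^ e).im = 11 ^ k) :
    ∃ t : ZMod r, ((⟨t, 1⟩ : SieveRing r) ^ e).im * (11 ^ (e - 1)) ^ k = 1 := by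
  refine ⟨a * u ^ k, ?_⟩
  have hcast : ∀ (A : ℤ√(-11)) (n : ℕ), (⟨A.re, A.im⟩ : SieveRing r) ^ n =
      ⟨((A ^ n).re : ℤ), ((A ^ n).im : ℤ)⟩ := by
    intro A n
    induction n with
    | zero => ext <;> simp [QuadraticAlgebra.re_one, QuadraticAlgebra.im_one]
    | succ n ih =>
      rw [pow_succ, ih, pow_succ]
      ext
      · rw [QuadraticAlgebra.re_mul, Zsqrtd.re_mul]; push_cast; ring
      · rw [QuadraticAlgebra.im_mul, Zsqrtd.im_mul]; push_cast; ring
  have h1 := congrArg QuadraticAlgebra.im (hcast ⟨a, 11 ^ k⟩ e)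
  rw [h] at h1
  have huk : u ^ k * 11 ^ k = 1 := by rw [← mul_pow, hu, one_pow]
  have h2 : (⟨((a : ℤ) : ZMod r), ((11 ^ k : ℤ) : ZMod r)⟩ : SieveRing r) =
      algebraMap (ZMod r) _ (11 ^ k) * ⟨a * u ^ k, 1⟩ := by
    ext
    · simp only [QuadraticAlgebra.re_mul, QuadraticAlgebra.algebraMap_re,
        QuadraticAlgebra.algebraMap_im]
      linear_combination (-(a : ZMod r)) * huk
    · simp only [QuadraticAlgebra.im_mul, QuadraticAlgebra.algebraMap_re,
        QuadraticAlgebra.algebraMap_im]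
      push_cast; ring
  dsimp only at h1
  rw [h2, mul_pow, ← map_pow] at h1
  simp only [QuadraticAlgebra.im_mul, QuadraticAlgebra.algebraMap_re,
        QuadraticAlgebra.algebraMap_im] at h1
  obtain ⟨m, rfl⟩ : ∃ m, e = m + 1 := ⟨e - 1, by omega⟩
  push_cast at h1
  rw [Nat.add_sub_cancel]
  linear_combination u ^ k * h1 + (1 - ((⟨a * u ^ k, 1⟩ : SieveRing r) ^ (m + 1)).im *
    (11 ^ m) ^ k) * huk

instance sieveRing_charP (r : ℕ) [Fact r.Prime] : CharP (SieveRing r) r :=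
  charP_of_injective_algebraMap (R := ZMod r) QuadraticAlgebra.algebraMap_injective r

lemma mk_pow_char {r : ℕ} [hr : Fact r.Prime] (hr2 : r ≠ 2) (t u : ZMod r) :
    (⟨t, u⟩ : SieveRing r) ^ r = ⟨t, (-11) ^ (r / 2) * u⟩ := by
  have h1 : (⟨t, u⟩ : SieveRing r) = ⟨t, 0⟩ + ⟨0, u⟩ := by ext <;> simp
  have h2 : ∀ n : ℕ, (⟨t, 0⟩ : SieveRing r) ^ n = ⟨t ^ n, 0⟩ := by
    intro n
    rw [← QuadraticAlgebra.algebraMap_eq, ← map_pow, QuadraticAlgebra.algebraMap_eq]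
  have h3 : ∀ n : ℕ, (⟨0, u⟩ : SieveRing r) ^ (2 * n + 1) = ⟨0, (-11) ^ n * u ^ (2 * n + 1)⟩ := by
    intro n
    induction n with
    | zero => ext <;> simp
    | succ n ih =>
      rw [show 2 * (n + 1) + 1 = 2 * n + 1 + 1 + 1 by ring, pow_succ, pow_succ, ih]
      ext
      · simp only [QuadraticAlgebra.re_mul, QuadraticAlgebra.im_mul]; ring
      · simp only [QuadraticAlgebra.re_mul, QuadraticAlgebra.im_mul]; ring
  obtain ⟨n, hn⟩ := hr.out.odd_of_ne_two hr2
  have hn' : r / 2 = n := by omega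
  have h4 := h3 n
  rw [← hn, ZMod.pow_card, ← hn'] at h4
  rw [h1, add_pow_char, h2, h4, ZMod.pow_card]
  ext <;> simp

lemma mk_pow_char_sq {r : ℕ} [hr : Fact r.Prime] (hr2 : r ≠ 2) (h11 : (-11 : ZMod r) ≠ 0)
    (t u : ZMod r) : (⟨t, u⟩ : SieveRing r) ^ r ^ 2 = ⟨t, u⟩ := by
  rw [pow_two, pow_mul, mk_pow_char hr2, mk_pow_char hr2, ← mul_assoc, ← pow_add]
  obtain ⟨n, hn⟩ := hr.out.odd_of_ne_two hr2
  rw [show r / 2 + r / 2 = r - 1 by omega, ZMod.pow_card_sub_one_eq_one h11, one_mul]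

lemma mk_pow_char_of_sq {r : ℕ} [hr : Fact r.Prime] (hr2 : r ≠ 2) (h11 : (-11 : ZMod r) ≠ 0)
    {s : ZMod r} (hs : s * s = -11) (t u : ZMod r) : (⟨t, u⟩ : SieveRing r) ^ r = ⟨t, u⟩ := by
  obtain ⟨n, hn⟩ := hr.out.odd_of_ne_two hr2
  have hs0 : s ≠ 0 := by rintro rfl; exact h11 (by rw [← hs, zero_mul])
  rw [mk_pow_char hr2, ← hs, ← pow_two, ← pow_mul, show 2 * (r / 2) = r - 1 by omega,
    ZMod.pow_card_sub_one_eq_one hs0, one_mul]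

lemma pow_eq_pow_mod_of_pow_succ_eq {M : Type*} [Monoid M] {z : M} {P : ℕ} (hz : z ^ (P + 1) = z)
    (n : ℕ) (hn : 1 ≤ n % P) : z ^ n = z ^ (n % P) := by
  have key : ∀ m : ℕ, z ^ (n % P + P * m) = z ^ (n % P) := by
    intro m
    induction m with
    | zero => simp
    | succ m ih =>
      obtain ⟨e, he⟩ : ∃ e, n % P = e + 1 := ⟨n % P - 1, by omega⟩
      rw [he] at ih ⊢
      rw [show e + 1 + P * (m + 1) = e + P * m + (P + 1) by ring, pow_add, hz, ← pow_succ,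
        show e + P * m + 1 = e + 1 + P * m by ring, ih]
  conv_lhs => rw [← Nat.mod_add_div n P]
  exact key _

lemma SieveTable.testBit_entry {q : SieveTable} (hq : q.check = true) [NeZero q.r]
    (hper : ∀ t : ZMod q.r, (⟨t, 1⟩ : SieveRing q.r) ^ (q.P + 1) = ⟨t, 1⟩) (hP : Even q.P)
    (hPb : 2 ≤ q.P ∧ q.P < 2 ^ 16)
    {p k : ℕ} (hp : p.Coprime q.P) (t : ZMod q.r)
    (h : ((⟨t, 1⟩ : SieveRing q.r) ^ p).im * (11 ^ (p - 1)) ^ k = 1) :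
    (q.entry p).testBit (k % q.o) = true := by
  simp only [SieveTable.check, Bool.and_eq_true, Nat.beq_eq] at hq
  obtain ⟨⟨hv, h11⟩, hch⟩ := hq
  have hodd : Odd (p % q.P) := by
    have h2 : p.Coprime 2 := hp.coprime_dvd_right hP.two_dvd
    rw [Nat.coprime_two_right] at h2
    obtain ⟨w, hw⟩ := hP
    rw [Nat.odd_iff] at h2 ⊢
    rw [Nat.mod_mod_of_dvd _ ⟨w, by omega⟩, h2]
  obtain ⟨i, hi⟩ := hodd
  have hlt : p % q.P < q.P := Nat.mod_lt _ (by omega)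
  have hgcd : Nat.gcd (2 * i + 1) q.P = 1 := by
    rw [← hi, ← Nat.gcd_rec, Nat.gcd_comm]; exact hp
  have h1 := eq_zero_of_orRange_eq_zero hch (i := i) (by omega) (Nat.zero_le _) (by omega)
  rw [hgcd] at h1
  change _ ^^^ _ = 0 at h1
  rw [Nat.xor_eq_zero_iff, ← hi] at h1
  have h2 : q.entry (p % q.P) = q.entry p := by rw [SieveTable.entry, Nat.mod_mod, SieveTable.entry]
  rw [← h2, ← h1]
  refine testBit_exponentMask hv ⟨i, hi⟩ (by omega) t ?_
  have hdiv := Nat.mod_add_div p q.P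
  have h11' : (11 : ZMod q.r) ^ q.P = 1 := by
    have : ((11 ^ q.P : ℕ) : ZMod q.r) = ((1 : ℕ) : ZMod q.r) := by
      rw [← ZMod.natCast_mod, h11]
    exact_mod_cast this
  have hexp : (11 : ZMod q.r) ^ (p - 1) = 11 ^ (p % q.P - 1) := by
    rw [show p - 1 = p % q.P - 1 + q.P * (p / q.P) by omega, pow_add, pow_mul, h11', one_pow,
      mul_one]
  rwa [← pow_eq_pow_mod_of_pow_succ_eq (hper t) p (by omega), ← hexp]

def SieveTable.periodic (q : SieveTable) : Prop :=
  q.r.Prime ∧ q.r ≠ 2 ∧ ¬ q.r ∣ 11 ∧ Even q.P ∧ (2 ≤ q.P ∧ q.P < 2 ^ 16) ∧ q.P ∣ 5040 * 2 ^ 16 ∧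
    (q.P + 1 = q.r ^ 2 ∨ q.P + 1 = q.r ∧ q.r ∣ q.s * q.s + 11)

lemma sieveTables_periodic : ∀ q ∈ sieveTables, q.periodic := by
  simp only [sieveTables, List.forall_mem_cons, SieveTable.periodic]
  refine ⟨?_, ?_, ?_, ?_, ?_, ?_, by simp⟩ <;> norm_num

lemma testBit_entry_of_mem {q : SieveTable} (hq : q ∈ sieveTables) {p k : ℕ}
    (hp : p.Coprime 210) {a : ℤ} (h : ((⟨a, 11 ^ k⟩ : ℤ√(-11)) ^ p).im = 11 ^ k) :
    (q.entry p).testBit (k % q.o) = true := by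
  have hch := List.all_eq_true.1 sieveTables_check q hq
  obtain ⟨hr, hr2, hr11, hPe, hPb, hPd, hor⟩ := sieveTables_periodic q hq
  have : Fact q.r.Prime := ⟨hr⟩
  have h11 : (-11 : ZMod q.r) ≠ 0 := by
    rw [neg_ne_zero]
    intro h0
    exact hr11 ((ZMod.natCast_eq_zero_iff 11 q.r).1 (by exact_mod_cast h0))
  have hper : ∀ t : ZMod q.r, (⟨t, 1⟩ : SieveRing q.r) ^ (q.P + 1) = ⟨t, 1⟩ := by
    intro t
    rcases hor with h1 | ⟨h1, h2⟩
    · rw [h1, mk_pow_char_sq hr2 h11]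
    · rw [h1, mk_pow_char_of_sq hr2 h11 (s := q.s)]
      have := (ZMod.natCast_eq_zero_iff _ _).2 h2
      push_cast at this
      linear_combination this
  have hcop : p.Coprime q.P := by
    refine Nat.Coprime.coprime_dvd_right hPd ?_
    have h2 : p.Coprime 2 := hp.coprime_dvd_right (by norm_num)
    refine Nat.Coprime.mul_right ?_ (h2.pow_right _)
    exact (Nat.Coprime.coprime_dvd_right (by norm_num : 5040 ∣ 210 ^ 4) (hp.pow_right 4))
  have hp1 : 1 ≤ p := by
    rcases Nat.eq_zero_or_pos p with rfl | h0
    · norm_num at hp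
    · exact h0
  obtain ⟨t, ht⟩ := exists_sieveRing_pow_im (r := q.r) (11⁻¹) (inv_mul_cancel₀ (by
    rwa [neg_ne_zero] at h11)) hp1 h
  exact SieveTable.testBit_entry hch hper hPe hPb hcop t ht

lemma testBit_residueMask {p k M : ℕ} (hp : Odd p) (hM : M % 4 = 0) (hM0 : 0 < M)
    (h5 : p % 5 = 1 → k = 0)
    (hk : (p % 8 = 1 → k % 4 = 3) ∧ (p % 8 = 5 → k % 4 = 1) ∧ (p % 8 = 3 → k % 4 = 0) ∧
      (p % 8 = 7 → k % 4 = 2)) : (residueMask p M).testBit (k % M) = true := by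
  obtain ⟨h1, h2, h3, h4⟩ := hk
  rw [Nat.odd_iff] at hp
  have h8 : p % 8 = 1 ∨ p % 8 = 3 ∨ p % 8 = 5 ∨ p % 8 = 7 := by omega
  rw [residueMask]
  by_cases h5' : p % 5 = 1
  · obtain rfl := h5 h5'
    have h8' : p % 8 = 3 := by omega
    simp [h5', h8']
  · rw [Nat.beq_eq_false_of_ne h5', cond_false]
    refine testBit_periodicMask hM hM0 ?_
    rcases h8 with h | h | h | h
    · rw [h, h1 h]; decide
    · rw [h, h3 h]; decide
    · rw [h, h2 h]; decide
    · rw [h, h4 h]; decide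

lemma testBit_foldr_and {α : Type*} (f : α → ℕ) (C n : ℕ) (l : List α)
    (hC : C.testBit n = true) (h : ∀ q ∈ l, (f q).testBit n = true) :
    (l.foldr (fun q D => f q &&& D) C).testBit n = true := by
  induction l with
  | nil => exact hC
  | cons q l ih =>
    rw [List.foldr_cons, Nat.testBit_and, h q (by simp),
      ih fun q hq => h q (List.mem_cons_of_mem _ hq)]
    rfl

lemma sieveTables_dvd : (sieveTables.all fun q => (192 % q.o).beq 0 && Nat.ble 1 q.o) = true := by
  decide +kernel

lemma sieveCertificates_pos : (sieveCertificates.all fun c => Nat.ble 1 c.2.1) = true := by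
  decide +kernel

lemma coprime_of_prime_of_lt {p N B : ℕ} (hp : p.Prime) (hB : B ≤ p)
    (hN : ∀ q : ℕ, q.Prime → q ∣ N → q < B) : p.Coprime N := by
  rw [hp.coprime_iff_not_dvd]
  intro h
  have := hN p hp h
  omega

lemma sieve_aux {p k : ℕ} (hp : p.Prime) (hp13 : 13 ≤ p)
    (hp3 : p < 30000) (h11 : p % 11 = 1 ∨ p % 11 = 3 ∨ p % 11 = 4 ∨ p % 11 = 5 ∨ p % 11 = 9)
    (h5 : p % 5 = 1 → k = 0) (h8 : p % 8 = 1 → p < 8512)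
    (hk : (p % 8 = 1 → k % 4 = 3) ∧ (p % 8 = 5 → k % 4 = 1) ∧ (p % 8 = 3 → k % 4 = 0) ∧
      (p % 8 = 7 → k % 4 = 2)) {a : ℤ} : ((⟨a, 11 ^ k⟩ : ℤ√(-11)) ^ p).im ≠ 11 ^ k := by
  intro him
  obtain ⟨i, hi⟩ : Odd p := hp.odd_of_ne_two (by omega)
  have hodd : Odd p := ⟨i, hi⟩
  have h0 := eq_zero_of_orRange_eq_zero (Nat.eq_of_beq_eq_true orRange_sieveBad) (i := i) (by norm_num) (by omega) (by omega)
  rw [← hi] at h0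
  have hpow : p.Coprime 210 := by
    rw [Nat.coprime_comm]
    refine Nat.Coprime.symm (coprime_of_prime_of_lt hp hp13 ?_)
    intro q hq hqd
    have : q ∣ 2 * 3 * 5 * 7 := hqd
    rw [hq.dvd_mul, hq.dvd_mul, hq.dvd_mul] at this
    rcases this with ((h | h) | h) | h <;> have := Nat.le_of_dvd (by norm_num) h <;> omega
  have hg1 : (!(Nat.gcd p 30030).beq 1 && Nat.ble 14 p) = false := by
    rw [Bool.and_eq_false_iff]
    by_cases h : 14 ≤ p
    · left
      have : p.Coprime 30030 := by
        refine coprime_of_prime_of_lt hp h ?_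
        intro q hq hqd
        have : q ∣ 2 * 3 * 5 * 7 * 11 * 13 := hqd
        simp only [hq.dvd_mul] at this
        rcases this with ((((h | h) | h) | h) | h) | h <;>
          have := Nat.le_of_dvd (by norm_num) h <;> omega
      rw [Nat.Coprime] at this
      rw [this]; rfl
    · right
      rw [← Bool.not_eq_true, Nat.ble_eq]; exact h
  have hg2 : (!(Nat.gcd p 166589903787325219380851695350896256250980509594874862046961683989710).beq 1
      && Nat.ble 174 p) = false := by
    rw [Bool.and_eq_false_iff]
    by_cases h : 174 ≤ p
    · left
      have : p.Coprime 166589903787325219380851695350896256250980509594874862046961683989710 := by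
        refine coprime_of_prime_of_lt hp h ?_
        intro q hq hqd
        have h1 : (166589903787325219380851695350896256250980509594874862046961683989710 : ℕ) =
          primorial 173 := by decide +kernel
        rw [h1, primorial] at hqd
        obtain ⟨q', hq', hd⟩ := (hq.prime.dvd_finsetProd_iff _).1 hqd
        rw [Finset.mem_filter, Finset.mem_range] at hq'
        have := (Nat.prime_dvd_prime_iff_eq hq hq'.2).1 hd
        omega
      rw [Nat.Coprime] at this
      rw [this]; rfl
    · right
      rw [← Bool.not_eq_true, Nat.ble_eq]; exact h
  have hg3 : (!((p % 11).beq 1 || (p % 11).beq 3 || (p % 11).beq 4 || (p % 11).beq 5 ||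
      (p % 11).beq 9)) = false := by
    rcases h11 with h | h | h | h | h <;> rw [h] <;> rfl
  have hg4 : ((p % 8).beq 1 && Nat.ble 8512 p) = false := by
    rw [Bool.and_eq_false_iff]
    by_cases h : p % 8 = 1
    · right
      rw [← Bool.not_eq_true, Nat.ble_eq]; have := h8 h; omega
    · left
      exact Nat.beq_eq_false_of_ne h
  have hg5 : (sieveTables.foldr (fun q C => periodicMask (q.entry p) q.o 192 &&& C)
      (residueMask p 192)).beq 0 = false := by
    refine Nat.beq_eq_false_of_ne fun h => ?_
    have := testBit_foldr_and (fun q : SieveTable => periodicMask (q.entry p) q.o 192)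
      (residueMask p 192) (k % 192) sieveTables
      (testBit_residueMask hodd (by norm_num) (by norm_num) h5 hk) ?_
    · rw [h, Nat.zero_testBit] at this
      exact Bool.false_ne_true this
    · intro q hq
      have h1 := List.all_eq_true.1 sieveTables_dvd q hq
      rw [Bool.and_eq_true, Nat.beq_eq, Nat.ble_eq] at h1
      exact testBit_periodicMask h1.1 (by norm_num) (testBit_entry_of_mem hq hpow him)
  have hg6 : sieveCertificates.any (fun c => c.1.beq p) = false := by
    rw [← Bool.not_eq_true, List.any_eq_true]
    rintro ⟨⟨p', M, l⟩, hc, hcp⟩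
    rw [Nat.beq_eq] at hcp
    dsimp only at hcp
    subst hcp
    have h1 := List.all_eq_true.1 sieveCertificates_check _ hc
    have h2 := List.all_eq_true.1 sieveCertificates_pos _ hc
    rw [Nat.ble_eq] at h2
    dsimp only at h1 h2
    rw [checkCertificate, Bool.and_eq_true, Bool.and_eq_true, Nat.beq_eq, Nat.beq_eq] at h1
    obtain ⟨⟨hl, hM4⟩, hz⟩ := h1
    have := testBit_foldr_and
      (fun q : SieveModulus => periodicMask (exponentMask q.r q.s p' q.o) q.o M)
      (residueMask p' M) (k % M) l (testBit_residueMask hodd hM4 h2 h5 hk) ?_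
    · rw [hz, Nat.zero_testBit] at this
      exact Bool.false_ne_true this
    · intro q hq
      have h3 := List.all_eq_true.1 hl q hq
      rw [Bool.and_eq_true, Nat.beq_eq] at h3
      obtain ⟨hv, hMo⟩ := h3
      obtain ⟨-, hro, hinv, ho1, -, -⟩ := SieveModulus.valid_iff hv
      have : NeZero q.r := by
        refine ⟨fun h0 => ?_⟩
        rw [h0, Nat.mod_zero] at hro
        have := Nat.one_lt_pow (by omega : q.o ≠ 0) (by norm_num : 1 < 11)
        omega
      refine testBit_periodicMask hMo h2 ?_
      obtain ⟨t, ht⟩ := exists_sieveRing_pow_im (r := q.r) ((11 ^ (q.r - 2) : ℕ) : ZMod q.r) (by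
        have h4 : ((11 ^ (q.r - 2) % q.r * 11 : ℕ) : ZMod q.r) = ((1 : ℕ) : ZMod q.r) := by
          rw [← ZMod.natCast_mod, hinv]
        rw [Nat.cast_mul, ZMod.natCast_mod] at h4
        exact_mod_cast h4) (by omega) him
      exact testBit_exponentMask hv hodd (by omega) t ht
  rw [sieveBad, hg1, hg2, hg3, hg4, hg5, hg6] at h0
  exact absurd h0 (by decide)

lemma zsqrtd_pow_cast {r : ℕ} (A : ℤ√(-11)) (n : ℕ) : (⟨A.re, A.im⟩ : SieveRing r) ^ n =
    ⟨((A ^ n).re : ℤ), ((A ^ n).im : ℤ)⟩ := by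
  induction n with
  | zero => ext <;> simp [QuadraticAlgebra.re_one, QuadraticAlgebra.im_one]
  | succ n ih =>
    rw [pow_succ, ih, pow_succ]
    ext
    · rw [QuadraticAlgebra.re_mul, Zsqrtd.re_mul]; push_cast; ring
    · rw [QuadraticAlgebra.im_mul, Zsqrtd.im_mul]; push_cast; ring

lemma zsqrtdPowImAux_mod {r o : ℕ} [NeZero r] (ho : 11 ^ o % r = 1 % r) {a : ℤ} {k e : ℕ}
    (he : e < 2 ^ 16) (h : (r : ℤ) ∣ ((⟨a, 11 ^ k⟩ : ℤ√(-11)) ^ e).im - 11 ^ k) :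
    ∃ t < r, (t : ℤ) = a % r ∧
      zsqrtdPowImAux r 16 e t (11 ^ (k % o) % r) 1 0 % r = 11 ^ (k % o) % r := by
  have hr : (r : ℤ) ≠ 0 := by exact_mod_cast NeZero.ne r
  obtain ⟨t, ht⟩ := Int.eq_ofNat_of_zero_le (Int.emod_nonneg a hr)
  have htr : t < r := by
    have := Int.emod_lt_of_pos a (by positivity : (0 : ℤ) < r)
    omega
  have h11 : (11 : ZMod r) ^ k = 11 ^ (k % o) := by
    have h1 : (11 : ZMod r) ^ o = 1 := by
      have : ((11 ^ o : ℕ) : ZMod r) = ((1 : ℕ) : ZMod r) := by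
        rw [← ZMod.natCast_mod, ho, ZMod.natCast_mod]
      exact_mod_cast this
    conv_lhs => rw [← Nat.mod_add_div k o, pow_add, pow_mul, h1, one_pow, mul_one]
  have hta : (t : ZMod r) = (a : ZMod r) := by
    have : ((t : ℤ) : ZMod r) = ((a % r : ℤ) : ZMod r) := by rw [ht]
    rw [Int.cast_natCast] at this
    rw [this, ZMod.intCast_mod]
  refine ⟨t, htr, ht.symm, ?_⟩
  have h2 := zsqrtdPowImAux_spec (r := r) 16 e t (11 ^ (k % o) % r) 1 0 he
  have h3 : (⟨((1 : ℕ) : ZMod r), ((0 : ℕ) : ZMod r)⟩ : SieveRing r) = 1 := by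
    ext <;> simp [QuadraticAlgebra.re_one, QuadraticAlgebra.im_one]
  rw [h3, mul_one, hta, ZMod.natCast_mod] at h2
  push_cast at h2
  rw [← h11] at h2
  have h4 := zsqrtd_pow_cast (r := r) (⟨a, 11 ^ k⟩ : ℤ√(-11)) e
  push_cast at h4
  rw [h4] at h2
  have h5 : ((((⟨a, 11 ^ k⟩ : ℤ√(-11)) ^ e).im - 11 ^ k : ℤ) : ZMod r) = 0 :=
    (ZMod.intCast_zmod_eq_zero_iff_dvd _ _).2 h
  push_cast at h5
  have h6 : ((zsqrtdPowImAux r 16 e t (11 ^ (k % o) % r) 1 0 : ℕ) : ZMod r) =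
      ((11 ^ (k % o) : ℕ) : ZMod r) := by
    rw [h2]; push_cast; rw [← h11]; linear_combination h5
  exact (ZMod.natCast_eq_natCast_iff' _ _ _).1 h6

lemma pow_eight_eq {a b : ℤ} (ha : Even a) (hb : Odd b) :
    ∃ z : ℤ√(-11), (⟨a, b⟩ : ℤ√(-11)) ^ 8 = 1 + 16 * z := by
  obtain ⟨c, rfl⟩ := ha.two_dvd
  obtain ⟨d, rfl⟩ := hb
  have h2 : ∃ z : ℤ√(-11), (⟨2 * c, 2 * d + 1⟩ : ℤ√(-11)) ^ 2 = 1 + 4 * z := by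
    refine ⟨⟨c ^ 2 - 11 * d ^ 2 - 11 * d - 3, c * (2 * d + 1)⟩, ?_⟩
    rw [pow_two, Zsqrtd.ext_iff]
    constructor
    · simp; ring
    · simp; ring
  obtain ⟨z, hz⟩ := h2
  refine ⟨z + 6 * z ^ 2 + 16 * z ^ 3 + 16 * z ^ 4, ?_⟩
  rw [show 8 = 2 * 4 by rfl, pow_mul, hz]
  ring

lemma one_add_sixteen_mul_pow (z : ℤ√(-11)) (s g : ℕ) :
    ∃ w, (1 + 16 * z) ^ (2 ^ s * g) = 1 + 2 ^ s * 16 * (g * z + 8 * w) := by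
  induction s with
  | zero =>
    induction g with
    | zero => exact ⟨0, by simp⟩
    | succ g ih =>
      obtain ⟨w, hw⟩ := ih
      refine ⟨w + 2 * z * (g * z + 8 * w), ?_⟩
      rw [pow_zero, one_mul] at hw ⊢
      rw [pow_succ, hw]
      push_cast
      ring
  | succ s ih =>
    obtain ⟨w, hw⟩ := ih
    refine ⟨w + 2 ^ s * (g * z + 8 * w) ^ 2, ?_⟩
    rw [pow_succ, mul_right_comm, pow_mul, hw]
    ring

lemma im_intCast_mul (n : ℤ) (z : ℤ√(-11)) : ((n : ℤ√(-11)) * z).im = n * z.im := by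
  simp

lemma dvd_im_pow_nine {a b : ℤ} (ha : Even a) (hb : Odd b) {m : ℕ} (hm : m ≠ 0)
    (h : ((⟨a, b⟩ : ℤ√(-11)) ^ (8 * m + 1)).im = b) :
    (128 : ℤ) ∣ ((⟨a, b⟩ : ℤ√(-11)) ^ 9).im - b := by
  obtain ⟨z, hz⟩ := pow_eight_eq ha hb
  obtain ⟨s, g, hg, rfl⟩ := Nat.exists_eq_two_pow_mul_odd hm
  obtain ⟨w, hw⟩ := one_add_sixteen_mul_pow z s g
  set A : ℤ√(-11) := ⟨a, b⟩ with hA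
  have h1 : A ^ (8 * (2 ^ s * g) + 1) =
      A + ((2 ^ s * 16 * g : ℤ) : ℤ√(-11)) * (A * z) + ((2 ^ s * 16 * 8 : ℤ) : ℤ√(-11)) * (A * w) := by
    rw [pow_succ, pow_mul, hz, hw]; push_cast; ring
  have h2 := congrArg Zsqrtd.im h1
  rw [h, Zsqrtd.im_add, Zsqrtd.im_add, im_intCast_mul, im_intCast_mul] at h2
  have h3 : (g : ℤ) * (A * z).im + 8 * (A * w).im = 0 := by
    have h4 : (2 ^ s * 16 : ℤ) * ((g : ℤ) * (A * z).im + 8 * (A * w).im) = 0 := by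
      have : A.im = b := rfl
      rw [this] at h2
      linear_combination -h2
    exact (mul_eq_zero.1 h4).resolve_left (by positivity)
  have h5 : (8 : ℤ) ∣ (A * z).im := by
    have hgc : IsCoprime (8 : ℤ) g := by
      rw [show (8 : ℤ) = ((2 ^ 3 : ℕ) : ℤ) by norm_num, Nat.isCoprime_iff_coprime]
      exact (Nat.coprime_two_left.2 hg).pow_left 3
    exact hgc.dvd_of_dvd_mul_left ⟨-(A * w).im, by linear_combination h3⟩
  have h6 : A ^ 9 = A + ((16 : ℤ) : ℤ√(-11)) * (A * z) := by
    rw [pow_succ, hz]; push_cast; ring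
  rw [h6, Zsqrtd.im_add, im_intCast_mul]
  obtain ⟨v, hv⟩ := h5
  refine ⟨v, ?_⟩
  rw [hv]
  have : A.im = b := rfl
  rw [this]; ring

lemma dvd_im_pow_mod {a b : ℤ} (ha : Even a) (hb : Odd b) (p : ℕ)
    (h : ((⟨a, b⟩ : ℤ√(-11)) ^ p).im = b) :
    (64 : ℤ) ∣ ((⟨a, b⟩ : ℤ√(-11)) ^ (p % 32)).im - b := by
  obtain ⟨z, hz⟩ := pow_eight_eq ha hb
  obtain ⟨w, hw⟩ := one_add_sixteen_mul_pow z 2 (p / 32)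
  set A : ℤ√(-11) := ⟨a, b⟩ with hA
  have h1 : A ^ p = A ^ (p % 32) + ((64 : ℤ) : ℤ√(-11)) *
      (A ^ (p % 32) * ((p / 32 : ℕ) * z + 8 * w)) := by
    conv_lhs => rw [← Nat.mod_add_div p 32, pow_add, show 32 * (p / 32) = 8 * (2 ^ 2 * (p / 32)) by ring,
      pow_mul, hz, hw]
    push_cast
    ring
  rw [h1, Zsqrtd.im_add, im_intCast_mul] at h
  exact ⟨-(A ^ (p % 32) * ((p / 32 : ℕ) * z + 8 * w)).im, by linear_combination h⟩

lemma zsqrtdPowImAux_sixtyFour : ∀ i < 4, ∀ j < 32, ∀ k < 16,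
    (zsqrtdPowImAux 64 16 (8 * i + 5) (2 * j) (11 ^ k % 64) 1 0 % 64 = 11 ^ k % 64 → k % 4 = 1) ∧
    (zsqrtdPowImAux 64 16 (8 * i + 3) (2 * j) (11 ^ k % 64) 1 0 % 64 = 11 ^ k % 64 → k % 4 = 0) ∧
    (zsqrtdPowImAux 64 16 (8 * i + 7) (2 * j) (11 ^ k % 64) 1 0 % 64 = 11 ^ k % 64 →
      k % 4 = 2) := by
  decide +kernel

lemma zsqrtdPowImAux_oneHundredTwentyEight : ∀ j < 64, ∀ k < 32,
    zsqrtdPowImAux 128 16 9 (2 * j) (11 ^ k % 128) 1 0 % 128 = 11 ^ k % 128 → k % 4 = 3 := by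
  decide +kernel

lemma mod_four_of_pow_im_eq {p k : ℕ} (hp : Odd p) (hp1 : p ≠ 1) {a : ℤ} (ha : Even a)
    (h : ((⟨a, 11 ^ k⟩ : ℤ√(-11)) ^ p).im = 11 ^ k) :
    (p % 8 = 1 → k % 4 = 3) ∧ (p % 8 = 5 → k % 4 = 1) ∧ (p % 8 = 3 → k % 4 = 0) ∧
      (p % 8 = 7 → k % 4 = 2) := by
  have h11 : Odd ((11 : ℤ) ^ k) := Odd.pow (by decide)
  rw [Nat.odd_iff] at hp
  by_cases h8 : p % 8 = 1
  · refine ⟨fun _ => ?_, by omega, by omega, by omega⟩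
    have h1 := dvd_im_pow_nine ha h11 (m := p / 8) (by omega) (by
      rwa [show 8 * (p / 8) + 1 = p by omega])
    obtain ⟨t, ht, hta, h2⟩ := zsqrtdPowImAux_mod (r := 128) (o := 32) (by norm_num) (by norm_num) h1
    rw [Int.even_iff] at ha
    have := zsqrtdPowImAux_oneHundredTwentyEight (t / 2) (by omega) (k % 32) (by omega) (by
      rwa [show 2 * (t / 2) = t by omega])
    omega
  · refine ⟨by omega, ?_⟩
    have h1 := dvd_im_pow_mod ha h11 p h
    obtain ⟨t, ht, hta, h2⟩ := zsqrtdPowImAux_mod (r := 64) (o := 16) (by norm_num) (by omega) h1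
    rw [Int.even_iff] at ha
    obtain ⟨h5, h3, h7⟩ := zsqrtdPowImAux_sixtyFour (p % 32 / 8) (by omega) (t / 2) (by omega)
      (k % 16) (by omega)
    rw [show 2 * (t / 2) = t by omega] at h5 h3 h7
    refine ⟨fun h => ?_, fun h => ?_, fun h => ?_⟩
    · rw [show 8 * (p % 32 / 8) + 5 = p % 32 by omega] at h5
      have := h5 h2
      omega
    · rw [show 8 * (p % 32 / 8) + 3 = p % 32 by omega] at h3
      have := h3 h2
      omega
    · rw [show 8 * (p % 32 / 8) + 7 = p % 32 by omega] at h7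
      have := h7 h2
      omega

lemma zsqrtdPowImAux_five : (∀ t < 7, ∀ k < 3,
      zsqrtdPowImAux 7 16 5 t (11 ^ k % 7) 1 0 % 7 = 11 ^ k % 7 → k = 1) ∧
    ∀ t < 13, ∀ k < 12,
      zsqrtdPowImAux 13 16 5 t (11 ^ k % 13) 1 0 % 13 = 11 ^ k % 13 → k % 3 = 2 := by
  decide +kernel

lemma pow_five_im_ne {k : ℕ} {a : ℤ} : ((⟨a, 11 ^ k⟩ : ℤ√(-11)) ^ 5).im ≠ 11 ^ k := by
  intro h
  obtain ⟨t, ht, -, h1⟩ := zsqrtdPowImAux_mod (r := 7) (o := 3) (a := a) (k := k) (e := 5)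
    (by norm_num) (by norm_num) (by rw [h, sub_self]; exact dvd_zero _)
  obtain ⟨t', ht', -, h2⟩ := zsqrtdPowImAux_mod (r := 13) (o := 12) (a := a) (k := k) (e := 5)
    (by norm_num) (by norm_num) (by rw [h, sub_self]; exact dvd_zero _)
  have h3 := zsqrtdPowImAux_five.1 t ht (k % 3) (by omega) h1
  have h4 := zsqrtdPowImAux_five.2 t' ht' (k % 12) (by omega) h2
  omega

lemma exists_pow_mul_eq_add {R : Type*} [CommRing R] {A w : R} (h : A ^ 3 = A + 3 * w) (m : ℕ) :
    ∃ v, A ^ (2 * m + 1) = A + 3 * v := by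
  induction m with
  | zero => exact ⟨0, by ring⟩
  | succ m ih =>
    obtain ⟨v, hv⟩ := ih
    exact ⟨w + A ^ 2 * v, by
      rw [show 2 * (m + 1) + 1 = 2 * m + 1 + 2 by ring, pow_add, hv]; linear_combination h⟩

lemma three_dvd_pow_im_sub {a b : ℤ} {p : ℕ} (hp : Odd p) :
    (3 : ℤ) ∣ ((⟨a, b⟩ : ℤ√(-11)) ^ p).im - b := by
  have ha : (3 : ℤ) ∣ a ^ 3 - a := by
    have : ((3 : ℕ) : ℤ) ∣ a ^ 3 - a := by
      rw [← ZMod.intCast_zmod_eq_zero_iff_dvd]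
      push_cast
      generalize (a : ZMod 3) = x
      revert x; decide
    exact_mod_cast this
  have hb : (3 : ℤ) ∣ b ^ 3 - b := by
    have : ((3 : ℕ) : ℤ) ∣ b ^ 3 - b := by
      rw [← ZMod.intCast_zmod_eq_zero_iff_dvd]
      push_cast
      generalize (b : ZMod 3) = x
      revert x; decide
    exact_mod_cast this
  obtain ⟨c, hc⟩ := ha
  obtain ⟨d, hd⟩ := hb
  have h3 : (⟨a, b⟩ : ℤ√(-11)) ^ 3 = ⟨a, b⟩ + 3 * ⟨c - 11 * a * b ^ 2, a ^ 2 * b - 4 * b ^ 3 + d⟩ := by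
    rw [pow_three, Zsqrtd.ext_iff]
    constructor
    · simp; linear_combination hc
    · simp; linear_combination hd
  obtain ⟨m, rfl⟩ := hp
  obtain ⟨v, hv⟩ := exists_pow_mul_eq_add h3 m
  rw [hv]
  exact ⟨v.im, by simp⟩

lemma isSquare_of_pow_im_eq {p : ℕ} (hp : p.Prime) (hp2 : p ≠ 2) {a b : ℤ} (hb : ¬ (p : ℤ) ∣ b)
    (h : ((⟨a, b⟩ : ℤ√(-11)) ^ p).im = b) : IsSquare (-11 : ZMod p) := by
  have := Fact.mk hp
  have h1 := mk_pow_char (r := p) hp2 a b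
  have h2 := zsqrtd_pow_cast (r := p) (⟨a, b⟩ : ℤ√(-11)) p
  rw [h1, h] at h2
  have h3 := congrArg QuadraticAlgebra.im h2
  dsimp only at h3
  have hb0 : (b : ZMod p) ≠ 0 := by rwa [Ne, ZMod.intCast_zmod_eq_zero_iff_dvd]
  have h4 : (-11 : ZMod p) ^ (p / 2) = 1 := mul_right_cancel₀ hb0 (by rw [h3, one_mul])
  by_cases h0 : (-11 : ZMod p) = 0
  · rw [h0]; exact ⟨0, by simp⟩
  · exact (ZMod.euler_criterion p h0).2 h4

lemma isSquare_zmod_eleven : ∀ q < 11, IsSquare ((q : ℕ) : ZMod 11) →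
    q = 0 ∨ q = 1 ∨ q = 3 ∨ q = 4 ∨ q = 5 ∨ q = 9 := by
  decide

lemma mod_eleven_of_isSquare {p : ℕ} (hp : p.Prime) (hp2 : p ≠ 2) (hp11 : p ≠ 11)
    (h : IsSquare (-11 : ZMod p)) :
    p % 11 = 1 ∨ p % 11 = 3 ∨ p % 11 = 4 ∨ p % 11 = 5 ∨ p % 11 = 9 := by
  have := Fact.mk hp
  have h11 : Fact (Nat.Prime 11) := ⟨by norm_num⟩
  have key : IsSquare ((p : ℕ) : ZMod 11) := by
    have hodd := Nat.odd_iff.1 (hp.odd_of_ne_two hp2)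
    have h4 : p % 4 = 1 ∨ p % 4 = 3 := by omega
    rcases h4 with h4 | h4
    · rw [← ZMod.exists_sq_eq_prime_iff_of_mod_four_eq_one h4 (by norm_num)]
      have h1 : IsSquare (-1 : ZMod p) := ZMod.exists_sq_eq_neg_one_iff.2 (by omega)
      have := h1.mul h
      simpa using this
    · rw [ZMod.exists_sq_eq_prime_iff_of_mod_four_eq_three (by norm_num) h4 (Ne.symm hp11)]
      intro h5
      have h6 : (11 : ZMod p) ≠ 0 := fun h6 => hp11 ((Nat.prime_dvd_prime_iff_eq hp (by norm_num)).1
        ((ZMod.natCast_eq_zero_iff 11 p).1 (by exact_mod_cast h6)))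
      have h7 := h.div h5
      rw [Nat.cast_ofNat, neg_div, div_self h6] at h7
      exact (ZMod.exists_sq_eq_neg_one_iff.1 h7) h4
  have h0 : p % 11 ≠ 0 := by
    intro h0
    exact hp11 ((Nat.prime_dvd_prime_iff_eq (by norm_num) hp).1 (Nat.dvd_of_mod_eq_zero h0)).symm
  rw [← ZMod.natCast_mod] at key
  have := isSquare_zmod_eleven (p % 11) (Nat.mod_lt _ (by norm_num)) key
  omega

lemma pow_re_im_expand (D : ℤ) (a b : ℤ) (n : ℕ) : ∃ c d : ℤ,
    ((⟨a, b⟩ : ℤ√D) ^ (n + 1)).re = a ^ (n + 1) + D * b ^ 2 * d ∧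
    ((⟨a, b⟩ : ℤ√D) ^ (n + 1)).im = (n + 1) * a ^ n * b + D * b ^ 3 * c := by
  induction n with
  | zero => exact ⟨0, 0, by simp, by simp⟩
  | succ n ih =>
    obtain ⟨c, d, h1, h2⟩ := ih
    refine ⟨c * a + d, a * d + (n + 1) * a ^ n + D * b ^ 2 * c, ?_, ?_⟩
    · rw [pow_succ, Zsqrtd.re_mul, h1, h2]; ring
    · rw [pow_succ, Zsqrtd.im_mul, h1, h2]; push_cast; ring

lemma dvd_mul_pow_sub_one {k p : ℕ} (hk : 1 ≤ k) (hp : 1 ≤ p) {a : ℤ}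
    (h : ((⟨a, 11 ^ k⟩ : ℤ√(-11)) ^ p).im = 11 ^ k) : (1331 : ℤ) ∣ p * a ^ (p - 1) - 1 := by
  obtain ⟨n, rfl⟩ : ∃ n, p = n + 1 := ⟨p - 1, by omega⟩
  obtain ⟨j, rfl⟩ : ∃ j, k = j + 1 := ⟨k - 1, by omega⟩
  obtain ⟨c, d, -, h2⟩ := pow_re_im_expand (-11) a (11 ^ (j + 1)) n
  rw [h] at h2
  have h3 : (11 ^ (j + 1) : ℤ) * (((n + 1 : ℕ) : ℤ) * a ^ n - 1 - 1331 * ((11 ^ j) ^ 2 * c)) = 0 := by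
    push_cast
    linear_combination -h2
  have h4 := (mul_eq_zero.1 h3).resolve_left (by positivity)
  rw [Nat.add_sub_cancel]
  exact ⟨(11 ^ j) ^ 2 * c, by linear_combination h4⟩

lemma mod_eq_one_of_dvd_mul_pow_sub_one {p : ℕ} (hp : p % 10 = 1) {a : ℤ} (ha : ¬ (11 : ℤ) ∣ a)
    (h : (1331 : ℤ) ∣ p * a ^ (p - 1) - 1) : p % 13310 = 1 := by
  have h1 : (11 : ℤ) ∣ a ^ 10 - 1 := by
    have hc : IsCoprime a ((11 : ℕ) : ℤ) := by
      rw [isCoprime_comm, Int.isCoprime_iff_gcd_eq_one]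
      have := (Nat.Prime.coprime_iff_not_dvd (p := 11) (n := a.natAbs) (by norm_num)).2
        (by rwa [← Int.natCast_dvd] )
      exact this
    have := Int.ModEq.pow_card_sub_one_eq_one (p := 11) (by norm_num) hc
    exact Int.modEq_iff_dvd.1 this.symm
  have h2 : ∀ j, ((11 : ℤ)) ^ (j + 1) ∣ (a ^ 10) ^ 11 ^ j - 1 := by
    intro j
    have := dvd_sub_pow_of_dvd_sub (R := ℤ) (p := 11) (a := a ^ 10) (b := 1) (by exact_mod_cast h1) j
    simpa using this
  have step : ∀ j, j ≤ 2 → 10 * 11 ^ j ∣ p - 1 → 10 * 11 ^ (j + 1) ∣ p - 1 := by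
    intro j hj ⟨m, hm⟩
    have h3 : (11 : ℤ) ^ (j + 1) ∣ a ^ (p - 1) - 1 := by
      rw [hm, pow_mul, pow_mul]
      refine (h2 j).trans ?_
      have := sub_dvd_pow_sub_pow ((a ^ 10) ^ 11 ^ j) 1 m
      rwa [one_pow] at this
    have h4 : (11 : ℤ) ^ (j + 1) ∣ p * a ^ (p - 1) - 1 :=
      (show (11 : ℤ) ^ (j + 1) ∣ 1331 from pow_dvd_pow 11 (by omega : j + 1 ≤ 3)).trans h
    have h5 : (11 : ℤ) ^ (j + 1) ∣ ((p - 1 : ℕ) : ℤ) := by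
      have h6 := dvd_sub h4 (h3.mul_left p)
      rw [show (p : ℤ) * a ^ (p - 1) - 1 - p * (a ^ (p - 1) - 1) = p - 1 by ring] at h6
      rwa [Nat.cast_sub (by omega), Nat.cast_one]
    have h7 : 11 ^ (j + 1) ∣ p - 1 := by exact_mod_cast h5
    exact Nat.Coprime.mul_dvd_of_dvd_of_dvd (Nat.Coprime.pow_right _ (by norm_num))
      (by omega) h7
  have h8 := step 2 le_rfl (step 1 (by norm_num) (step 0 (by norm_num) (by omega)))
  norm_num at h8
  omega

theorem pow_im_ne_of_abs {p : ℕ} (hp : p.Prime) (hp5 : 5 ≤ p) (hp11 : p ≠ 11) {a : ℤ}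
    (ha : Even a) (ha0 : a ≠ 0) (ha11 : ¬ (11 : ℤ) ∣ a) {k : ℕ} :
    |((⟨a, 11 ^ k⟩ : ℤ√(-11)) ^ p).im| ≠ 11 ^ k := by
  intro habs
  set A : ℤ√(-11) := ⟨a, 11 ^ k⟩ with hA
  have hodd : Odd p := hp.odd_of_ne_two (by omega)
  have h11 : (0 : ℤ) < 11 ^ k := by positivity
  have him : (A ^ p).im = 11 ^ k := by
    rcases (abs_eq h11.le).1 habs with h | h
    · exact h
    · exfalso
      have h3 := three_dvd_pow_im_sub (a := a) (b := 11 ^ k) hodd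
      rw [← hA, h] at h3
      have h4 : (3 : ℤ) ∣ 2 * 11 ^ k := by
        rw [← Int.dvd_neg]; convert h3 using 1; ring
      rcases Int.prime_three.dvd_or_dvd h4 with h5 | h5
      · norm_num at h5
      · have := Int.prime_three.dvd_of_dvd_pow h5
        norm_num at this
  have hre : A.re = a := rfl
  have himA : A.im = 11 ^ k := rfl
  have hnorm : A.norm = a ^ 2 + 11 * (11 ^ k) ^ 2 := by
    rw [Zsqrtd.norm_def, hre, himA]; ring
  have hk := mod_four_of_pow_im_eq hodd (by omega) ha him
  have hcop : IsCoprime (2 * A.re * A.im) A.norm := by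
    rw [hnorm, hre, himA]
    have ha11' : IsCoprime a (11 : ℤ) := by
      rw [isCoprime_comm]
      exact ((Nat.prime_iff_prime_int.1 (by norm_num : Nat.Prime 11)).coprime_iff_not_dvd).2
        (by exact_mod_cast ha11)
    have h1 : IsCoprime (2 : ℤ) (a ^ 2 + 11 * (11 ^ k) ^ 2) := by
      have h0 : Odd (a ^ 2 + 11 * (11 ^ k) ^ 2) :=
        (ha.pow_of_ne_zero two_ne_zero).add_odd ((by decide : Odd (11 : ℤ)).mul
          (Odd.pow (Odd.pow (by decide))))
      obtain ⟨c, hc⟩ := h0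
      exact ⟨-c, 1, by rw [hc]; ring⟩
    have h2 : IsCoprime a (a ^ 2 + 11 * (11 ^ k) ^ 2) := by
      rw [pow_two a, IsCoprime.mul_add_left_right_iff]
      exact ha11'.mul_right ((ha11'.pow_right).pow_right)
    have h3 : IsCoprime ((11 : ℤ) ^ k) (a ^ 2 + 11 * (11 ^ k) ^ 2) := by
      rw [show a ^ 2 + 11 * (11 ^ k) ^ 2 = 11 ^ k * (11 * 11 ^ k) + a ^ 2 by ring,
        IsCoprime.mul_add_left_right_iff]
      exact (ha11'.symm.pow_left).pow_right
    exact (h1.mul_left h2).mul_left h3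
  have ha4 : 4 ≤ a ^ 2 := by
    obtain ⟨c, rfl⟩ := ha.two_dvd
    have : c ≠ 0 := by rintro rfl; simp at ha0
    have : 0 < c ^ 2 := by positivity
    nlinarith
  have habs' : |(A ^ p).im| = |A.im| := by rw [habs, himA, abs_of_pos h11]
  have hp3 : p < 30000 := by
    refine prime_lt_of_abs_pow_im_eq (by rw [hre]; exact ha0) (by rw [himA]; exact h11.ne') hcop ?_ hp
      (by omega) habs'
    rw [hnorm]
    have : (1 : ℤ) ≤ (11 ^ k) ^ 2 := one_le_pow₀ (by omega)
    linarith
  have h8 : p % 8 = 1 → p < 8512 := by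
    intro h8
    have hk3 := hk.1 h8
    refine prime_lt_of_abs_pow_im_eq_of_le_norm (by rw [hre]; exact ha0)
      (by rw [himA]; exact h11.ne') hcop ?_ hp (by omega) habs'
    rw [hnorm]
    have : (11 : ℤ) ^ 3 ≤ 11 ^ k := pow_le_pow_right₀ (by norm_num) (by omega)
    nlinarith
  have hpb : ¬ (p : ℤ) ∣ 11 ^ k := by
    intro h
    have := (Nat.prime_dvd_prime_iff_eq hp (by norm_num)).1
      (hp.dvd_of_dvd_pow (by exact_mod_cast h : p ∣ 11 ^ k))
    exact hp11 this
  have hqr := mod_eleven_of_isSquare hp (by omega) hp11 (isSquare_of_pow_im_eq hp (by omega) hpb him)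
  have h5 : p % 5 = 1 → k = 0 := by
    intro h5
    by_contra hk0
    have := mod_eq_one_of_dvd_mul_pow_sub_one (p := p) (by have := Nat.odd_iff.1 hodd; omega) ha11
      (dvd_mul_pow_sub_one (by omega) (by omega) him)
    obtain rfl | rfl : p = 13311 ∨ p = 26621 := by omega
    · exact absurd hp (by norm_num)
    · exact absurd hp (by norm_num)
  rcases Nat.lt_or_ge p 13 with hlt | hge
  · obtain rfl : p = 5 := by
      interval_cases p <;> first | rfl | omega | (exact absurd hp (by norm_num))
    exact pow_five_im_ne him
  · exact sieve_aux hp hge hp3 hqr h5 h8 hk him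

/-- The action of the unit `23 + 4 √33` on the solutions of `3 u ^ 2 - 11 v ^ 2 = N`. -/
def pellStep (z : ℕ × ℕ) : ℕ × ℕ := (23 * z.1 + 44 * z.2, 12 * z.1 + 23 * z.2)

def pellStepMod (m : ℕ) (z : ℕ × ℕ) : ℕ × ℕ :=
  ((23 * z.1 + 44 * z.2) % m, (12 * z.1 + 23 * z.2) % m)

lemma iterate_pellStep_mod (m n : ℕ) (z : ℕ × ℕ) :
    (((pellStep^[n]) z).1 % m, ((pellStep^[n]) z).2 % m) =
      (pellStepMod m)^[n] (z.1 % m, z.2 % m) := by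
  induction n with
  | zero => rfl
  | succ n ih =>
    rw [Function.iterate_succ_apply', Function.iterate_succ_apply', ← ih, pellStep, pellStepMod]
    ext
    · simp [Nat.add_mod, Nat.mul_mod]
    · simp [Nat.add_mod, Nat.mul_mod]

lemma iterate_pellStep_snd_mod {m o : ℕ} {z : ℕ × ℕ}
    (ho : (pellStepMod m)^[o] (z.1 % m, z.2 % m) = (z.1 % m, z.2 % m)) (n : ℕ) :
    ((pellStep^[n]) z).2 % m = ((pellStepMod m)^[n % o] (z.1 % m, z.2 % m)).2 := by
  have h := congrArg Prod.snd (iterate_pellStep_mod m n z)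
  rw [← (show Function.IsPeriodicPt (pellStepMod m) o _ from ho).iterate_mod_apply n] at h
  exact h

lemma pow_modEq_pow_mod {a m o : ℕ} (ho : a ^ o ≡ 1 [MOD m]) (k : ℕ) :
    a ^ k ≡ a ^ (k % o) [MOD m] := by
  have := (ho.pow (k / o)).mul_left (a ^ (k % o))
  rwa [← pow_mul, ← pow_add, Nat.mod_add_div, one_pow, mul_one] at this

/-- No power `11 ^ k` divisible by `m` occurs in the sequence starting at `z`. -/
lemma iterate_pellStep_snd_ne {m q o s : ℕ} {z : ℕ × ℕ}
    (hm : (pellStepMod m)^[o] (z.1 % m, z.2 % m) = (z.1 % m, z.2 % m))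
    (hq : (pellStepMod q)^[o] (z.1 % q, z.2 % q) = (z.1 % q, z.2 % q))
    (ho : 0 < o) (hs0 : 0 < s) (hs : 11 ^ s ≡ 1 [MOD q])
    (h : ∀ n < o, ((pellStepMod m)^[n] (z.1 % m, z.2 % m)).2 = 0 →
      ∀ j < s, ((pellStepMod q)^[n] (z.1 % q, z.2 % q)).2 ≠ 11 ^ j % q)
    {k n : ℕ} (hk : m ∣ 11 ^ k) : ((pellStep^[n]) z).2 ≠ 11 ^ k := by
  intro hn
  refine h (n % o) (Nat.mod_lt _ ho) ?_ (k % s) (Nat.mod_lt _ hs0) ?_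
  · rw [← iterate_pellStep_snd_mod hm n, hn]
    exact Nat.mod_eq_zero_of_dvd hk
  · rw [← iterate_pellStep_snd_mod hq n, hn]
    exact pow_modEq_pow_mod hs k

lemma exists_iterate_pellStep_of_one : ∀ v u : ℕ, 3 * u ^ 2 = 11 * v ^ 2 + 1 →
    ∃ n, (pellStep^[n]) (2, 1) = (u, v) := by
  intro v
  induction v using Nat.strong_induction_on with
  | _ v ih =>
    intro u huv
    rcases Nat.lt_or_ge v 7 with hv | hv
    · have hu : u < 14 := by nlinarith
      obtain ⟨rfl, rfl⟩ : u = 2 ∧ v = 1 := by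
        interval_cases v <;> interval_cases u <;> simp_all
      exact ⟨0, rfl⟩
    · have h1 : 44 * v ≤ 23 * u := by nlinarith
      have h2 : 12 * u ≤ 23 * v := by nlinarith
      have h3 : 23 * v - 12 * u < v := by
        have : 22 * v < 12 * u := by nlinarith
        omega
      obtain ⟨u', hu'⟩ := Nat.exists_eq_add_of_le h1
      obtain ⟨v', hv'⟩ := Nat.exists_eq_add_of_le h2
      have hvv : 23 * v - 12 * u = v' := by omega
      rw [hvv] at h3
      have hu : u = 23 * u' + 44 * v' := by omega
      have hv : v = 12 * u' + 23 * v' := by omega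
      obtain ⟨n, hn⟩ := ih v' h3 u' (by subst hu hv; nlinarith)
      refine ⟨n + 1, ?_⟩
      rw [Function.iterate_succ_apply', hn, pellStep, hu, hv]

lemma exists_iterate_pellStep_of_neg_eight : ∀ v u : ℕ, 3 * u ^ 2 + 8 = 11 * v ^ 2 →
    ∃ n, (pellStep^[n]) (1, 1) = (u, v) ∨ (pellStep^[n]) (21, 11) = (u, v) := by
  intro v
  induction v using Nat.strong_induction_on with
  | _ v ih =>
    intro u huv
    rcases Nat.lt_or_ge v 20 with hv | hv
    · have hu : u < 40 := by nlinarith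
      obtain ⟨rfl, rfl⟩ | ⟨rfl, rfl⟩ : u = 1 ∧ v = 1 ∨ u = 21 ∧ v = 11 := by
        clear ih
        interval_cases v <;> interval_cases u <;> simp_all
      · exact ⟨0, Or.inl rfl⟩
      · exact ⟨0, Or.inr rfl⟩
    · have h1 : 44 * v ≤ 23 * u := by nlinarith
      have h2 : 12 * u ≤ 23 * v := by nlinarith
      have h3 : 23 * v - 12 * u < v := by
        have : 22 * v < 12 * u := by nlinarith
        omega
      obtain ⟨u', hu'⟩ := Nat.exists_eq_add_of_le h1
      obtain ⟨v', hv'⟩ := Nat.exists_eq_add_of_le h2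
      have hvv : 23 * v - 12 * u = v' := by omega
      rw [hvv] at h3
      have hu : u = 23 * u' + 44 * v' := by omega
      have hv : v = 12 * u' + 23 * v' := by omega
      obtain ⟨n, hn⟩ := ih v' h3 u' (by subst hu hv; nlinarith)
      refine ⟨n + 1, ?_⟩
      rw [Function.iterate_succ_apply', Function.iterate_succ_apply']
      rcases hn with hn | hn
      · left; rw [hn, pellStep, hu, hv]
      · right; rw [hn, pellStep, hu, hv]

lemma eq_zero_of_three_mul_sq_eq {u m : ℕ} (h : 3 * u ^ 2 = 11 * (11 ^ m) ^ 2 + 1) : m = 0 := by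
  obtain ⟨n, hn⟩ := exists_iterate_pellStep_of_one _ _ h
  by_contra hm
  refine iterate_pellStep_snd_ne (m := 11) (q := 373) (o := 11) (s := 372) (z := (2, 1))
    (by decide +kernel) (by decide +kernel) (by norm_num) (by norm_num) (by decide +kernel)
    (by decide +kernel) (k := m) (n := n) (dvd_pow_self 11 hm) ?_
  rw [hn]

lemma le_one_of_three_mul_sq_add_eight_eq {u m : ℕ} (h : 3 * u ^ 2 + 8 = 11 * (11 ^ m) ^ 2) :
    m ≤ 1 := by
  by_contra! hm
  have h121 : 121 ∣ 11 ^ m := pow_dvd_pow 11 hm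
  obtain ⟨n, hn | hn⟩ := exists_iterate_pellStep_of_neg_eight _ _ h
  · refine iterate_pellStep_snd_ne (m := 121) (q := 241) (o := 121) (s := 48) (z := (1, 1))
      (by decide +kernel) (by decide +kernel) (by norm_num) (by norm_num) (by decide +kernel)
      (by decide +kernel) (k := m) (n := n) h121 ?_
    rw [hn]
  · refine iterate_pellStep_snd_ne (m := 121) (q := 241) (o := 121) (s := 48) (z := (21, 11))
      (by decide +kernel) (by decide +kernel) (by norm_num) (by norm_num) (by decide +kernel)
      (by decide +kernel) (k := m) (n := n) h121 ?_
    rw [hn]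

lemma GaussianInt.pow_four_eq_one_of_isUnit {u : GaussianInt} (hu : IsUnit u) : u ^ 4 = 1 := by
  have h1 := Zsqrtd.norm_eq_one_iff.2 hu
  have h2 : u.re ^ 2 + u.im ^ 2 = 1 := by
    have h3 : u.norm = u.re ^ 2 + u.im ^ 2 := by rw [Zsqrtd.norm_def]; ring
    have h4 : 0 ≤ u.re ^ 2 + u.im ^ 2 := by positivity
    omega
  have h3 : u.re * u.im = 0 := by
    by_contra h
    have h4 := mul_ne_zero_iff.1 h
    have h5 : 0 < u.re ^ 2 := by have := h4.1; positivity
    have h6 : 0 < u.im ^ 2 := by have := h4.2; positivity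
    omega
  have h5 : u ^ 4 = (⟨(u.re ^ 2 - u.im ^ 2) ^ 2 - 4 * (u.re * u.im) ^ 2,
      4 * (u.re ^ 2 - u.im ^ 2) * (u.re * u.im)⟩ : GaussianInt) := by
    rw [show u ^ 4 = u * u * (u * u) by ring, Zsqrtd.ext_iff]
    constructor
    · simp; ring
    · simp; ring
  rw [h5, h3, Zsqrtd.ext_iff]
  constructor
  · simp only [Zsqrtd.re_one]
    linear_combination (u.re ^ 2 + u.im ^ 2 + 1) * h2 - 4 * (u.re * u.im) * h3
  · simp

/-- Coprime factors of a perfect power are perfect powers up to units; for odd exponents this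
applies to `z * star z` when the units have order dividing a power of `2`. -/
lemma exists_pow_eq_of_isCoprime {R : Type*} [CommRing R] [IsDomain R] [IsBezout R] {z w c : R}
    {p : ℕ} (hu : ∀ u : R, IsUnit u → u ^ 4 = 1) (hp : Odd p) (hc : IsCoprime z w)
    (h : z * w = c ^ p) : ∃ g, z = g ^ p := by
  obtain ⟨d, u, hdu⟩ := exists_associated_pow_of_mul_eq_pow' hc h
  refine ⟨d * u ^ p, ?_⟩
  have h1 : (u : R) ^ (p * p) = u := by
    obtain ⟨m, rfl⟩ := hp
    rw [show (2 * m + 1) * (2 * m + 1) = 4 * (m * (m + 1)) + 1 by ring, pow_succ, pow_mul,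
      hu u u.isUnit, one_pow, one_mul]
  rw [mul_pow, ← pow_mul, h1, hdu]

lemma isCoprime_of_add {R : Type*} [CommRing R] {z w : R} {m t : ℤ} (hmul : z * w = m)
    (hadd : z + w = t) (h : IsCoprime m t) : IsCoprime z w := by
  have h1 : IsCoprime (z * w) (z + w) := by
    rw [hmul, hadd]
    exact h.map (Int.castRingHom R)
  have := h1.of_mul_left_left
  rw [add_comm] at this
  exact (IsCoprime.add_mul_left_right_iff (z := 1)).1 (by simpa using this)

lemma exists_gaussianInt_of_sq_add_sq_eq_pow {p : ℕ} (hp : Odd p) {x w y : ℤ} (hx : Even x)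
    (hw : Odd w) (hxy : IsCoprime x y) (h : x ^ 2 + w ^ 2 = y ^ p) :
    ∃ g : GaussianInt, g ^ p = ⟨x, w⟩ := by
  have hodd : Odd (y ^ p) := by
    rw [← h]
    exact (hx.pow_of_ne_zero two_ne_zero).add_odd (hw.pow)
  have hcop : IsCoprime (y ^ p) (2 * x) := by
    obtain ⟨c, hc⟩ := hodd
    refine IsCoprime.mul_right ⟨1, -c, by rw [hc]; ring⟩ hxy.symm.pow_left
  have hmul : (⟨x, w⟩ : GaussianInt) * ⟨x, -w⟩ = (y : GaussianInt) ^ p := by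
    rw [← Int.cast_pow, ← h, Zsqrtd.intCast_val, Zsqrtd.ext_iff]
    constructor
    · simp; ring
    · simp; ring
  obtain ⟨g, hg⟩ := exists_pow_eq_of_isCoprime (z := (⟨x, w⟩ : GaussianInt)) (w := ⟨x, -w⟩)
    (fun u => GaussianInt.pow_four_eq_one_of_isUnit) hp
    (isCoprime_of_add (m := y ^ p) (t := 2 * x) (by rw [hmul]; push_cast; rfl) (by
      rw [Zsqrtd.ext_iff]
      constructor
      · simp; ring
      · simp) hcop) hmul
  exact ⟨g, hg.symm⟩

lemma GaussianInt.norm_eq (g : GaussianInt) : g.norm = g.re ^ 2 + g.im ^ 2 := by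
  rw [Zsqrtd.norm_def]; ring

/-- The data carried by a solution of `x ^ 2 + w ^ 2 = y ^ p`. -/
lemma exists_re_pow_eq {p : ℕ} (hp : Odd p) {x w y : ℤ} (hx : Even x) (hx0 : x ≠ 0)
    (hw : Odd w) (hxy : IsCoprime x y) (h : x ^ 2 + w ^ 2 = y ^ p) :
    ∃ a b : ℤ, Even a ∧ a ≠ 0 ∧ Odd b ∧ y = a ^ 2 + b ^ 2 ∧ IsCoprime a b ∧
      b ∣ w ∧ |(⟨b, a⟩ ^ p : GaussianInt).re| = |w| := by
  obtain ⟨g, hg⟩ := exists_gaussianInt_of_sq_add_sq_eq_pow hp hx hw hxy h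
  have hy : y = g.re ^ 2 + g.im ^ 2 := by
    have h1 : (g ^ p).norm = g.norm ^ p := map_pow Zsqrtd.normMonoidHom g p
    rw [hg, GaussianInt.norm_eq, GaussianInt.norm_eq] at h1
    dsimp only at h1
    rw [h] at h1
    exact hp.strictMono_pow.injective h1
  have hi : ∃ s : ℤ, (s = 1 ∨ s = -1) ∧ (⟨0, 1⟩ : GaussianInt) ^ p = ⟨0, s⟩ := by
    obtain ⟨m, rfl⟩ := hp
    have hsq : (⟨0, 1⟩ : GaussianInt) ^ 2 = ((-1 : ℤ) : GaussianInt) := by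
      rw [pow_two, Zsqrtd.ext_iff]; simp
    refine ⟨(-1) ^ m, neg_one_pow_eq_or ℤ m, ?_⟩
    rw [pow_succ, pow_mul, hsq, ← Int.cast_pow, Zsqrtd.intCast_val, Zsqrtd.ext_iff]
    simp
  obtain ⟨s, hs, hi⟩ := hi
  have hβ : (⟨-g.im, g.re⟩ : GaussianInt) ^ p = ⟨-s * w, s * x⟩ := by
    have h1 : (⟨-g.im, g.re⟩ : GaussianInt) = ⟨0, 1⟩ * g := by
      rw [Zsqrtd.ext_iff]; simp
    rw [h1, mul_pow, hi, hg, Zsqrtd.ext_iff]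
    constructor <;> simp
  have hdvd : g.im ∣ w := by
    obtain ⟨n, rfl⟩ : ∃ n, p = n + 1 := ⟨p - 1, by have := hp.pos; omega⟩
    obtain ⟨c, -, -, hd⟩ := pow_re_im_expand (-1) g.re g.im n
    have h1 : ((⟨g.re, g.im⟩ : GaussianInt) ^ (n + 1)).im = w := by
      rw [show (⟨g.re, g.im⟩ : GaussianInt) = g from rfl, hg]
    rw [← h1, hd]
    exact ⟨(n + 1) * g.re ^ n + -1 * g.im ^ 2 * c, by ring⟩
  have hbodd : Odd g.im := Int.Odd.of_mul_left (n := hdvd.choose) (by rwa [← hdvd.choose_spec])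
  have hyodd : Odd y := by
    have h1 : Odd (y ^ p) := by
      rw [← h]
      exact (hx.pow_of_ne_zero two_ne_zero).add_odd (hw.pow)
    exact (Int.odd_pow' hp.pos.ne').1 h1
  have hw0 : w ≠ 0 := by rintro rfl; simp at hw
  refine ⟨g.re, -g.im, ?_, ?_, hbodd.neg, ?_, ?_, ?_, ?_⟩
  · by_contra hc
    rw [Int.not_even_iff_odd] at hc
    have : Even y := by
      rw [hy]
      exact hc.pow.add_odd hbodd.pow
    exact Int.not_even_iff_odd.2 hyodd this
  · intro h0
    have h1 : (⟨-g.im, g.re⟩ : GaussianInt) ^ p = ⟨(-g.im) ^ p, 0⟩ := by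
      rw [h0, ← Zsqrtd.intCast_val, ← Zsqrtd.intCast_val, Int.cast_pow]
    rw [hβ, Zsqrtd.ext_iff] at h1
    have h2 : s * x = 0 := h1.2
    rcases hs with rfl | rfl <;> simp at h2 <;> exact hx0 h2
  · rw [hy]; ring
  · have h1 : IsCoprime (x ^ 2) (y ^ p) := hxy.pow
    have h2 : IsCoprime w y := by
      have h3 : IsCoprime (w ^ 2) (y ^ p) := by
        rw [show w ^ 2 = -x ^ 2 + y ^ p * 1 by linarith]
        exact IsCoprime.add_mul_left_left h1.neg_left 1
      exact (IsCoprime.pow_iff two_pos hp.pos).1 h3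
    have h4 := (h2.of_isCoprime_of_dvd_left hdvd)
    rw [hy] at h4
    have h5 : IsCoprime g.im (g.re ^ 2) := by
      have := h4.add_mul_left_right (-g.im)
      rwa [show g.re ^ 2 + g.im ^ 2 + g.im * -g.im = g.re ^ 2 by ring] at this
    exact ((IsCoprime.pow_right_iff two_pos).1 h5).symm.neg_right
  · rw [neg_dvd]; exact hdvd
  · rw [hβ]
    rcases hs with rfl | rfl <;> simp

lemma GaussianInt.odd_pow_expand (a b : ℤ) (m : ℕ) : ∃ c d : ℤ,
    ((⟨b, a⟩ : GaussianInt) ^ (2 * m + 1)).re =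
      b * ((2 * m + 1) * (-1) ^ m * a ^ (2 * m) + b ^ 2 * c) ∧
    ((⟨b, a⟩ : GaussianInt) ^ (2 * m + 1)).im = (-1) ^ m * a ^ (2 * m + 1) + b ^ 2 * d := by
  induction m with
  | zero => exact ⟨0, 0, by simp, by simp⟩
  | succ m ih =>
    obtain ⟨c, d, h1, h2⟩ := ih
    have h3 : (⟨b, a⟩ : GaussianInt) ^ 2 = ⟨b ^ 2 - a ^ 2, 2 * a * b⟩ := by
      rw [pow_two, Zsqrtd.ext_iff]
      constructor
      · simp; ring
      · simp; ring
    refine ⟨(2 * m + 1) * (-1) ^ m * a ^ (2 * m) + (b ^ 2 - a ^ 2) * c - 2 * a * d,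
      (-1) ^ m * a ^ (2 * m + 1) + (b ^ 2 - a ^ 2) * d +
        2 * a * ((2 * m + 1) * (-1) ^ m * a ^ (2 * m) + b ^ 2 * c), ?_, ?_⟩
    · rw [show 2 * (m + 1) + 1 = 2 * m + 1 + 2 by ring, pow_add, h3, Zsqrtd.re_mul, h1, h2]
      push_cast; ring
    · rw [show 2 * (m + 1) + 1 = 2 * m + 1 + 2 by ring, pow_add, h3, Zsqrtd.im_mul, h1, h2]
      push_cast; ring

lemma GaussianInt.four_dvd_odd_pow_re_sub {a b : ℤ} (ha : Even a) (hb : Odd b) {p : ℕ}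
    (hp : Odd p) : 4 ∣ ((⟨b, a⟩ : GaussianInt) ^ p).re - b := by
  obtain ⟨m, rfl⟩ := hp
  obtain ⟨-, d, h, -⟩ := pow_re_im_expand (-1) b a (2 * m)
  obtain ⟨e, rfl⟩ := ha.two_dvd
  have h1 : (4 : ℤ) ∣ b ^ (2 * m) - 1 := by
    rw [pow_mul]
    refine Dvd.dvd.trans ?_ (by simpa using sub_dvd_pow_sub_pow (b ^ 2) 1 m)
    obtain ⟨f, rfl⟩ := hb
    exact ⟨f ^ 2 + f, by ring⟩
  obtain ⟨f, hf⟩ := h1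
  have h2 : ((⟨b, 2 * e⟩ : GaussianInt) ^ (2 * m + 1)).re = _ := h
  rw [h2]
  exact ⟨b * f - e ^ 2 * d, by rw [pow_succ]; linear_combination b * hf⟩

lemma GaussianInt.eleven_dvd_pow_twelve (a b : ℤ) : (11 : ℤ) ∣ ((⟨b, a⟩ : GaussianInt) ^ 12).im ∧
    ((11 : ℤ) ∣ ((⟨b, a⟩ : GaussianInt) ^ 12).re → (11 : ℤ) ∣ b) := by
  have h3 : (⟨b, a⟩ : GaussianInt) ^ 3 = ⟨b ^ 3 - 3 * b * a ^ 2, 3 * b ^ 2 * a - a ^ 3⟩ := by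
    rw [pow_succ, pow_two, Zsqrtd.ext_iff]
    constructor
    · simp; ring
    · simp; ring
  have h4 : ∀ e f : ℤ, (⟨e, f⟩ : GaussianInt) ^ 4 =
      ⟨(e ^ 2 - f ^ 2) ^ 2 - 4 * e ^ 2 * f ^ 2, 4 * e * f * (e ^ 2 - f ^ 2)⟩ := by
    intro e f
    rw [show (4 : ℕ) = 2 * 2 by rfl, pow_mul, pow_two, pow_two, Zsqrtd.ext_iff]
    constructor
    · simp; ring
    · simp; ring
  rw [show (12 : ℕ) = 3 * 4 by rfl, pow_mul, h3, h4]
  dsimp only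
  have h1 : ∀ z : ℤ, (11 : ℤ) ∣ z ↔ (z : ZMod 11) = 0 := fun z => by
    simpa using (ZMod.intCast_zmod_eq_zero_iff_dvd z 11).symm
  simp only [h1]
  constructor
  · push_cast
    generalize (a : ZMod 11) = a
    generalize (b : ZMod 11) = b
    revert a b
    decide
  · push_cast
    generalize (a : ZMod 11) = a
    generalize (b : ZMod 11) = b
    revert a b
    decide

lemma GaussianInt.eleven_dvd_of_dvd_pow_re {a b : ℤ} {p : ℕ} (hp : p ^ 2 % 12 = 1)
    (h : (11 : ℤ) ∣ ((⟨b, a⟩ : GaussianInt) ^ p).re) : (11 : ℤ) ∣ b := by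
  have hodd : Odd p := by
    rw [← Nat.not_even_iff_odd]
    rintro hc
    have := hc.two_dvd
    obtain ⟨q, rfl⟩ := this
    rw [mul_pow] at hp
    omega
  by_contra hb
  obtain ⟨h1, h2⟩ := GaussianInt.eleven_dvd_pow_twelve a b
  have h3 : ¬ (11 : ℤ) ∣ ((⟨b, a⟩ : GaussianInt) ^ 12).re := fun h => hb (h2 h)
  have hP : Prime (11 : ℤ) := by norm_num
  have h4 : ∀ q : ℕ, (11 : ℤ) ∣ (((⟨b, a⟩ : GaussianInt) ^ 12) ^ q).im ∧
      ¬ (11 : ℤ) ∣ (((⟨b, a⟩ : GaussianInt) ^ 12) ^ q).re := by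
    intro q
    induction q with
    | zero => simp
    | succ q ih =>
      rw [pow_succ, Zsqrtd.im_mul, Zsqrtd.re_mul]
      refine ⟨dvd_add (h1.mul_left _) (ih.1.mul_right _), ?_⟩
      intro hc
      rw [mul_assoc, dvd_add_left ((ih.1.mul_right _).mul_left _)] at hc
      rcases hP.dvd_or_dvd hc with hc | hc
      · exact ih.2 hc
      · exact h3 hc
  have h5 : (11 : ℤ) ∣ ((⟨b, a⟩ : GaussianInt) ^ (p ^ 2)).re := by
    rw [pow_two, pow_mul]
    obtain ⟨m, rfl⟩ := hodd
    obtain ⟨c, d, h6, -⟩ := GaussianInt.odd_pow_expand ((⟨b, a⟩ : GaussianInt) ^ (2 * m + 1)).im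
      ((⟨b, a⟩ : GaussianInt) ^ (2 * m + 1)).re m
    exact (h.mul_right _).trans h6.symm.dvd
  rw [← Nat.div_add_mod (p ^ 2) 12, hp, pow_succ, pow_mul, Zsqrtd.re_mul] at h5
  obtain ⟨h6, h7⟩ := h4 (p ^ 2 / 12)
  rw [mul_assoc, dvd_add_left ((h6.mul_right _).mul_left _)] at h5
  rcases hP.dvd_or_dvd h5 with hc | hc
  · exact h7 hc
  · exact hb hc

lemma eq_or_eq_neg_of_dvd_eleven_pow {b : ℤ} {k : ℕ} (h : b ∣ 11 ^ k) :
    ∃ j ≤ k, b = 11 ^ j ∨ b = -11 ^ j := by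
  obtain ⟨j, hj, h1⟩ := (Nat.dvd_prime_pow (by norm_num : Nat.Prime 11)).1
    (show b.natAbs ∣ 11 ^ k by
      have := Int.natAbs_dvd_natAbs.2 h
      rwa [Int.natAbs_pow] at this)
  refine ⟨j, hj, ?_⟩
  have := Int.natAbs_eq b
  rw [h1] at this
  exact_mod_cast this

lemma eq_one_or_eq_neg_one_of_dvd_eleven_pow {u : ℤ} {k : ℕ} (h : u ∣ 11 ^ k)
    (hu : ¬ (11 : ℤ) ∣ u) : u = 1 ∨ u = -1 := by
  obtain ⟨j, -, h1⟩ := eq_or_eq_neg_of_dvd_eleven_pow h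
  rcases j with _ | j
  · simpa using h1
  · exfalso
    apply hu
    rcases h1 with rfl | rfl
    · exact dvd_pow_self _ (by omega)
    · exact (dvd_pow_self _ (by omega)).neg_right

lemma GaussianInt.pow_re_eq_of_abs {a b : ℤ} (ha : Even a) (hb : Odd b) (hab : IsCoprime a b)
    {p k : ℕ} (hp : p.Prime) (hp5 : 5 ≤ p) (h11 : p ≠ 11 ∨ ¬ (11 : ℤ) ∣ b)
    (hbk : b ∣ 11 ^ k) (h : |((⟨b, a⟩ : GaussianInt) ^ p).re| = 11 ^ k) :
    ((⟨b, a⟩ : GaussianInt) ^ p).re = b ∧ (b = 11 ^ k ∨ b = -11 ^ k) := by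
  have hodd : Odd p := hp.odd_of_ne_two (by omega)
  have hr : ((⟨b, a⟩ : GaussianInt) ^ p).re = b ∨ ((⟨b, a⟩ : GaussianInt) ^ p).re = -b := by
    by_cases hb11 : (11 : ℤ) ∣ b
    · have hp11 : p ≠ 11 := by tauto
      obtain ⟨m, rfl⟩ := hodd
      obtain ⟨c, -, h1, -⟩ := GaussianInt.odd_pow_expand a b m
      have h2 : ((2 * m + 1) * (-1) ^ m * a ^ (2 * m) + b ^ 2 * c) ∣ (11 : ℤ) ^ k := by
        rw [← h, dvd_abs, h1]
        exact dvd_mul_left _ _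
      have hP : Prime (11 : ℤ) := by norm_num
      have h3 := eq_one_or_eq_neg_one_of_dvd_eleven_pow h2 (by
        intro hc
        rw [dvd_add_left (((hb11.trans (dvd_pow_self b two_ne_zero))).mul_right c)] at hc
        rcases hP.dvd_or_dvd hc with hc | hc
        · rcases hP.dvd_or_dvd hc with hc | hc
          · have : 11 ∣ 2 * m + 1 := by exact_mod_cast hc
            exact hp11 ((Nat.prime_dvd_prime_iff_eq (by norm_num) hp).1 this).symm
          · exact hP.not_isUnit (isUnit_of_dvd_unit hc (isUnit_one.neg.pow m))
        · exact hP.not_isUnit (hab.isUnit_of_dvd' (hP.dvd_of_dvd_pow hc) hb11))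
      rw [h1]
      rcases h3 with h3 | h3 <;> rw [h3]
      · left; ring
      · right; ring
    · have h12 : p ^ 2 % 12 = 1 := by
        have h2 : p % 2 = 1 := Nat.odd_iff.1 hodd
        have h3 : p % 3 ≠ 0 := by
          intro h3
          have := (Nat.prime_dvd_prime_iff_eq (by norm_num) hp).1 (Nat.dvd_of_mod_eq_zero h3)
          omega
        have h4 : p % 12 = 1 ∨ p % 12 = 5 ∨ p % 12 = 7 ∨ p % 12 = 11 := by omega
        rcases h4 with h4 | h4 | h4 | h4 <;> simp [Nat.pow_mod, h4]
      have hk : k = 0 := by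
        by_contra hk
        apply hb11
        apply GaussianInt.eleven_dvd_of_dvd_pow_re h12 (a := a)
        rw [← dvd_abs, h]
        exact dvd_pow_self _ hk
      subst hk
      rw [pow_zero] at h hbk
      rcases Int.isUnit_iff.1 (isUnit_of_dvd_one hbk) with rfl | rfl
      · exact eq_or_eq_neg_of_abs_eq h
      · simpa [or_comm] using eq_or_eq_neg_of_abs_eq h
  have h4 := GaussianInt.four_dvd_odd_pow_re_sub ha hb hodd
  have hre : ((⟨b, a⟩ : GaussianInt) ^ p).re = b := by
    rcases hr with h5 | h5
    · exact h5
    · rw [h5] at h4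
      obtain ⟨c, rfl⟩ := hb
      omega
  refine ⟨hre, ?_⟩
  rw [hre] at h
  exact eq_or_eq_neg_of_abs_eq h

lemma eleven_dvd_iff_zmod (z : ℤ) : (11 : ℤ) ∣ z ↔ (z : ZMod 11) = 0 := by
  simpa using (ZMod.intCast_zmod_eq_zero_iff_dvd z 11).symm

lemma GaussianInt.pow_eleven_re (a b : ℤ) : ((⟨b, a⟩ : GaussianInt) ^ 11).re =
    b * ((b ^ 2) ^ 5 - 55 * (b ^ 2) ^ 4 * a ^ 2 + 330 * (b ^ 2) ^ 3 * a ^ 4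
      - 462 * (b ^ 2) ^ 2 * a ^ 6 + 165 * b ^ 2 * a ^ 8 - 11 * a ^ 10) := by
  have h3 : (⟨b, a⟩ : GaussianInt) ^ 3 = ⟨b ^ 3 - 3 * b * a ^ 2, 3 * b ^ 2 * a - a ^ 3⟩ := by
    rw [pow_succ, pow_two, Zsqrtd.ext_iff]
    constructor
    · simp; ring
    · simp; ring
  have h2 : ∀ b a : ℤ, (⟨b, a⟩ : GaussianInt) ^ 2 = ⟨b ^ 2 - a ^ 2, 2 * a * b⟩ := by
    intro b a
    rw [pow_two, Zsqrtd.ext_iff]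
    constructor
    · simp; ring
    · simp; ring
  rw [show (11 : ℕ) = 3 * 2 + 3 + 2 by rfl, pow_add, pow_add, pow_mul, h3, h2, h2,
    Zsqrtd.re_mul, Zsqrtd.re_mul, Zsqrtd.im_mul]
  ring

lemma pow_eleven_re_residues_mod_nineteen : ∀ j < 3, ∀ a < 19,
    ((121 ^ j) ^ 5 + 330 * (121 ^ j) ^ 3 * a ^ 4 + 165 * 121 ^ j * a ^ 8 + 11) % 19 =
    (55 * (121 ^ j) ^ 4 * a ^ 2 + 462 * (121 ^ j) ^ 2 * a ^ 6 + 11 * a ^ 10) % 19 → j = 1 := by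
  decide +kernel

lemma pow_eleven_re_residues_mod_thirteen : ∀ j < 6, ∀ a < 13,
    ((121 ^ j) ^ 5 + 330 * (121 ^ j) ^ 3 * a ^ 4 + 165 * 121 ^ j * a ^ 8 + 11) % 13 =
    (55 * (121 ^ j) ^ 4 * a ^ 2 + 462 * (121 ^ j) ^ 2 * a ^ 6 + 11 * a ^ 10) % 13 →
      j = 1 ∨ j = 2 ∨ j = 5 := by
  decide +kernel

lemma pow_eleven_re_residues_mod_fortyOne : ∀ j < 20, ∀ a < 41,
    ((121 ^ j) ^ 5 + 330 * (121 ^ j) ^ 3 * a ^ 4 + 165 * 121 ^ j * a ^ 8 + 11) % 41 =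
    (55 * (121 ^ j) ^ 4 * a ^ 2 + 462 * (121 ^ j) ^ 2 * a ^ 6 + 11 * a ^ 10) % 41 → j % 4 = 0 := by
  decide +kernel

lemma pow_eleven_re_reduce {r o : ℕ} (hr : 0 < r) (ho : 121 ^ o % r = 1 % r) {a : ℤ} {j : ℕ}
    (h : (121 ^ j) ^ 5 - 55 * (121 ^ j) ^ 4 * a ^ 2 + 330 * (121 ^ j) ^ 3 * a ^ 4
      - 462 * (121 ^ j) ^ 2 * a ^ 6 + 165 * 121 ^ j * a ^ 8 - 11 * a ^ 10 = -11) :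
    ∃ t < r, ((121 ^ (j % o)) ^ 5 + 330 * (121 ^ (j % o)) ^ 3 * t ^ 4 +
        165 * 121 ^ (j % o) * t ^ 8 + 11) % r =
      (55 * (121 ^ (j % o)) ^ 4 * t ^ 2 + 462 * (121 ^ (j % o)) ^ 2 * t ^ 6 + 11 * t ^ 10) % r := by
  have hr0 : (r : ℤ) ≠ 0 := by exact_mod_cast hr.ne'
  obtain ⟨t, ht⟩ := Int.eq_ofNat_of_zero_le (Int.emod_nonneg a hr0)
  have htr : t < r := by
    have := Int.emod_lt_of_pos a (by exact_mod_cast hr : (0 : ℤ) < r)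
    omega
  refine ⟨t, htr, ?_⟩
  have hj : (121 : ZMod r) ^ j = 121 ^ (j % o) := by
    have h1 : (121 : ZMod r) ^ o = 1 := by
      have : ((121 ^ o : ℕ) : ZMod r) = ((1 : ℕ) : ZMod r) := by
        rw [← ZMod.natCast_mod, ho, ZMod.natCast_mod]
      exact_mod_cast this
    conv_lhs => rw [← Nat.mod_add_div j o, pow_add, pow_mul, h1, one_pow, mul_one]
  have hta : (a : ZMod r) = (t : ZMod r) := by
    have : ((t : ℤ) : ZMod r) = ((a % r : ℤ) : ZMod r) := by rw [ht]
    rw [Int.cast_natCast] at this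
    rw [this, ZMod.intCast_mod]
  have h2 := congrArg (Int.cast : ℤ → ZMod r) h
  push_cast at h2
  rw [hj, hta] at h2
  refine (ZMod.natCast_eq_natCast_iff' _ _ _).1 ?_
  push_cast
  linear_combination h2

lemma pow_eleven_re_ne {a : ℤ} {j : ℕ} :
    (121 ^ j) ^ 5 - 55 * (121 ^ j) ^ 4 * a ^ 2 + 330 * (121 ^ j) ^ 3 * a ^ 4
      - 462 * (121 ^ j) ^ 2 * a ^ 6 + 165 * 121 ^ j * a ^ 8 - 11 * a ^ 10 ≠ -11 := by
  intro h
  obtain ⟨t, ht, h1⟩ := pow_eleven_re_reduce (r := 19) (o := 3) (by norm_num) (by norm_num) h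
  have h1 := pow_eleven_re_residues_mod_nineteen _ (Nat.mod_lt _ (by norm_num)) t ht h1
  obtain ⟨t, ht, h2⟩ := pow_eleven_re_reduce (r := 13) (o := 6) (by norm_num) (by norm_num) h
  have h2 := pow_eleven_re_residues_mod_thirteen _ (Nat.mod_lt _ (by norm_num)) t ht h2
  obtain ⟨t, ht, h3⟩ := pow_eleven_re_reduce (r := 41) (o := 20) (by norm_num) (by norm_num) h
  have h3 := pow_eleven_re_residues_mod_fortyOne _ (Nat.mod_lt _ (by norm_num)) t ht h3
  omega

lemma GaussianInt.abs_pow_eleven_re_ne {a b : ℤ} (ha : Even a) (hab : IsCoprime a b)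
    {k : ℕ} (hb : (11 : ℤ) ∣ b) (hbk : b ∣ 11 ^ k) :
    |((⟨b, a⟩ : GaussianInt) ^ 11).re| ≠ 11 ^ k := by
  intro h
  rw [GaussianInt.pow_eleven_re] at h
  have hP : Prime (11 : ℤ) := by norm_num
  have ha11 : ¬ (11 : ℤ) ∣ a := fun hc => hP.not_isUnit (hab.isUnit_of_dvd' hc hb)
  obtain ⟨j, -, hj⟩ := eq_or_eq_neg_of_dvd_eleven_pow hbk
  have hb2 : b ^ 2 = 121 ^ j := by
    rcases hj with rfl | rfl
    · rw [← pow_mul, mul_comm, pow_mul]; norm_num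
    · rw [neg_sq, ← pow_mul, mul_comm, pow_mul]; norm_num
  have hk : k ≠ 0 := by
    rintro rfl
    exact hP.not_isUnit (isUnit_of_dvd_one (hb.trans (by simpa using hbk)))
  obtain ⟨k, rfl⟩ := Nat.exists_eq_succ_of_ne_zero hk
  set u := (b ^ 2) ^ 5 - 55 * (b ^ 2) ^ 4 * a ^ 2 + 330 * (b ^ 2) ^ 3 * a ^ 4
      - 462 * (b ^ 2) ^ 2 * a ^ 6 + 165 * b ^ 2 * a ^ 8 - 11 * a ^ 10 with hu
  obtain ⟨v, hv, hv11⟩ : ∃ v, u = 11 * v ∧ ¬ (11 : ℤ) ∣ v := by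
    obtain ⟨c, rfl⟩ := hb
    refine ⟨11 * (11 ^ 8 * c ^ 10 - 55 * 11 ^ 6 * c ^ 8 * a ^ 2 + 330 * 11 ^ 4 * c ^ 6 * a ^ 4
      - 462 * 11 ^ 2 * c ^ 4 * a ^ 6 + 165 * c ^ 2 * a ^ 8) - a ^ 10, by rw [hu]; ring, ?_⟩
    rw [dvd_sub_right (dvd_mul_right _ _)]
    exact fun hc => ha11 (hP.dvd_of_dvd_pow hc)
  have hv1 : v = 1 ∨ v = -1 := by
    apply eq_one_or_eq_neg_one_of_dvd_eleven_pow (k := k) _ hv11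
    have : 11 * v ∣ 11 * 11 ^ k := by
      rw [← hv, ← pow_succ', ← h, dvd_abs]
      exact dvd_mul_left _ _
    exact (mul_dvd_mul_iff_left (by norm_num)).1 this
  have hbodd : Odd (b ^ 2) := by
    rw [hb2]
    exact Odd.pow (by decide)
  rcases hv1 with rfl | rfl
  · obtain ⟨e, rfl⟩ := ha.two_dvd
    have h8 : (4 : ℤ) ∣ (b ^ 2) ^ 5 - 1 := by
      rw [hb2, ← pow_mul, mul_comm, pow_mul]
      refine (by norm_num : (4 : ℤ) ∣ 121 ^ 5 - 1).trans ?_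
      have := sub_dvd_pow_sub_pow ((121 : ℤ) ^ 5) 1 j
      rwa [one_pow] at this
    obtain ⟨f, hf⟩ := h8
    have : (b ^ 2) ^ 5 - 11 = 4 * (55 * (b ^ 2) ^ 4 * e ^ 2 - 330 * (b ^ 2) ^ 3 * 4 * e ^ 4
      + 462 * (b ^ 2) ^ 2 * 16 * e ^ 6 - 165 * b ^ 2 * 64 * e ^ 8 + 11 * 256 * e ^ 10) := by
      linear_combination hv - hu
    omega
  · rw [hv, hb2] at hu
    exact pow_eleven_re_ne (by linear_combination -hu)

lemma GaussianInt.abs_pow_re_ne {p : ℕ} (hp : p.Prime) (hp5 : 5 ≤ p) {a b : ℤ} (ha : Even a)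
    (ha0 : a ≠ 0) (hb : Odd b) (hab : IsCoprime a b) {k : ℕ} (hbk : b ∣ 11 ^ k) :
    |((⟨b, a⟩ : GaussianInt) ^ p).re| ≠ 11 ^ k := by
  intro h
  by_cases hp11 : p = 11
  · subst hp11
    by_cases hb11 : (11 : ℤ) ∣ b
    · exact GaussianInt.abs_pow_eleven_re_ne ha hab hb11 hbk h
    · obtain ⟨h1, -⟩ := GaussianInt.pow_re_eq_of_abs ha hb hab hp hp5 (Or.inr hb11) hbk h
      apply (four_dvd_of_re_pow_eq (by decide) (by norm_num) ha ha0 hb h1).2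
      rcases eq_one_or_eq_neg_one_of_dvd_eleven_pow hbk hb11 with rfl | rfl <;> norm_num
  · obtain ⟨h1, h2⟩ := GaussianInt.pow_re_eq_of_abs ha hb hab hp hp5 (Or.inl hp11) hbk h
    exact re_pow_ne_of_eq_pow hp (by omega) hp11 ha ha0 h2 h1

/-- The equation `x ^ 2 + 11 ^ (2 * k) = y ^ p` has no solutions for primes `p ≥ 5`. -/
lemma sq_add_eleven_pow_even_ne {p : ℕ} (hp : p.Prime) (hp5 : 5 ≤ p) {x y : ℤ} (hx : Even x)
    (hx0 : x ≠ 0) (hxy : IsCoprime x y) (k : ℕ) : x ^ 2 + 11 ^ (2 * k) ≠ y ^ p := by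
  intro h
  have hodd : Odd p := hp.odd_of_ne_two (by omega)
  rw [mul_comm 2 k, pow_mul] at h
  obtain ⟨a, b, ha, ha0, hb, -, hab, hbk, h1⟩ := exists_re_pow_eq hodd hx hx0
    (Odd.pow (by decide)) hxy h
  rw [abs_of_pos (by positivity : (0 : ℤ) < 11 ^ k)] at h1
  exact GaussianInt.abs_pow_re_ne hp hp5 ha ha0 hb hab hbk h1

/-- The equation `x ^ 2 + 11 ^ (2 * k) = y ^ 3` only has the solution with `k = 1`. -/
lemma eq_of_sq_add_eleven_pow_even_eq_cube {x y : ℤ} (hx : Even x)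
    (hx0 : x ≠ 0) (hxy : IsCoprime x y) {k : ℕ} (h : x ^ 2 + 11 ^ (2 * k) = y ^ 3) :
    k = 1 ∧ x ^ 2 = 4 ∧ y = 5 := by
  have h0 := h
  rw [mul_comm 2 k, pow_mul] at h
  obtain ⟨a, b, ha, ha0, hb, hy, hab, hbk, h1⟩ := exists_re_pow_eq (by decide) hx hx0
    (Odd.pow (by decide)) hxy h
  rw [abs_of_pos (by positivity : (0 : ℤ) < 11 ^ k)] at h1
  have h3 : ((⟨b, a⟩ : GaussianInt) ^ 3).re = b * (b ^ 2 - 3 * a ^ 2) := by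
    rw [pow_succ, pow_two]
    simp; ring
  rw [h3] at h1
  have hP : Prime (11 : ℤ) := by norm_num
  have hu : b ^ 2 - 3 * a ^ 2 ∣ 11 ^ k := by
    rw [← h1, dvd_abs]; exact dvd_mul_left _ _
  obtain ⟨i, hi, hi1⟩ := eq_or_eq_neg_of_dvd_eleven_pow hu
  have hmod : ∀ i : ℕ, (11 : ℤ) ^ i % 3 = 1 ∧ Even i ∨ (11 : ℤ) ^ i % 3 = 2 ∧ Odd i := by
    intro i
    induction i with
    | zero => left; decide
    | succ i ih =>
      rw [pow_succ, Nat.even_add_one, Nat.not_even_iff_odd, Nat.odd_add_one, Nat.not_odd_iff_even]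
      rcases ih with ⟨h1, h2⟩ | ⟨h1, h2⟩
      · exact Or.inr ⟨by omega, h2⟩
      · exact Or.inl ⟨by omega, h2⟩
  by_cases hb11 : (11 : ℤ) ∣ b
  · have hu1 : ¬ (11 : ℤ) ∣ b ^ 2 - 3 * a ^ 2 := by
      intro hc
      rw [dvd_sub_right (hb11.trans (dvd_pow_self b two_ne_zero))] at hc
      rcases hP.dvd_or_dvd hc with hc | hc
      · norm_num at hc
      · exact hP.not_isUnit (hab.isUnit_of_dvd' (hP.dvd_of_dvd_pow hc) hb11)
    have hb3 : b ^ 2 % 3 = 0 ∨ b ^ 2 % 3 = 1 := by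
      have : b % 3 = 0 ∨ b % 3 = 1 ∨ b % 3 = 2 := by omega
      rcases this with h | h | h <;> simp [pow_two, Int.mul_emod, h]
    have h4 : ∀ a : ℤ, (11 : ℤ) ∣ 3 * a ^ 2 + 1 → False := by
      intro a
      rw [eleven_dvd_iff_zmod]
      push_cast
      generalize (a : ZMod 11) = a
      revert a
      decide
    rcases eq_one_or_eq_neg_one_of_dvd_eleven_pow hu hu1 with h5 | h5
    · refine (h4 a ?_).elim
      rw [show 3 * a ^ 2 + 1 = b ^ 2 by linarith]
      exact hb11.trans (dvd_pow_self b two_ne_zero)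
    · omega
  · have hb1 : b ^ 2 = 1 := by
      rcases eq_one_or_eq_neg_one_of_dvd_eleven_pow hbk hb11 with rfl | rfl <;> norm_num
    rw [hb1] at hi1
    have hapos : 0 < a ^ 2 := by positivity
    have h11pos : (0 : ℤ) < 11 ^ i := by positivity
    have hi2 : 3 * a ^ 2 = 11 ^ i + 1 := by omega
    obtain ⟨m, rfl⟩ : Odd i := by
      rcases hmod i with ⟨h6, -⟩ | ⟨-, h6⟩
      · omega
      · exact h6
    have h6 : m = 0 := by
      apply eq_zero_of_three_mul_sq_eq (u := a.natAbs)
      zify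
      rw [sq_abs, hi2, pow_succ, mul_comm 2, pow_mul, mul_comm]
    subst h6
    have ha2 : a ^ 2 = 4 := by norm_num at hi2; linarith
    have hy5 : y = 5 := by rw [hy, ha2, hb1]; norm_num
    have hk : k = 1 := by
      rw [abs_mul, hb1, ha2] at h1
      have hb2 : |b| = 1 := by
        rw [← sq_abs] at hb1
        nlinarith [abs_nonneg b]
      rw [hb2] at h1
      norm_num at h1
      have : (11 : ℤ) ^ k = 11 ^ 1 := by rw [← h1]; norm_num
      exact Int.pow_right_injective (by norm_num) this
    subst hk
    refine ⟨rfl, ?_, hy5⟩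
    rw [hy5] at h0
    norm_num at h0
    linarith

/-- The ring of integers `ℤ[(1 + √-11) / 2]`. -/
abbrev HalfSqrtNegEleven : Type := QuadraticAlgebra ℤ (-3) 1

namespace HalfSqrtNegEleven

lemma four_mul_norm (z : HalfSqrtNegEleven) :
    4 * z.norm = (2 * z.re + z.im) ^ 2 + 11 * z.im ^ 2 := by
  rw [QuadraticAlgebra.norm_def]; ring

lemma norm_nonneg (z : HalfSqrtNegEleven) : 0 ≤ z.norm := by
  have := four_mul_norm z
  nlinarith [sq_nonneg (2 * z.re + z.im), sq_nonneg z.im]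

lemma norm_pos {z : HalfSqrtNegEleven} (hz : z ≠ 0) : 0 < z.norm := by
  refine (norm_nonneg z).lt_of_ne' fun h => hz ?_
  have h1 := four_mul_norm z
  have h2 : z.im = 0 := by
    by_contra hc
    have : 0 < z.im ^ 2 := by positivity
    nlinarith [sq_nonneg (2 * z.re + z.im)]
  have h3 : z.re = 0 := by
    by_contra hc
    have : 0 < z.re ^ 2 := by positivity
    rw [h2, h] at h1
    linarith
  exact QuadraticAlgebra.ext h3 h2

instance : IsDomain HalfSqrtNegEleven := by
  have : NoZeroDivisors HalfSqrtNegEleven := ⟨fun {x y} h => by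
    by_contra! hc
    have h1 := mul_pos (norm_pos hc.1) (norm_pos hc.2)
    rw [← map_mul, h, QuadraticAlgebra.norm_zero] at h1
    exact h1.false⟩
  exact NoZeroDivisors.to_isDomain _

lemma exists_abs_two_mul_sub_le {n : ℤ} (hn : 0 < n) (t : ℤ) : ∃ q, |2 * (n * q) - t| ≤ n := by
  refine ⟨(t + n) / (2 * n), ?_⟩
  have h1 := Int.mul_ediv_add_emod (t + n) (2 * n)
  have h2 := Int.emod_nonneg (t + n) (by positivity : 2 * n ≠ 0)
  have h3 := Int.emod_lt_of_pos (t + n) (by positivity : 0 < 2 * n)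
  rw [abs_le]
  constructor <;> linarith

lemma exists_norm_sub_mul_lt (x : HalfSqrtNegEleven) {g : HalfSqrtNegEleven} (hg : g ≠ 0) :
    ∃ q, (x - q * g).norm < g.norm := by
  have hn := norm_pos hg
  set n := g.norm with hn_def
  set w := x * star g with hw
  obtain ⟨d, hd⟩ := exists_abs_two_mul_sub_le hn (2 * w.im)
  obtain ⟨c, hc⟩ := exists_abs_two_mul_sub_le hn (2 * w.re + w.im - n * d)
  refine ⟨⟨c, d⟩, ?_⟩
  have h1 : (x - ⟨c, d⟩ * g) * star g = ⟨w.re - n * c, w.im - n * d⟩ := by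
    rw [sub_mul, mul_assoc, ← QuadraticAlgebra.algebraMap_norm_eq_mul_star, ← hw, ← hn_def]
    ext
    · simp [mul_comm]
    · simp [mul_comm]
  have h2 := congrArg QuadraticAlgebra.norm h1
  rw [map_mul, QuadraticAlgebra.norm_star, ← hn_def] at h2
  have h3 := four_mul_norm ⟨w.re - n * c, w.im - n * d⟩
  dsimp only at h3
  rw [← h2] at h3
  have h4 : (2 * (w.re - n * c) + (w.im - n * d)) ^ 2 ≤ n ^ 2 := by
    rw [show 2 * (w.re - n * c) + (w.im - n * d) =
      -(2 * (n * c) - (2 * w.re + w.im - n * d)) by ring, neg_sq, ← sq_abs]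
    gcongr
  have h5 : 4 * (w.im - n * d) ^ 2 ≤ n ^ 2 := by
    rw [show 4 * (w.im - n * d) ^ 2 = (2 * (n * d) - 2 * w.im) ^ 2 by ring, ← sq_abs]
    gcongr
  refine lt_of_mul_lt_mul_right ?_ hn.le
  nlinarith

instance : IsPrincipalIdealRing HalfSqrtNegEleven := by
  refine ⟨fun I => ?_⟩
  by_cases hI : I = ⊥
  · rw [hI]; exact bot_isPrincipal
  obtain ⟨x, hx, hx0⟩ := Submodule.exists_mem_ne_zero_of_ne_bot hI
  obtain ⟨g, ⟨hg, hg0⟩, hmin⟩ := WellFounded.has_min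
    (measure fun z : HalfSqrtNegEleven => z.norm.toNat).wf {z | z ∈ I ∧ z ≠ 0} ⟨x, hx, hx0⟩
  refine ⟨⟨g, le_antisymm (fun z hz => ?_) ((Ideal.span_singleton_le_iff_mem I).2 hg)⟩⟩
  obtain ⟨q, hq⟩ := exists_norm_sub_mul_lt z hg0
  have hmem : z - q * g ∈ I := I.sub_mem hz (I.mul_mem_left q hg)
  have h0 : z - q * g = 0 := by
    by_contra hc
    refine hmin _ ⟨hmem, hc⟩ ?_
    have := norm_nonneg (z - q * g)
    change (z - q * g).norm.toNat < g.norm.toNat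
    omega
  rw [sub_eq_zero] at h0
  exact Ideal.mem_span_singleton'.2 ⟨q, h0.symm⟩

lemma pow_four_eq_one_of_isUnit (u : HalfSqrtNegEleven) (hu : IsUnit u) : u ^ 4 = 1 := by
  have h1 : u.norm = 1 := by
    have h2 := QuadraticAlgebra.isUnit_iff_norm_isUnit.1 hu
    rcases Int.isUnit_iff.1 h2 with h | h
    · exact h
    · have := norm_nonneg u
      omega
  have h2 := four_mul_norm u
  have h3 : u.im = 0 := by
    by_contra hc
    have : 0 < u.im ^ 2 := by positivity
    nlinarith [sq_nonneg (2 * u.re + u.im)]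
  rw [h1, h3] at h2
  have h4 : u.re ^ 2 = 1 := by linarith
  have h5 : u ^ 2 = 1 := by
    rw [pow_two]
    ext
    · rw [QuadraticAlgebra.re_mul, QuadraticAlgebra.re_one, h3]; linarith
    · rw [QuadraticAlgebra.im_mul, QuadraticAlgebra.im_one, h3]; ring
  rw [show (4 : ℕ) = 2 * 2 by rfl, pow_mul, h5, one_pow]

/-- The inclusion of `ℤ[√-11]`. -/
def ofZsqrtd : ℤ√(-11) →+* HalfSqrtNegEleven :=
  Zsqrtd.lift ⟨⟨-1, 2⟩, by rw [QuadraticAlgebra.mk_mul_mk]; rfl⟩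

lemma ofZsqrtd_mk (a b : ℤ) : ofZsqrtd ⟨a, b⟩ = ⟨a - b, 2 * b⟩ := by
  ext
  · simp [ofZsqrtd, Zsqrtd.lift]; ring
  · simp [ofZsqrtd, Zsqrtd.lift]; ring

lemma ofZsqrtd_injective : Function.Injective ofZsqrtd := by
  rintro ⟨a, b⟩ ⟨c, d⟩ h
  rw [ofZsqrtd_mk, ofZsqrtd_mk, QuadraticAlgebra.ext_iff] at h
  dsimp only at h
  rw [Zsqrtd.ext_iff]
  dsimp only
  omega

lemma cube_eq_of_odd {z : HalfSqrtNegEleven} (hz : Odd z.im) : ∃ w, z ^ 3 = 1 + (w + w) := by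
  obtain ⟨e, f⟩ := z
  obtain ⟨f, rfl⟩ := hz
  obtain ⟨e, rfl | rfl⟩ := Int.even_or_odd' e
  all_goals rw [pow_succ, pow_two]
  · refine ⟨⟨4 * e ^ 3 - 9 * e * (2 * f + 1) ^ 2 - 12 * f ^ 3 - 18 * f ^ 2 - 9 * f - 2,
      6 * e ^ 2 * (2 * f + 1) + 3 * e * (2 * f + 1) ^ 2 - (2 * f + 1) ^ 3⟩, ?_⟩
    ext
    · simp [QuadraticAlgebra.re_one]; ring
    · simp [QuadraticAlgebra.im_one]; ring
  · refine ⟨⟨4 * e ^ 3 + 6 * e ^ 2 - 6 * e - 36 * e * f - 36 * e * f ^ 2 - 12 * f ^ 3 - 36 * f ^ 2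
      - 27 * f - 6, 12 * e ^ 2 * f + 24 * e * f + 12 * e * f ^ 2 + 6 * e ^ 2 + 9 * e
      - 8 * f ^ 3 - 6 * f ^ 2 + 3 * f + 2⟩, ?_⟩
    ext
    · simp [QuadraticAlgebra.re_one]; ring
    · simp [QuadraticAlgebra.im_one]; ring

lemma odd_im_pow {z : HalfSqrtNegEleven} (hz : Odd z.im) {p : ℕ} (hp : ¬ 3 ∣ p) :
    Odd (z ^ p).im := by
  obtain ⟨w, hw⟩ := cube_eq_of_odd hz
  have h1 : ∀ q : ℕ, ∃ v, (z ^ 3) ^ q = 1 + (v + v) := by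
    intro q
    induction q with
    | zero => exact ⟨0, by simp⟩
    | succ q ih =>
      obtain ⟨v, hv⟩ := ih
      refine ⟨v + w + v * w + v * w, ?_⟩
      rw [pow_succ, hv, hw]
      ring
  obtain ⟨v, hv⟩ := h1 (p / 3)
  have h2 : ∀ t : HalfSqrtNegEleven, Odd t.im → Odd ((1 + (v + v)) * t).im := by
    intro t ht
    rw [show (1 + (v + v)) * t = t + (v * t + v * t) by ring, QuadraticAlgebra.im_add,
      QuadraticAlgebra.im_add]
    exact ht.add_even (Even.add_self _)
  rw [← Nat.div_add_mod p 3, pow_add, pow_mul, hv]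
  apply h2
  have h3 : p % 3 = 1 ∨ p % 3 = 2 := by omega
  rcases h3 with h3 | h3 <;> rw [h3]
  · rwa [pow_one]
  · rw [pow_two, QuadraticAlgebra.im_mul, one_mul, mul_comm z.im, ← two_mul]
    exact (even_two_mul _).add_odd (hz.mul hz)

lemma exists_pow_eq {p : ℕ} (hp : Odd p) {x y : ℤ} (hx : Even x) (hxy : IsCoprime x y) {k : ℕ}
    (h : x ^ 2 + 11 ^ (2 * k + 1) = y ^ p) :
    ∃ z : HalfSqrtNegEleven, z ^ p = ⟨x - 11 ^ k, 2 * 11 ^ k⟩ ∧ z.norm = y := by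
  have hodd : Odd (y ^ p) := by
    rw [← h]
    exact (hx.pow_of_ne_zero two_ne_zero).add_odd (Odd.pow (by decide))
  have hcop : IsCoprime (y ^ p) (2 * x) := by
    obtain ⟨c, hc⟩ := hodd
    refine IsCoprime.mul_right ⟨1, -c, by rw [hc]; ring⟩ hxy.symm.pow_left
  have hmul : (⟨x - 11 ^ k, 2 * 11 ^ k⟩ : HalfSqrtNegEleven) * ⟨x + 11 ^ k, -2 * 11 ^ k⟩ =
      (y : HalfSqrtNegEleven) ^ p := by
    rw [← Int.cast_pow, ← h]
    ext
    · rw [QuadraticAlgebra.re_mul, QuadraticAlgebra.re_intCast, Int.cast_id]; ring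
    · rw [QuadraticAlgebra.im_mul, QuadraticAlgebra.im_intCast]; ring
  obtain ⟨g, hg⟩ := exists_pow_eq_of_isCoprime pow_four_eq_one_of_isUnit hp
    (isCoprime_of_add (m := y ^ p) (t := 2 * x) (by rw [hmul, Int.cast_pow]) (by
      ext
      · rw [QuadraticAlgebra.re_add, QuadraticAlgebra.re_intCast, Int.cast_id]; ring
      · rw [QuadraticAlgebra.im_add, QuadraticAlgebra.im_intCast]; ring) hcop) hmul
  refine ⟨g, hg.symm, hp.strictMono_pow.injective ?_⟩
  rw [← map_pow, ← hg, ← h, QuadraticAlgebra.norm_def]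
  ring

/-- The data carried by a solution of `x ^ 2 + 11 ^ (2 * k + 1) = y ^ p` whose base lies in the
order `ℤ[√-11]`. -/
lemma exists_zsqrtd_of_even {p : ℕ} (hp : Odd p) {x y : ℤ} (hx : Even x) (hxy : IsCoprime x y)
    {k : ℕ} (h : x ^ 2 + 11 ^ (2 * k + 1) = y ^ p) {z : HalfSqrtNegEleven}
    (hz : z ^ p = ⟨x - 11 ^ k, 2 * 11 ^ k⟩) (hy : z.norm = y) (heven : Even z.im) :
    ∃ a b : ℤ, ((⟨a, b⟩ : ℤ√(-11)) ^ p).im = 11 ^ k ∧ y = a ^ 2 + 11 * b ^ 2 ∧ b ∣ 11 ^ k ∧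
      Even a ∧ a ≠ 0 ∧ ¬ (11 : ℤ) ∣ a := by
  obtain ⟨b, hb⟩ := heven.two_dvd
  have hz' : z = ofZsqrtd ⟨z.re + b, b⟩ := by
    rw [ofZsqrtd_mk]
    ext
    · dsimp only; ring
    · exact hb
  set a := z.re + b
  have h1 : (⟨a, b⟩ : ℤ√(-11)) ^ p = ⟨x, 11 ^ k⟩ := by
    apply ofZsqrtd_injective
    rw [map_pow, ← hz', hz, ofZsqrtd_mk]
  have hyab : y = a ^ 2 + 11 * b ^ 2 := by
    rw [← hy, hz', ofZsqrtd_mk, QuadraticAlgebra.norm_def]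
    ring
  have hdvd : b ∣ 11 ^ k := by
    obtain ⟨n, rfl⟩ : ∃ n, p = n + 1 := ⟨p - 1, by have := hp.pos; omega⟩
    obtain ⟨c, -, -, hc⟩ := pow_re_im_expand (-11) a b n
    rw [h1] at hc
    dsimp only at hc
    rw [hc]
    exact ⟨(n + 1) * a ^ n + -11 * b ^ 2 * c, by ring⟩
  have hbodd : Odd b := by
    have : Odd ((11 : ℤ) ^ k) := Odd.pow (by decide)
    rw [hdvd.choose_spec] at this
    exact Int.Odd.of_mul_left this
  have hyodd : Odd y := by
    have : Odd (y ^ p) := by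
      rw [← h]
      exact (hx.pow_of_ne_zero two_ne_zero).add_odd (Odd.pow (by decide))
    exact (Int.odd_pow' hp.pos.ne').1 this
  have hP : Prime (11 : ℤ) := by norm_num
  have ha11 : ¬ (11 : ℤ) ∣ a := by
    intro hc
    have hy11 : (11 : ℤ) ∣ y := by
      rw [hyab]
      exact dvd_add (hc.trans (dvd_pow_self a two_ne_zero)) (dvd_mul_right _ _)
    have hx11 : (11 : ℤ) ∣ x ^ 2 := by
      rw [← dvd_add_left (dvd_pow_self 11 (by omega : 2 * k + 1 ≠ 0)), h]
      exact hy11.trans (dvd_pow_self y hp.pos.ne')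
    exact hP.not_isUnit (hxy.isUnit_of_dvd' (hP.dvd_of_dvd_pow hx11) hy11)
  refine ⟨a, b, by rw [h1], hyab, hdvd, ?_, ?_, ha11⟩
  · by_contra hc
    rw [Int.not_even_iff_odd] at hc
    have : Even y := by
      rw [hyab]
      exact hc.pow.add_odd (Odd.mul (by decide) hbodd.pow)
    exact Int.not_even_iff_odd.2 hyodd this
  · rintro h0
    rw [h0] at ha11
    exact ha11 (dvd_zero _)

end HalfSqrtNegEleven

lemma zsqrtd_pow_eleven_im (a b : ℤ) : ((⟨a, b⟩ : ℤ√(-11)) ^ 11).im =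
    b * (11 * (a ^ 10 - 165 * b ^ 2 * a ^ 8 + 5082 * (b ^ 2) ^ 2 * a ^ 6
      - 39930 * (b ^ 2) ^ 3 * a ^ 4 + 73205 * (b ^ 2) ^ 4 * a ^ 2 - 14641 * (b ^ 2) ^ 5)) := by
  have h3 : (⟨a, b⟩ : ℤ√(-11)) ^ 3 =
      ⟨a ^ 3 - 33 * a * b ^ 2, 3 * a ^ 2 * b - 11 * b ^ 3⟩ := by
    rw [pow_succ, pow_two, Zsqrtd.ext_iff]
    constructor
    · simp; ring
    · simp; ring
  have h2 : ∀ a b : ℤ, (⟨a, b⟩ : ℤ√(-11)) ^ 2 = ⟨a ^ 2 - 11 * b ^ 2, 2 * a * b⟩ := by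
    intro a b
    rw [pow_two, Zsqrtd.ext_iff]
    constructor
    · simp; ring
    · simp; ring
  rw [show (11 : ℕ) = 3 * 2 + 3 + 2 by rfl, pow_add, pow_add, pow_mul, h3, h2, h2,
    Zsqrtd.im_mul, Zsqrtd.im_mul, Zsqrtd.re_mul]
  ring

lemma pow_eleven_im_residues_mod_thirtyOne : ∀ j < 15, ∀ a < 31,
    (a ^ 10 + 5082 * (121 ^ j) ^ 2 * a ^ 6 + 73205 * (121 ^ j) ^ 4 * a ^ 2 + 1) % 31 ≠
    (165 * 121 ^ j * a ^ 8 + 39930 * (121 ^ j) ^ 3 * a ^ 4 + 14641 * (121 ^ j) ^ 5) % 31 := by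
  decide +kernel

lemma pow_eleven_im_ne {a : ℤ} {j : ℕ} :
    a ^ 10 - 165 * 121 ^ j * a ^ 8 + 5082 * (121 ^ j) ^ 2 * a ^ 6
      - 39930 * (121 ^ j) ^ 3 * a ^ 4 + 73205 * (121 ^ j) ^ 4 * a ^ 2
      - 14641 * (121 ^ j) ^ 5 ≠ -1 := by
  intro h
  obtain ⟨t, ht⟩ := Int.eq_ofNat_of_zero_le (Int.emod_nonneg a (by norm_num : (31 : ℤ) ≠ 0))
  have htr : t < 31 := by
    have := Int.emod_lt_of_pos a (by norm_num : (0 : ℤ) < 31)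
    omega
  refine pow_eleven_im_residues_mod_thirtyOne (j % 15) (Nat.mod_lt _ (by norm_num)) t htr ?_
  have hj : (121 : ZMod 31) ^ j = 121 ^ (j % 15) := by
    have h1 : (121 : ZMod 31) ^ 15 = 1 := by decide
    conv_lhs => rw [← Nat.mod_add_div j 15, pow_add, pow_mul, h1, one_pow, mul_one]
  have hta : (a : ZMod 31) = (t : ZMod 31) := by
    have : ((t : ℤ) : ZMod 31) = ((a % (31 : ℕ) : ℤ) : ZMod 31) := by
      rw [Nat.cast_ofNat, ht]
    rw [Int.cast_natCast] at this
    rw [this, ZMod.intCast_mod]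
  have h2 := congrArg (Int.cast : ℤ → ZMod 31) h
  push_cast at h2
  rw [hj, hta] at h2
  refine (ZMod.natCast_eq_natCast_iff' _ _ 31).1 ?_
  push_cast
  linear_combination h2

lemma zsqrtd_pow_eleven_im_ne {a b : ℤ} (ha : Even a) (ha11 : ¬ (11 : ℤ) ∣ a) {k : ℕ}
    (hbk : b ∣ 11 ^ k) : ((⟨a, b⟩ : ℤ√(-11)) ^ 11).im ≠ 11 ^ k := by
  intro h
  rw [zsqrtd_pow_eleven_im] at h
  have hP : Prime (11 : ℤ) := by norm_num
  obtain ⟨j, -, hj⟩ := eq_or_eq_neg_of_dvd_eleven_pow hbk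
  have hb2 : b ^ 2 = 121 ^ j := by
    rcases hj with rfl | rfl
    · rw [← pow_mul, mul_comm, pow_mul]; norm_num
    · rw [neg_sq, ← pow_mul, mul_comm, pow_mul]; norm_num
  set v := a ^ 10 - 165 * b ^ 2 * a ^ 8 + 5082 * (b ^ 2) ^ 2 * a ^ 6
      - 39930 * (b ^ 2) ^ 3 * a ^ 4 + 73205 * (b ^ 2) ^ 4 * a ^ 2 - 14641 * (b ^ 2) ^ 5 with hv
  have hv11 : ¬ (11 : ℤ) ∣ v := by
    rw [show v = a ^ 10 + 11 * (-15 * b ^ 2 * a ^ 8 + 462 * (b ^ 2) ^ 2 * a ^ 6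
      - 3630 * (b ^ 2) ^ 3 * a ^ 4 + 6655 * (b ^ 2) ^ 4 * a ^ 2 - 1331 * (b ^ 2) ^ 5) by
        rw [hv]; ring, dvd_add_left (dvd_mul_right _ _)]
    exact fun hc => ha11 (hP.dvd_of_dvd_pow hc)
  have hv1 : v ∣ 11 ^ k := by
    rw [← h]
    exact (dvd_mul_left _ _).mul_left _
  rcases eq_one_or_eq_neg_one_of_dvd_eleven_pow hv1 hv11 with h1 | h1
  · obtain ⟨e, rfl⟩ := ha.two_dvd
    have h8 : (4 : ℤ) ∣ 14641 * (b ^ 2) ^ 5 - 1 := by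
      have h9 : (4 : ℤ) ∣ (121 ^ 5) ^ j - 1 := by
        refine (by norm_num : (4 : ℤ) ∣ 121 ^ 5 - 1).trans ?_
        have := sub_dvd_pow_sub_pow ((121 : ℤ) ^ 5) 1 j
        rwa [one_pow] at this
      rw [hb2, ← pow_mul, mul_comm j, pow_mul]
      omega
    obtain ⟨f, hf⟩ := h8
    have : 14641 * (b ^ 2) ^ 5 + 1 = 4 * (256 * e ^ 10 - 165 * b ^ 2 * 64 * e ^ 8
      + 5082 * (b ^ 2) ^ 2 * 16 * e ^ 6 - 39930 * (b ^ 2) ^ 3 * 4 * e ^ 4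
      + 73205 * (b ^ 2) ^ 4 * e ^ 2) := by
      linear_combination hv - h1
    omega
  · rw [h1, hb2] at hv
    exact pow_eleven_im_ne hv.symm

lemma zsqrtd_pow_im_ne {p : ℕ} (hp : p.Prime) (hp5 : 5 ≤ p) {a b : ℤ} (ha : Even a)
    (ha0 : a ≠ 0) (ha11 : ¬ (11 : ℤ) ∣ a) {k : ℕ} (hbk : b ∣ 11 ^ k) :
    ((⟨a, b⟩ : ℤ√(-11)) ^ p).im ≠ 11 ^ k := by
  by_cases hp11 : p = 11
  · subst hp11
    exact zsqrtd_pow_eleven_im_ne ha ha11 hbk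
  intro h
  have hP : Prime (11 : ℤ) := by norm_num
  obtain ⟨n, rfl⟩ : ∃ n, p = n + 1 := ⟨p - 1, by omega⟩
  obtain ⟨c, -, -, hc⟩ := pow_re_im_expand (-11) a b n
  have hu : ((n + 1) * a ^ n + -11 * b ^ 2 * c) = 1 ∨ ((n + 1) * a ^ n + -11 * b ^ 2 * c) = -1 := by
    apply eq_one_or_eq_neg_one_of_dvd_eleven_pow (k := k)
    · rw [← h, hc]
      exact ⟨b, by ring⟩
    · rw [show -11 * b ^ 2 * c = 11 * (-b ^ 2 * c) by ring, dvd_add_left (dvd_mul_right _ _)]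
      intro hd
      rcases hP.dvd_or_dvd hd with hd | hd
      · have : 11 ∣ n + 1 := by exact_mod_cast hd
        exact hp11 ((Nat.prime_dvd_prime_iff_eq (by norm_num) hp).1 this).symm
      · exact ha11 (hP.dvd_of_dvd_pow hd)
  have him : ((⟨a, b⟩ : ℤ√(-11)) ^ (n + 1)).im = b * ((n + 1) * a ^ n + -11 * b ^ 2 * c) := by
    rw [hc]; ring
  rw [h] at him
  rcases hu with hu | hu
  · rw [hu, mul_one] at him
    subst him
    exact pow_im_ne_of_abs hp hp5 hp11 ha ha0 ha11 (k := k) (by rw [h, abs_of_pos (by positivity)])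
  · rw [hu] at him
    have hb : b = -11 ^ k := by linarith
    have h1 : ((⟨a, 11 ^ k⟩ : ℤ√(-11)) ^ (n + 1)).im = -11 ^ k := by
      rw [show (⟨a, 11 ^ k⟩ : ℤ√(-11)) = star ⟨a, b⟩ by rw [hb, Zsqrtd.star_mk, neg_neg],
        ← star_pow, Zsqrtd.im_star, h]
    exact pow_im_ne_of_abs hp hp5 hp11 ha ha0 ha11 (k := k)
      (by rw [h1, abs_neg, abs_of_pos (by positivity)])

/-- The equation `x ^ 2 + 11 ^ (2 * k + 1) = y ^ p` has no solutions for primes `p ≥ 5`. -/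
lemma sq_add_eleven_pow_odd_ne {p : ℕ} (hp : p.Prime) (hp5 : 5 ≤ p) {x y : ℤ} (hx : Even x)
    (hxy : IsCoprime x y) (k : ℕ) : x ^ 2 + 11 ^ (2 * k + 1) ≠ y ^ p := by
  intro h
  have hodd : Odd p := hp.odd_of_ne_two (by omega)
  obtain ⟨z, hz, hy⟩ := HalfSqrtNegEleven.exists_pow_eq hodd hx hxy h
  rcases Int.even_or_odd z.im with he | ho
  · obtain ⟨a, b, him, -, hbk, ha, ha0, ha11⟩ :=
      HalfSqrtNegEleven.exists_zsqrtd_of_even hodd hx hxy h hz hy he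
    exact zsqrtd_pow_im_ne hp hp5 ha ha0 ha11 hbk him
  · have h3 : ¬ 3 ∣ p := by
      intro h3
      have := (Nat.prime_dvd_prime_iff_eq (by norm_num) hp).1 h3
      omega
    have := HalfSqrtNegEleven.odd_im_pow ho h3
    rw [hz] at this
    exact Int.not_even_iff_odd.2 this (even_two_mul _)

/-- The solutions of `x ^ 2 + 11 ^ (2 * k + 1) = y ^ 3` have `k ≤ 1`. -/
lemma eq_of_sq_add_eleven_pow_odd_eq_cube {x y : ℤ} (hx : Even x) (hxy : IsCoprime x y) {k : ℕ}
    (h : x ^ 2 + 11 ^ (2 * k + 1) = y ^ 3) :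
    k = 0 ∧ (y = 3 ∨ y = 15) ∨ k = 1 ∧ y = 443 := by
  have hP : Prime (11 : ℤ) := by norm_num
  obtain ⟨z, hz, hy⟩ := HalfSqrtNegEleven.exists_pow_eq (by decide) hx hxy h
  have hsq : ((11 : ℤ) ^ k) ^ 2 % 3 = 1 := by
    have h1 : ∀ k : ℕ, (11 : ℤ) ^ k % 3 = 1 ∨ (11 : ℤ) ^ k % 3 = 2 := by
      intro k
      induction k with
      | zero => left; decide
      | succ k ih => rw [pow_succ]; omega
    have h1 := h1 k
    rcases h1 with h1 | h1 <;> simp [pow_two, Int.mul_emod, h1]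
  rcases Int.even_or_odd z.im with he | ho
  · obtain ⟨a, b, him, hyab, hbk, ha, ha0, ha11⟩ :=
      HalfSqrtNegEleven.exists_zsqrtd_of_even (by decide) hx hxy h hz hy he
    have him' : ((⟨a, b⟩ : ℤ√(-11)) ^ 3).im = b * (3 * a ^ 2 - 11 * b ^ 2) := by
      rw [pow_succ, pow_two]
      simp; ring
    rw [him'] at him
    have hu := eq_one_or_eq_neg_one_of_dvd_eleven_pow (Dvd.intro_left b him) (by
      rw [dvd_sub_left (dvd_mul_right _ _)]
      intro hc
      rcases hP.dvd_or_dvd hc with hc | hc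
      · norm_num at hc
      · exact ha11 (hP.dvd_of_dvd_pow hc))
    have hb2 : b ^ 2 = (11 ^ k) ^ 2 := by
      rw [← him, mul_pow]
      rcases hu with hu | hu <;> rw [hu] <;> ring
    have hu1 : 3 * a ^ 2 - 11 * b ^ 2 = 1 := by omega
    have hk : k = 0 := by
      apply eq_zero_of_three_mul_sq_eq (u := a.natAbs)
      zify
      rw [sq_abs]
      linarith
    subst hk
    rw [pow_zero, one_pow] at hb2
    left
    exact ⟨rfl, Or.inr (by omega)⟩
  · set f := z.im with hf
    set s := 2 * z.re + z.im with hs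
    have h4y : 4 * y = s ^ 2 + 11 * f ^ 2 := by
      rw [← hy, HalfSqrtNegEleven.four_mul_norm]
    have him : f * (3 * s ^ 2 - 11 * f ^ 2) = 8 * 11 ^ k := by
      have h1 : (z ^ 3).im = 3 * z.re ^ 2 * f + 3 * z.re * f ^ 2 - 2 * f ^ 3 := by
        rw [pow_succ, pow_two]
        simp; ring
      rw [hz] at h1
      dsimp only at h1
      rw [hs, ← hf]
      linear_combination -4 * h1
    have hs11 : ¬ (11 : ℤ) ∣ s := by
      intro hc
      have hy11 : (11 : ℤ) ∣ y := by
        have : (11 : ℤ) ∣ 4 * y := by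
          rw [h4y]
          exact dvd_add (hc.trans (dvd_pow_self s two_ne_zero)) (dvd_mul_right _ _)
        omega
      have hx11 : (11 : ℤ) ∣ x ^ 2 := by
        rw [← dvd_add_left (dvd_pow_self 11 (by omega : 2 * k + 1 ≠ 0)), h]
        exact hy11.trans (dvd_pow_self y (by norm_num))
      exact hP.not_isUnit (hxy.isUnit_of_dvd' (hP.dvd_of_dvd_pow hx11) hy11)
    have hfk : f ∣ 11 ^ k := by
      have h2 : IsCoprime f 8 := by
        obtain ⟨c, hc⟩ := ho
        have : IsCoprime f (2 ^ 3) := IsCoprime.pow_right ⟨1, -c, by rw [hc]; ring⟩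
        simpa using this
      exact h2.dvd_of_dvd_mul_left (Dvd.intro _ him)
    have hu11 : ¬ (11 : ℤ) ∣ 3 * s ^ 2 - 11 * f ^ 2 := by
      rw [dvd_sub_left (dvd_mul_right _ _)]
      intro hc
      rcases hP.dvd_or_dvd hc with hc | hc
      · norm_num at hc
      · exact hs11 (hP.dvd_of_dvd_pow hc)
    obtain ⟨j, hj, hfj⟩ := eq_or_eq_neg_of_dvd_eleven_pow hfk
    have hkj : k = j := by
      by_contra hne
      obtain ⟨i, rfl⟩ : ∃ i, k = j + (i + 1) := ⟨k - j - 1, by omega⟩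
      have h11 : (11 : ℤ) ^ j ≠ 0 := by positivity
      apply hu11
      rcases hfj with hfj | hfj
      · have h1 : 11 ^ j * (3 * s ^ 2 - 11 * f ^ 2) = 11 ^ j * (11 * (8 * 11 ^ i)) := by
          rw [← hfj, him, hfj, pow_add, pow_succ]; ring
        exact ⟨_, mul_left_cancel₀ h11 h1⟩
      · have h1 : 11 ^ j * (3 * s ^ 2 - 11 * f ^ 2) = 11 ^ j * (11 * (-8 * 11 ^ i)) := by
          have : 11 ^ j = -f := by rw [hfj, neg_neg]
          rw [pow_add, pow_succ] at him
          linear_combination (3 * s ^ 2 - 11 * f ^ 2) * this - him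
        exact ⟨_, mul_left_cancel₀ h11 h1⟩
    subst hkj
    have h11 : (11 : ℤ) ^ k ≠ 0 := by positivity
    have hf2 : f ^ 2 = (11 ^ k) ^ 2 := by
      rcases hfj with hfj | hfj <;> rw [hfj]
      ring
    have hu : 3 * s ^ 2 - 11 * f ^ 2 = 8 ∨ 3 * s ^ 2 - 11 * f ^ 2 = -8 := by
      rcases hfj with hfj | hfj
      · left
        apply mul_left_cancel₀ h11
        rw [← hfj, him, hfj]; ring
      · right
        apply mul_left_cancel₀ h11
        have : 11 ^ k = -f := by rw [hfj, neg_neg]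
        linear_combination (3 * s ^ 2 - 11 * f ^ 2) * this - him
    have hu1 : 3 * s ^ 2 + 8 = 11 * (11 ^ k) ^ 2 := by omega
    have hk : k ≤ 1 := by
      apply le_one_of_three_mul_sq_add_eight_eq (u := s.natAbs)
      zify
      rw [sq_abs]
      exact hu1
    interval_cases k
    · left
      norm_num at hu1 hf2
      exact ⟨rfl, Or.inl (by omega)⟩
    · right
      norm_num at hu1 hf2
      exact ⟨rfl, by omega⟩

lemma prime_dvd_or_four_dvd {n : ℕ} (hn : 3 ≤ n) :
    4 ∣ n ∨ ∃ p, p.Prime ∧ 3 ≤ p ∧ p ∣ n := by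
  obtain ⟨s, m, hm, rfl⟩ := Nat.exists_eq_two_pow_mul_odd (n := n) (by omega)
  by_cases h1 : m = 1
  · subst h1
    left
    rw [mul_one] at hn ⊢
    have : 2 ≤ s := by
      by_contra hc
      interval_cases s <;> simp at hn
    exact pow_dvd_pow 2 this
  · right
    obtain ⟨p, hp, hpm⟩ := Nat.exists_prime_and_dvd h1
    refine ⟨p, hp, ?_, hpm.mul_left _⟩
    have hpo : Odd p := hm.of_dvd_nat hpm
    have := hp.two_le
    rcases hpo with ⟨c, rfl⟩
    omega

lemma even_of_sq_add_eleven_pow {x y l n : ℕ} (hn : 3 ≤ n) (h : x ^ 2 + 11 ^ l = y ^ n) :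
    Even x := by
  by_contra hx
  rw [Nat.not_even_iff_odd] at hx
  have h11 : ∀ l : ℕ, 11 ^ l % 8 = 1 ∨ 11 ^ l % 8 = 3 := by
    intro l
    induction l with
    | zero => left; rfl
    | succ l ih => rw [pow_succ]; omega
  have hx2 : x ^ 2 % 8 = 1 := by
    have h1 : x % 8 = 1 ∨ x % 8 = 3 ∨ x % 8 = 5 ∨ x % 8 = 7 := by
      have := Nat.odd_iff.1 hx
      omega
    rcases h1 with h1 | h1 | h1 | h1 <;> simp [Nat.pow_mod, h1]
  have hy : Even y := by
    have h1 : Even (y ^ n) := by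
      rw [← h]
      exact hx.pow.add_odd (Odd.pow (by decide))
    exact ((Nat.even_pow.1 h1).1)
  have h8 : 8 ∣ y ^ n := (pow_dvd_pow_of_dvd hy.two_dvd 3).trans (pow_dvd_pow y hn)
  have := h11 l
  omega

lemma sq_add_eleven_pow_ne_pow_four {x z l : ℕ} (hx : 0 < x) (hgcd : Nat.Coprime x z) :
    x ^ 2 + 11 ^ l ≠ z ^ 4 := by
  intro h
  have hlt : x < z ^ 2 := by
    by_contra! hc
    have : (z ^ 2) ^ 2 ≤ x ^ 2 := by gcongr
    have h1 : 0 < 11 ^ l := by positivity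
    rw [← pow_mul] at this
    norm_num at this
    omega
  obtain ⟨d, hd⟩ := Nat.exists_eq_add_of_lt hlt
  set D := d + 1 with hD
  have hmul : D * (2 * x + D) = 11 ^ l := by
    have : z ^ 4 = (x + D) ^ 2 := by rw [show z ^ 4 = (z ^ 2) ^ 2 by ring, hd, add_assoc]
    nlinarith
  have hcop : Nat.Coprime x D := by
    have h1 : Nat.Coprime x (z ^ 2) := hgcd.pow_right 2
    rw [hd, add_assoc] at h1
    simpa using h1
  have hD1 : D = 1 := by
    obtain ⟨i, hi, hDi⟩ := (Nat.dvd_prime_pow (by norm_num : Nat.Prime 11)).1 (Dvd.intro _ hmul)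
    obtain ⟨j, hj, hDj⟩ := (Nat.dvd_prime_pow (by norm_num : Nat.Prime 11)).1
      (Dvd.intro_left _ hmul)
    rcases i with _ | i
    · simpa using hDi
    · exfalso
      have h11D : 11 ∣ D := by rw [hDi]; exact dvd_pow_self 11 (by omega)
      have hj0 : j ≠ 0 := by
        rintro rfl
        rw [pow_zero] at hDj
        omega
      have h11j : 11 ∣ 2 * x + D := by rw [hDj]; exact dvd_pow_self 11 hj0
      have h11x : 11 ∣ x := by omega
      have := Nat.dvd_gcd h11x h11D
      rw [hcop] at this
      norm_num at this
  have hl : l ≠ 0 := by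
    rintro rfl
    rw [hD1] at hmul
    omega
  have h11 : 11 ∣ 2 * z ^ 2 - 1 := by
    have h1 : 2 * z ^ 2 - 1 = 11 ^ l := by
      rw [hd, add_assoc, ← hD, hD1]
      rw [hD1] at hmul
      omega
    rw [h1]
    exact dvd_pow_self 11 hl
  have hz2 : z ^ 2 % 11 = z % 11 * (z % 11) % 11 := by rw [pow_two, Nat.mul_mod]
  have hz := Nat.mod_lt z (by norm_num : 11 > 0)
  interval_cases z % 11 <;> omega

lemma sq_add_eleven_pow_ne_pow_prime {p : ℕ} (hp : p.Prime) (hp5 : 5 ≤ p) {x y l : ℕ} (hx : 0 < x)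
    (hxe : Even x) (hgcd : Nat.Coprime x y) : x ^ 2 + 11 ^ l ≠ y ^ p := by
  intro h
  have hZ : (x : ℤ) ^ 2 + 11 ^ l = (y : ℤ) ^ p := by exact_mod_cast h
  have hxZ : Even (x : ℤ) := by exact_mod_cast hxe
  have hc : IsCoprime (x : ℤ) y := Nat.isCoprime_iff_coprime.2 hgcd
  obtain ⟨k, rfl | rfl⟩ := Nat.even_or_odd' l
  · exact sq_add_eleven_pow_even_ne hp hp5 hxZ (by exact_mod_cast hx.ne') hc k hZ
  · exact sq_add_eleven_pow_odd_ne hp hp5 hxZ hc k hZ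

lemma eq_of_sq_add_eleven_pow_eq_cube {x y l : ℕ} (hx : 0 < x)
    (hxe : Even x) (hgcd : Nat.Coprime x y) (h : x ^ 2 + 11 ^ l = y ^ 3) :
    (x = 4 ∧ y = 3 ∧ l = 1) ∨ (x = 58 ∧ y = 15 ∧ l = 1) ∨ (x = 2 ∧ y = 5 ∧ l = 2) ∨
      (x = 9324 ∧ y = 443 ∧ l = 3) := by
  have hZ : (x : ℤ) ^ 2 + 11 ^ l = (y : ℤ) ^ 3 := by exact_mod_cast h
  have hxZ : Even (x : ℤ) := by exact_mod_cast hxe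
  have hc : IsCoprime (x : ℤ) y := Nat.isCoprime_iff_coprime.2 hgcd
  have hsq : ∀ t : ℕ, x ^ 2 = t ^ 2 → x = t := fun t ht => Nat.pow_left_injective two_ne_zero ht
  obtain ⟨k, rfl | rfl⟩ := Nat.even_or_odd' l
  · obtain ⟨rfl, -, hy⟩ :=
      eq_of_sq_add_eleven_pow_even_eq_cube hxZ (by exact_mod_cast hx.ne') hc hZ
    obtain rfl : y = 5 := by exact_mod_cast hy
    exact Or.inr (Or.inr (Or.inl ⟨hsq 2 (by omega), rfl, rfl⟩))
  · rcases eq_of_sq_add_eleven_pow_odd_eq_cube hxZ hc hZ with ⟨rfl, hy | hy⟩ | ⟨rfl, hy⟩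
    · obtain rfl : y = 3 := by exact_mod_cast hy
      exact Or.inl ⟨hsq 4 (by omega), rfl, rfl⟩
    · obtain rfl : y = 15 := by exact_mod_cast hy
      exact Or.inr (Or.inl ⟨hsq 58 (by omega), rfl, rfl⟩)
    · obtain rfl : y = 443 := by exact_mod_cast hy
      exact Or.inr (Or.inr (Or.inr ⟨hsq 9324 (by omega), rfl, rfl⟩))

lemma exponent_eq_one_of_pow_mem {y m : ℕ} (h : y ^ m = 3 ∨ y ^ m = 15 ∨ y ^ m = 5 ∨ y ^ m = 443) :
    m = 1 := by
  have h0 : m ≠ 0 := by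
    rintro rfl
    simp at h
  by_contra h1
  have h2 : 2 ≤ m := by omega
  have h3 : ∀ q : ℕ, q.Prime → q ∣ y ^ m → q ^ 2 ∣ y ^ m := fun q hq hd =>
    (pow_dvd_pow_of_dvd (hq.dvd_of_dvd_pow hd) 2).trans (pow_dvd_pow y h2)
  rcases h with h | h | h | h <;> rw [h] at h3
  · have := h3 3 (by norm_num) (by norm_num)
    norm_num at this
  · have := h3 3 (by norm_num) (by norm_num)
    norm_num at this
  · have := h3 5 (by norm_num) (by norm_num)
    norm_num at this
  · have := h3 443 (by norm_num) (by norm_num)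
    norm_num at this

theorem stmt_17 (x y l n : ℕ) (hx : 0 < x) (hy : 0 < y)
    (hgcd : Nat.gcd x y = 1) (hn : 3 ≤ n) :
    x ^ 2 + 11 ^ l = y ^ n ↔
      n = 3 ∧ (x, y, l) ∈ ({(4, 3, 1), (58, 15, 1), (2, 5, 2),
        (9324, 443, 3)} : Set (ℕ × ℕ × ℕ)) := by
  simp only [Set.mem_insert_iff, Set.mem_singleton_iff, Prod.mk.injEq]
  constructor
  · intro h
    have hxe := even_of_sq_add_eleven_pow hn h
    rcases prime_dvd_or_four_dvd hn with ⟨m, rfl⟩ | ⟨p, hp, hp3, m, rfl⟩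
    · rw [mul_comm, pow_mul] at h
      exact absurd h (sq_add_eleven_pow_ne_pow_four hx (Nat.Coprime.pow_right m hgcd))
    · rw [mul_comm, pow_mul] at h
      have hcop := Nat.Coprime.pow_right m hgcd
      rcases hp3.eq_or_lt with rfl | hp3
      · have h1 := eq_of_sq_add_eleven_pow_eq_cube hx hxe hcop h
        obtain rfl : m = 1 := exponent_eq_one_of_pow_mem (y := y) (by tauto)
        rw [pow_one] at h1
        exact ⟨rfl, h1⟩
      · have hp4 : p ≠ 4 := by
          rintro rfl
          norm_num at hp
        exact absurd h (sq_add_eleven_pow_ne_pow_prime hp (by omega) hx hxe hcop)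
  · rintro ⟨rfl, ⟨rfl, rfl, rfl⟩ | ⟨rfl, rfl, rfl⟩ | ⟨rfl, rfl, rfl⟩ | ⟨rfl, rfl, rfl⟩⟩ <;>
      norm_num
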